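/- Let Ω ⊂ ℝ² be a bounded strictly convex open set with smooth boundary of strictly positive curvature. Let f : ℝ → ℝ be real analytic and nondecreasing, and let u be a positive solution of the Dirichlet problem div(∇u/√(1+|∇u|²)) = f(u) in Ω, u = 0 on ∂Ω, real analytic in Ω and C² up to the closure of Ω. Let K = {x ∈ Ω : ∇u(x) = 0}, let X(x) = |∇u(x)|⁻² D²u(x)·(−∂₂u(x), ∂₁u(x)) for x ∈ (closure Ω) \ K, and define Z : closure Ω → ℝ² by Z = X/|X|² on (closure Ω) \ K and Z = 0 on K. Then there is a constant C > 0 such that |Z(x)| ≤ C |∇u(x)| for all x ∈ closure Ω, and Z is Lipschitz continuous on closure Ω: |Z(x₂) − Z(x₁)| ≤ C |x₂ − x₁| for all x₁, x₂ ∈ closure Ω. -/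

import Mathlib

open Set Metric

noncomputable section

/-- The coefficients `a_{ij}(p) = (1+|p|²)^{-1/2}(δ_{ij} − pᵢpⱼ/(1+|p|²))`
of the mean curvature operator. -/
def mcCoeff {n : ℕ} (p : EuclideanSpace ℝ (Fin n)) (i j : Fin n) : ℝ :=
  (Real.sqrt (1 + ‖p‖ ^ 2))⁻¹ * ((if i = j then 1 else 0) - p i * p j / (1 + ‖p‖ ^ 2))

/-- Second partial derivative `∂²u/∂xᵢ∂xⱼ`. -/
def hessEntry {n : ℕ} (u : EuclideanSpace ℝ (Fin n) → ℝ) (x : EuclideanSpace ℝ (Fin n))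
    (i j : Fin n) : ℝ :=
  iteratedFDeriv ℝ 2 u x ![EuclideanSpace.single i 1, EuclideanSpace.single j 1]

/-- The Hessian matrix `D²u(x)`. -/
def hessMatrix {n : ℕ} (u : EuclideanSpace ℝ (Fin n) → ℝ) (x : EuclideanSpace ℝ (Fin n)) :
    Matrix (Fin n) (Fin n) ℝ :=
  Matrix.of fun i j => hessEntry u x i j

/-- The mean curvature operator `L u = div(∇u/√(1+|∇u|²)) = Σ a_{ij}(∇u) ∂²u/∂xᵢ∂xⱼ`. -/
def meanCurv {n : ℕ} (u : EuclideanSpace ℝ (Fin n) → ℝ) (x : EuclideanSpace ℝ (Fin n)) : ℝ :=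
  ∑ i, ∑ j, mcCoeff (gradient u x) i j * hessEntry u x i j

/-- A solution of the Dirichlet problem `L u = f(u)` in `Ω`, `u = 0` on `∂Ω`:
`u ∈ C²(Ω) ∩ C(closure Ω)`. -/
def IsMCSolution {n : ℕ} (Ω : Set (EuclideanSpace ℝ (Fin n))) (f : ℝ → ℝ)
    (u : EuclideanSpace ℝ (Fin n) → ℝ) : Prop :=
  ContDiffOn ℝ 2 u Ω ∧ ContinuousOn u (closure Ω) ∧
    (∀ x ∈ Ω, meanCurv u x = f (u x)) ∧ (∀ x ∈ frontier Ω, u x = 0)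

/-- `Ω ⊆ ℝ²` has smooth boundary of strictly positive curvature: the boundary is
parametrized by a smooth periodic regular curve with positive signed curvature. -/
def SmoothPosCurvBoundary (Ω : Set (EuclideanSpace ℝ (Fin 2))) : Prop :=
  ∃ T > (0:ℝ), ∃ γ : ℝ → EuclideanSpace ℝ (Fin 2),
    ContDiff ℝ (⊤ : ℕ∞) γ ∧ Function.Periodic γ T ∧ range γ = frontier Ω ∧
    ∀ t : ℝ, deriv γ t ≠ 0 ∧
      0 < deriv γ t 0 * deriv (deriv γ) t 1 - deriv γ t 1 * deriv (deriv γ) t 0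

/-- The vector field `X(x) = |∇u(x)|⁻² D²u(x)·(−∂₂u(x), ∂₁u(x))`. -/
def Xfield (u : EuclideanSpace ℝ (Fin 2) → ℝ) (x : EuclideanSpace ℝ (Fin 2)) :
    EuclideanSpace ℝ (Fin 2) :=
  (‖gradient u x‖ ^ 2)⁻¹ •
    ((WithLp.equiv 2 (Fin 2 → ℝ)).symm
      ((hessMatrix u x).mulVec ![-(gradient u x 1), gradient u x 0]))

open scoped ContDiff Topology

local notation "𝔼" => EuclideanSpace ℝ (Fin 2)

/-- The derivative of `g` in the constant direction `d`. -/
def dirDeriv (d : 𝔼) (g : 𝔼 → ℝ) : 𝔼 → ℝ := fun x => fderiv ℝ g x d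

/-- The `i`-th partial derivative of `g`. -/
def pd (i : Fin 2) (g : 𝔼 → ℝ) : 𝔼 → ℝ := dirDeriv (EuclideanSpace.single i 1) g

lemma euclid_eq (d : 𝔼) :
    d = d 0 • EuclideanSpace.single (0 : Fin 2) (1 : ℝ) + d 1 • EuclideanSpace.single 1 1 := by
  ext i; fin_cases i <;> simp

lemma clm_apply_eq (A : 𝔼 →L[ℝ] ℝ) (d : 𝔼) :
    A d = d 0 * A (EuclideanSpace.single 0 1) + d 1 * A (EuclideanSpace.single 1 1) := by
  conv_lhs => rw [euclid_eq d]
  simp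

lemma fderiv_apply_eq (g : 𝔼 → ℝ) (x d : 𝔼) :
    fderiv ℝ g x d = d 0 * pd 0 g x + d 1 * pd 1 g x :=
  clm_apply_eq _ _

lemma dirDeriv_eq (d : 𝔼) (g : 𝔼 → ℝ) :
    dirDeriv d g = fun x => d 0 * pd 0 g x + d 1 * pd 1 g x :=
  funext fun x => fderiv_apply_eq g x d

lemma gradient_apply (g : 𝔼 → ℝ) (x : 𝔼) (i : Fin 2) : gradient g x i = pd i g x := by
  have h := inner_gradient_left (𝕜 := ℝ) (f := g) (x := x) (y := EuclideanSpace.single i (1 : ℝ))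
  rw [EuclideanSpace.inner_single_right] at h
  simpa [pd, dirDeriv] using h

lemma norm_sq_eq (d : 𝔼) : ‖d‖ ^ 2 = d 0 ^ 2 + d 1 ^ 2 := by
  simp [EuclideanSpace.norm_sq_eq, Fin.sum_univ_two]

lemma abs_apply_le (d : 𝔼) (i : Fin 2) : |d i| ≤ ‖d‖ := by
  simpa using PiLp.norm_apply_le d i

lemma inner_eq (d e : 𝔼) : inner ℝ d e = d 0 * e 0 + d 1 * e 1 := by
  simp [PiLp.inner_apply, Fin.sum_univ_two, mul_comm]

lemma norm_le_abs_add (d : 𝔼) : ‖d‖ ≤ |d 0| + |d 1| := by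
  refine abs_le_of_sq_le_sq' ?_ (by positivity) |>.2
  rw [norm_sq_eq, ← sq_abs (d 0), ← sq_abs (d 1)]
  nlinarith [abs_nonneg (d 0), abs_nonneg (d 1)]

lemma norm_gradient_sq (g : 𝔼 → ℝ) (x : 𝔼) :
    ‖gradient g x‖ ^ 2 = pd 0 g x ^ 2 + pd 1 g x ^ 2 := by
  rw [norm_sq_eq, gradient_apply, gradient_apply]

section rules

variable {g h : 𝔼 → ℝ} {x : 𝔼} {d : 𝔼}

lemma pd_add (hg : DifferentiableAt ℝ g x) (hh : DifferentiableAt ℝ h x) (i : Fin 2) :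
    pd i (fun y => g y + h y) x = pd i g x + pd i h x := by
  simp only [pd, dirDeriv]; rw [fderiv_fun_add hg hh]; rfl

lemma pd_sub (hg : DifferentiableAt ℝ g x) (hh : DifferentiableAt ℝ h x) (i : Fin 2) :
    pd i (fun y => g y - h y) x = pd i g x - pd i h x := by
  simp only [pd, dirDeriv]; rw [fderiv_fun_sub hg hh]; rfl

lemma pd_mul (hg : DifferentiableAt ℝ g x) (hh : DifferentiableAt ℝ h x) (i : Fin 2) :
    pd i (fun y => g y * h y) x = pd i g x * h x + g x * pd i h x := by
  simp only [pd, dirDeriv]; rw [fderiv_fun_mul hg hh]; simp; ring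

lemma pd_const_mul (hg : DifferentiableAt ℝ g x) (c : ℝ) (i : Fin 2) :
    pd i (fun y => c * g y) x = c * pd i g x := by
  simp only [pd, dirDeriv]; rw [fderiv_const_mul hg]; rfl

lemma pd_comp {ψ : ℝ → ℝ} {ψ' : ℝ} (hψ : HasDerivAt ψ ψ' (g x)) (hg : DifferentiableAt ℝ g x)
    (i : Fin 2) : pd i (fun y => ψ (g y)) x = ψ' * pd i g x := by
  have := hψ.comp_hasFDerivAt x hg.hasFDerivAt
  simp only [pd, dirDeriv]
  rw [show (fun y => ψ (g y)) = ψ ∘ g from rfl, this.fderiv]; simp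

lemma pd_congr {N : Set 𝔼} (hN : IsOpen N) (hgh : ∀ y ∈ N, g y = h y) (hx : x ∈ N) (i : Fin 2) :
    pd i g x = pd i h x := by
  simp only [pd, dirDeriv]
  rw [Filter.EventuallyEq.fderiv_eq (Filter.eventually_of_mem (hN.mem_nhds hx) hgh)]

lemma pd_pd_eq (hg : ContDiffAt ℝ 2 g x) (i j : Fin 2) : pd i (pd j g) x =
    fderiv ℝ (fderiv ℝ g) x (EuclideanSpace.single i 1) (EuclideanSpace.single j 1) := by
  have hd : DifferentiableAt ℝ (fderiv ℝ g) x :=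
    (hg.fderiv_right (m := 1) (by norm_num)).differentiableAt (by norm_num)
  change fderiv ℝ (fun y => fderiv ℝ g y (EuclideanSpace.single j 1)) x _ = _
  rw [fderiv_clm_apply hd (differentiableAt_const _)]; simp

lemma pd_comm (hg : ContDiffAt ℝ 2 g x) (i j : Fin 2) : pd i (pd j g) x = pd j (pd i g) x := by
  rw [pd_pd_eq hg, pd_pd_eq hg]
  exact (hg.isSymmSndFDerivAt (by simp)) _ _

lemma hessEntry_eq (hg : ContDiffAt ℝ 2 g x) (i j : Fin 2) :
    hessEntry g x i j = pd i (pd j g) x := by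
  rw [pd_pd_eq hg, hessEntry, iteratedFDeriv_two_apply]; rfl

end rules

lemma contDiffOn_pd {N : Set 𝔼} (hN : IsOpen N) {n m : WithTop ℕ∞} {g : 𝔼 → ℝ}
    (hg : ContDiffOn ℝ n g N) (hmn : m + 1 ≤ n) (i : Fin 2) : ContDiffOn ℝ m (pd i g) N :=
  (hg.fderiv_of_isOpen hN hmn).clm_apply contDiffOn_const

lemma contDiffOn_dirDeriv {N : Set 𝔼} (hN : IsOpen N) {n m : WithTop ℕ∞} {g : 𝔼 → ℝ}
    (hg : ContDiffOn ℝ n g N) (hmn : m + 1 ≤ n) (d : 𝔼) : ContDiffOn ℝ m (dirDeriv d g) N :=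
  (hg.fderiv_of_isOpen hN hmn).clm_apply contDiffOn_const

lemma smooth_pd {N : Set 𝔼} (hN : IsOpen N) {g : 𝔼 → ℝ} (hg : ContDiffOn ℝ ∞ g N) (i : Fin 2) :
    ContDiffOn ℝ ∞ (pd i g) N :=
  contDiffOn_pd hN hg (by simp) i

lemma smooth_dirDeriv {N : Set 𝔼} (hN : IsOpen N) {g : 𝔼 → ℝ} (hg : ContDiffOn ℝ ∞ g N) (d : 𝔼) :
    ContDiffOn ℝ ∞ (dirDeriv d g) N :=
  contDiffOn_dirDeriv hN hg (by simp) d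

lemma smooth_diffAt {N : Set 𝔼} (hN : IsOpen N) {g : 𝔼 → ℝ} (hg : ContDiffOn ℝ ∞ g N) {x : 𝔼}
    (hx : x ∈ N) : DifferentiableAt ℝ g x :=
  (hg.contDiffAt (hN.mem_nhds hx)).differentiableAt (by simp)

lemma smooth_pd_comm {N : Set 𝔼} (hN : IsOpen N) {g : 𝔼 → ℝ} (hg : ContDiffOn ℝ ∞ g N) {x : 𝔼}
    (hx : x ∈ N) (i j : Fin 2) : pd i (pd j g) x = pd j (pd i g) x :=
  pd_comm ((hg.contDiffAt (hN.mem_nhds hx)).of_le (by norm_cast)) i j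

/-- A polynomial form of the second-order part of the equation: the second derivative of `u` in the
direction tangent to its level lines. -/
def tangHess (u : 𝔼 → ℝ) (x : 𝔼) : ℝ :=
  pd 1 u x ^ 2 * pd 0 (pd 0 u) x - 2 * (pd 0 u x * pd 1 u x) * pd 0 (pd 1 u) x
    + pd 0 u x ^ 2 * pd 1 (pd 1 u) x

lemma meanCurv_eq {u : 𝔼 → ℝ} {x : 𝔼} (hu : ContDiffAt ℝ 2 u x) :
    (1 + pd 0 u x ^ 2 + pd 1 u x ^ 2) * √(1 + pd 0 u x ^ 2 + pd 1 u x ^ 2) * meanCurv u x =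
      pd 0 (pd 0 u) x + pd 1 (pd 1 u) x + tangHess u x := by
  have hS : 0 < 1 + pd 0 u x ^ 2 + pd 1 u x ^ 2 := by positivity
  have hs := Real.sqrt_pos.2 hS
  simp only [meanCurv, Fin.sum_univ_two, mcCoeff, hessEntry_eq hu, norm_gradient_sq,
    gradient_apply, tangHess, ← add_assoc, pd_comm hu 1 0]
  simp only [if_true, Fin.isValue, zero_ne_one, one_ne_zero, if_false]
  field_simp
  ring

/-- The Hessian quadratic form of `g` at `x`, evaluated at `d`. -/
def hessForm (g : 𝔼 → ℝ) (d x : 𝔼) : ℝ :=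
  d 0 ^ 2 * pd 0 (pd 0 g) x + 2 * (d 0 * d 1) * pd 0 (pd 1 g) x + d 1 ^ 2 * pd 1 (pd 1 g) x

lemma second_deriv_test {h : ℝ → ℝ} {a b : ℝ} (hC : ContDiffAt ℝ 2 h 0)
    (hle : ∀ᶠ t in 𝓝 (0 : ℝ), h t ≤ h 0 + a * t + b * t ^ 2) :
    deriv h 0 = a ∧ deriv (deriv h) 0 ≤ 2 * b := by
  set g : ℝ → ℝ := fun t => h t - (a * t + b * t ^ 2) with hg
  have hmax : IsLocalMax g 0 := by
    filter_upwards [hle] with t ht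
    simp only [hg]; linarith
  have hev : ∀ᶠ t in 𝓝 (0 : ℝ), deriv g t = deriv h t - (a + 2 * b * t) := by
    filter_upwards [hC.eventually (by simp)] with t ht
    have h1 : HasDerivAt h (deriv h t) t := (ht.differentiableAt (by simp)).hasDerivAt
    have h2 : HasDerivAt (fun t : ℝ => a * t + b * t ^ 2) (a + 2 * b * t) t := by
      exact (((hasDerivAt_id t).const_mul a).add ((hasDerivAt_pow 2 t).const_mul b)).congr_deriv
        (by push_cast; ring)
    exact (h1.sub h2).deriv
  have h0 : deriv g 0 = 0 := hmax.deriv_eq_zero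
  have hd : DifferentiableAt ℝ (deriv h) 0 := by
    have h1 : ContDiffAt ℝ 1 (fderiv ℝ h) 0 := hC.fderiv_right (by norm_num)
    exact (h1.differentiableAt (by simp)).clm_apply (differentiableAt_const _)
  have hdd : deriv (deriv g) 0 = deriv (deriv h) 0 - 2 * b := by
    rw [Filter.EventuallyEq.deriv_eq hev]
    have h2 : HasDerivAt (fun t : ℝ => a + 2 * b * t) (2 * b) 0 := by
      simpa using ((hasDerivAt_id (0 : ℝ)).const_mul (2 * b)).const_add a
    exact (hd.hasDerivAt.sub h2).deriv
  refine ⟨by have := hev.self_of_nhds; simp at this; linarith, ?_⟩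
  by_contra! hcon
  have hcont : ContinuousAt g 0 :=
    hC.continuousAt.sub (by fun_prop)
  have hmin := isLocalMin_of_deriv_deriv_pos (by rw [hdd]; linarith) h0 hcont
  have hconst : g =ᶠ[𝓝 0] fun _ => g 0 := by
    filter_upwards [hmax, hmin] with t h1 h2 using le_antisymm h1 h2
  have : deriv g =ᶠ[𝓝 0] fun _ => 0 := by
    have := hconst.deriv
    simpa using this
  have := this.deriv_eq
  simp at this
  linarith

lemma fderiv_fderiv_eq {g : 𝔼 → ℝ} {x : 𝔼} (hg : ContDiffAt ℝ 2 g x) (d e : 𝔼) :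
    fderiv ℝ (fderiv ℝ g) x d e = d 0 * e 0 * pd 0 (pd 0 g) x +
      (d 0 * e 1 + d 1 * e 0) * pd 0 (pd 1 g) x + d 1 * e 1 * pd 1 (pd 1 g) x := by
  have h10 := pd_comm hg 1 0
  rw [pd_pd_eq hg, pd_pd_eq hg] at h10
  rw [pd_pd_eq hg, pd_pd_eq hg, pd_pd_eq hg, clm_apply_eq (fderiv ℝ (fderiv ℝ g) x d) e]
  conv_lhs => rw [euclid_eq d]
  simp only [map_add, map_smul, _root_.add_apply, _root_.smul_apply,
    smul_eq_mul, h10]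
  ring

lemma contDiffAt_line {g : 𝔼 → ℝ} {x : 𝔼} (hg : ContDiffAt ℝ 2 g x) (d : 𝔼) :
    ContDiffAt ℝ 2 (fun t : ℝ => g (x + t • d)) 0 := by
  refine ContDiffAt.comp (0 : ℝ) (g := g) (by simpa using hg) (by fun_prop)

lemma hasDerivAt_line {g : 𝔼 → ℝ} {x : 𝔼} {d : 𝔼} {t : ℝ}
    (hg : DifferentiableAt ℝ g (x + t • d)) :
    HasDerivAt (fun t : ℝ => g (x + t • d)) (fderiv ℝ g (x + t • d) d) t := by
  have h1 : HasDerivAt (fun t : ℝ => x + t • d) d t := by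
    simpa using ((hasDerivAt_id t).smul_const d).const_add x
  exact hg.hasFDerivAt.comp_hasDerivAt t h1

lemma deriv_line {g : 𝔼 → ℝ} {x : 𝔼} (hg : ContDiffAt ℝ 2 g x) (d : 𝔼) :
    deriv (fun t : ℝ => g (x + t • d)) 0 = fderiv ℝ g x d := by
  have hx : x + (0 : ℝ) • d = x := by simp
  have := (hasDerivAt_line (t := 0) (d := d) (hx.symm ▸ hg.differentiableAt (by simp))).deriv
  simpa using this

lemma deriv_deriv_line {g : 𝔼 → ℝ} {x : 𝔼} (hg : ContDiffAt ℝ 2 g x) (d : 𝔼) :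
    deriv (deriv (fun t : ℝ => g (x + t • d))) 0 = hessForm g d x := by
  have hx : x + (0 : ℝ) • d = x := by simp
  have hcont : ContinuousAt (fun t : ℝ => x + t • d) 0 := by fun_prop
  have hev : ∀ᶠ t in 𝓝 (0 : ℝ), deriv (fun t : ℝ => g (x + t • d)) t =
      fderiv ℝ g (x + t • d) d := by
    have h1 : ∀ᶠ y in 𝓝 (x + (0 : ℝ) • d), ContDiffAt ℝ 2 g y := by
      rw [hx]; exact hg.eventually (by simp)
    filter_upwards [hcont.eventually h1] with t ht
    exact (hasDerivAt_line (ht.differentiableAt (by simp))).deriv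
  rw [Filter.EventuallyEq.deriv_eq hev]
  have hd : DifferentiableAt ℝ (fderiv ℝ g) (x + (0 : ℝ) • d) := by
    rw [hx]
    exact (hg.fderiv_right (m := 1) (by norm_num)).differentiableAt (by norm_num)
  have hf : HasFDerivAt (dirDeriv d g)
      ((fderiv ℝ (fderiv ℝ g) (x + (0 : ℝ) • d)).flip d) (x + (0 : ℝ) • d) := by
    exact (hd.hasFDerivAt.clm_apply (hasFDerivAt_const d _)).congr_fderiv (by ext z; simp)
  have h2 := (hasDerivAt_line hf.differentiableAt).deriv
  change deriv (fun t : ℝ => dirDeriv d g (x + t • d)) 0 = _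
  rw [h2, hf.fderiv, hx, ContinuousLinearMap.flip_apply, fderiv_fderiv_eq hg]
  simp only [hessForm]; ring

lemma line_test {g : 𝔼 → ℝ} {x d : 𝔼} {a b : ℝ} (hg : ContDiffAt ℝ 2 g x)
    (hle : ∀ᶠ t in 𝓝 (0 : ℝ), g (x + t • d) ≤ g x + a * t + b * t ^ 2) :
    fderiv ℝ g x d = a ∧ hessForm g d x ≤ 2 * b := by
  have := second_deriv_test (a := a) (b := b) (contDiffAt_line hg d) (by simpa using hle)
  rwa [deriv_line hg, deriv_deriv_line hg] at this

lemma line_test_sub {g : 𝔼 → ℝ} {x y d e : 𝔼} {a b : ℝ} (hx : ContDiffAt ℝ 2 g x)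
    (hy : ContDiffAt ℝ 2 g y)
    (hle : ∀ᶠ t in 𝓝 (0 : ℝ), g (x + t • d) - g (y + t • e) ≤ g x - g y + a * t + b * t ^ 2) :
    fderiv ℝ g x d - fderiv ℝ g y e = a ∧ hessForm g d x - hessForm g e y ≤ 2 * b := by
  have hX := contDiffAt_line hx d
  have hY := contDiffAt_line hy e
  have := (second_deriv_test (a := a) (b := b) (hX.sub hY) (by simpa using hle))
  have hev : deriv (fun t : ℝ => g (x + t • d) - g (y + t • e)) =ᶠ[𝓝 0]
      fun t => deriv (fun t : ℝ => g (x + t • d)) t - deriv (fun t : ℝ => g (y + t • e)) t := by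
    filter_upwards [hX.eventually (by simp), hY.eventually (by simp)] with t h1 h2
    exact deriv_fun_sub (h1.differentiableAt (by simp)) (h2.differentiableAt (by simp))
  have hd : ∀ {h : ℝ → ℝ}, ContDiffAt ℝ 2 h 0 → DifferentiableAt ℝ (deriv h) 0 := fun {h} hC =>
    ((ContDiffAt.fderiv_right (m := 1) hC (by norm_num)).differentiableAt (by simp)).clm_apply
      (differentiableAt_const _)
  rw [hev.deriv_eq, hev.self_of_nhds] at this
  beta_reduce at this
  have h3 := deriv_fun_sub (hd hX) (hd hY)
  rw [h3, deriv_deriv_line hx, deriv_deriv_line hy, deriv_line hx, deriv_line hy] at this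
  exact this

/-- The trace of the Hessian of `g` with respect to the coefficients `I + w wᵀ`. -/
def ellForm (g : 𝔼 → ℝ) (w x : 𝔼) : ℝ :=
  pd 0 (pd 0 g) x + pd 1 (pd 1 g) x + hessForm g w x

lemma norm_sub_add_smul_le {d ζ : 𝔼} (hd : 0 < ‖d‖) (t : ℝ) :
    ‖d + t • ζ‖ ≤ ‖d‖ + (inner ℝ d ζ / ‖d‖) * t + (‖ζ‖ ^ 2 / (2 * ‖d‖)) * t ^ 2 := by
  have h1 : ‖d + t • ζ‖ ^ 2 = ‖d‖ ^ 2 + 2 * t * inner ℝ d ζ + t ^ 2 * ‖ζ‖ ^ 2 := by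
    rw [norm_add_sq_real, inner_smul_right, norm_smul, mul_pow, Real.norm_eq_abs, sq_abs]; ring
  have h2 : ‖d + t • ζ‖ ≤ (‖d + t • ζ‖ ^ 2 + ‖d‖ ^ 2) / (2 * ‖d‖) := by
    rw [le_div_iff₀ (by positivity)]
    nlinarith [sq_nonneg (‖d + t • ζ‖ - ‖d‖)]
  refine h2.trans (le_of_eq ?_)
  rw [h1]; field_simp; ring

lemma clm_norm_le_of_apply {A : 𝔼 →L[ℝ] ℝ} {a : 𝔼} {C : ℝ} (h : ∀ ξ, A ξ = inner ℝ a ξ)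
    (ha : ‖a‖ ≤ C) : ‖A‖ ≤ C := by
  refine A.opNorm_le_bound ((norm_nonneg _).trans ha) fun ξ => ?_
  rw [h ξ]
  exact (norm_inner_le_norm a ξ).trans (by gcongr)

set_option maxHeartbeats 1000000 in
/-- One-sided boundary Lipschitz estimate by a quadratic barrier. -/
lemma boundary_barrier (B W C₀ M₀ δ : ℝ) (hB : 0 ≤ B) (hW : 0 ≤ W) (hC₀ : 0 ≤ C₀) (hM₀ : 0 ≤ M₀)
    (hδ : 0 < δ) (hBδ : B * δ ≤ 1 / 2) :
    ∃ C > 0, ∀ (Ω : Set 𝔼) (P : 𝔼 → ℝ) (w : 𝔼 → 𝔼) (x₀ ν g : 𝔼), IsOpen Ω →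
      ‖ν‖ = 1 → (∀ x ∈ closure Ω, 0 ≤ inner ℝ ν (x - x₀)) → ‖g‖ ≤ C₀ →
      ContinuousOn P (closure Ω ∩ closedBall x₀ δ) →
      (∀ x ∈ closure Ω ∩ closedBall x₀ δ, |P x| ≤ M₀) → |P x₀| ≤ M₀ →
      (∀ x ∈ Ω ∩ ball x₀ δ, ContDiffAt ℝ 2 P x ∧ ‖w x‖ ^ 2 ≤ W ∧
        -(B * (1 + ‖fderiv ℝ P x‖)) ≤ ellForm P (w x) x) →
      (∀ x ∈ frontier Ω ∩ closedBall x₀ δ,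
        P x ≤ P x₀ + inner ℝ g (x - x₀) + C₀ * ‖x - x₀‖ ^ 2) →
      ∀ x ∈ closure Ω ∩ closedBall x₀ δ, P x ≤ P x₀ + C * ‖x - x₀‖ := by
  set C : ℝ := C₀ + (2 * M₀ + C₀ * δ) / δ ^ 2 with hC
  have hC0 : C₀ ≤ C := by rw [hC]; have : 0 ≤ (2 * M₀ + C₀ * δ) / δ ^ 2 := by positivity
                          linarith
  have hCδ : 2 * M₀ + C₀ * δ ≤ C * δ ^ 2 := by
    rw [hC, add_mul, div_mul_cancel₀ _ (by positivity)]
    nlinarith [mul_nonneg hC₀ (sq_nonneg δ)]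
  have hCnn : 0 ≤ C := hC₀.trans hC0
  set M : ℝ := 2 * (2 * δ * C * (2 + W) + B * δ * (1 + C₀ + 2 * C * δ) + 2 * δ) with hM
  set N : ℝ := C * (2 + W) + B * (1 + C₀ + 2 * C * δ + M) / 2 + 1 with hN
  have hMpos : 0 < M := by positivity
  have hNpos : 0 < N := by positivity
  have hMN : 2 * N * δ ≤ M := by
    have : 2 * N * δ = M / 2 + B * δ * M := by rw [hN, hM]; ring
    nlinarith
  clear_value C M
  refine ⟨C₀ + C * δ + M, by positivity, ?_⟩
  intro Ω P w x₀ ν g hΩ hν hsupp hg hPc hPb hPx₀ hcond hbd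
  set ψ : 𝔼 → ℝ := fun x => P x₀ + inner ℝ g (x - x₀) + C * ‖x - x₀‖ ^ 2
    + M * inner ℝ ν (x - x₀) - N * (inner ℝ ν (x - x₀)) ^ 2 with hψ
  have hs : ∀ x ∈ closure Ω ∩ closedBall x₀ δ, 0 ≤ inner ℝ ν (x - x₀) ∧
      inner ℝ ν (x - x₀) ≤ ‖x - x₀‖ ∧ ‖x - x₀‖ ≤ δ := by
    rintro x ⟨hx, hxb⟩
    refine ⟨hsupp x hx, ?_, by simpa [dist_eq_norm] using hxb⟩
    simpa [hν] using real_inner_le_norm ν (x - x₀)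
  have hpos : ∀ x ∈ closure Ω ∩ closedBall x₀ δ,
      0 ≤ M * inner ℝ ν (x - x₀) - N * (inner ℝ ν (x - x₀)) ^ 2 := by
    intro x hx
    obtain ⟨h1, h2, h3⟩ := hs x hx
    have : 0 ≤ inner ℝ ν (x - x₀) * (M - N * inner ℝ ν (x - x₀)) := by
      apply mul_nonneg h1
      nlinarith
    nlinarith
  have hgx : ∀ x, |inner ℝ g (x - x₀)| ≤ C₀ * ‖x - x₀‖ := fun x =>
    (abs_real_inner_le_norm g _).trans (by gcongr)
  suffices hmain : ∀ x ∈ closure Ω ∩ closedBall x₀ δ, P x - ψ x ≤ 0 by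
    intro x hx
    obtain ⟨h1, h2, h3⟩ := hs x hx
    have h4 := hmain x hx
    have h5 := (abs_le.1 (hgx x)).2
    have h6 : C * ‖x - x₀‖ ^ 2 ≤ C * δ * ‖x - x₀‖ := by
      rw [pow_two, ← mul_assoc]; gcongr
    have h7 : M * inner ℝ ν (x - x₀) ≤ M * ‖x - x₀‖ := by gcongr
    have h8 : 0 ≤ N * (inner ℝ ν (x - x₀)) ^ 2 := by positivity
    simp only [hψ] at h4
    linarith
  have hcomp : IsCompact (closure Ω ∩ closedBall x₀ δ) :=
    (isCompact_closedBall x₀ δ).inter_left isClosed_closure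
  intro z hz
  obtain ⟨x, hx, hxmax⟩ := hcomp.exists_isMaxOn ⟨z, hz⟩
    (f := fun x => P x - ψ x) (hPc.sub (by simp only [hψ]; fun_prop))
  refine (hxmax hz).trans ?_
  by_contra! hcon
  have hψge : P x₀ + inner ℝ g (x - x₀) + C * ‖x - x₀‖ ^ 2 ≤ ψ x := by
    have := hpos x hx; simp only [hψ]; linarith
  have hxΩ : x ∈ Ω := by
    by_contra hxn
    have hfr : x ∈ frontier Ω := ⟨hx.1, by rwa [hΩ.interior_eq]⟩
    have h1 := hbd x ⟨hfr, hx.2⟩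
    have h2 : C₀ * ‖x - x₀‖ ^ 2 ≤ C * ‖x - x₀‖ ^ 2 := by gcongr
    linarith
  have hxb : x ∈ ball x₀ δ := by
    by_contra hxn
    have hn : ‖x - x₀‖ = δ := le_antisymm (hs x hx).2.2 (by simpa [dist_eq_norm] using hxn)
    have h1 := (abs_le.1 (hPb x hx)).2
    have h2 := (abs_le.1 hPx₀).1
    have h3 := (abs_le.1 (hgx x)).1
    rw [hn] at h3 hψge
    linarith
  obtain ⟨hC2, hw, hell⟩ := hcond x ⟨hxΩ, hxb⟩
  have hnhds : closure Ω ∩ closedBall x₀ δ ∈ 𝓝 x :=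
    Filter.mem_of_superset ((hΩ.inter isOpen_ball).mem_nhds ⟨hxΩ, hxb⟩)
      (inter_subset_inter subset_closure ball_subset_closedBall)
  set s : ℝ := inner ℝ ν (x - x₀) with hsdef
  set a : 𝔼 := g + (2 * C) • (x - x₀) + (M - 2 * N * s) • ν with ha
  have htest : ∀ ξ : 𝔼, fderiv ℝ P x ξ = inner ℝ a ξ ∧
      hessForm P ξ x ≤ 2 * (C * ‖ξ‖ ^ 2 - N * (inner ℝ ν ξ) ^ 2) := by
    intro ξ
    apply line_test hC2
    have hcont : Filter.Tendsto (fun t : ℝ => x + t • ξ) (𝓝 0) (𝓝 x) := by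
      have : ContinuousAt (fun t : ℝ => x + t • ξ) 0 := by fun_prop
      simpa [ContinuousAt] using this
    filter_upwards [hcont hnhds] with t ht
    have h1 : P (x + t • ξ) - ψ (x + t • ξ) ≤ P x - ψ x := hxmax ht
    have h2 : ψ (x + t • ξ) = ψ x + inner ℝ a ξ * t
        + (C * ‖ξ‖ ^ 2 - N * (inner ℝ ν ξ) ^ 2) * t ^ 2 := by
      have e1 : x + t • ξ - x₀ = (x - x₀) + t • ξ := by abel
      simp only [hψ, e1, norm_add_sq_real, inner_add_right, inner_smul_right, norm_smul, mul_pow,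
        Real.norm_eq_abs, sq_abs, ha, inner_add_left, inner_smul_left, ← hsdef]
      simp only [conj_trivial]
      ring
    linarith
  have hs' := hs x hx
  have hfd : ‖fderiv ℝ P x‖ ≤ C₀ + 2 * C * δ + M := by
    refine clm_norm_le_of_apply (fun ξ => (htest ξ).1) ?_
    have h1 : ‖(2 * C) • (x - x₀)‖ ≤ 2 * C * δ := by
      rw [norm_smul, Real.norm_eq_abs, abs_of_nonneg (by positivity)]
      have := hs'.2.2
      gcongr
    have h2 : ‖(M - 2 * N * s) • ν‖ ≤ M := by
      rw [norm_smul, hν, mul_one, Real.norm_eq_abs, abs_le]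
      have h3 : 0 ≤ 2 * N * s := mul_nonneg (by positivity) hs'.1
      have h4 : 2 * N * s ≤ 2 * N * δ := by
        have := hs'.2.1.trans hs'.2.2
        gcongr
      constructor <;> linarith
    calc ‖a‖ ≤ ‖g‖ + ‖(2 * C) • (x - x₀)‖ + ‖(M - 2 * N * s) • ν‖ := norm_add₃_le
      _ ≤ _ := by linarith
  have he0 := (htest (EuclideanSpace.single 0 1)).2
  have he1 := (htest (EuclideanSpace.single 1 1)).2
  have hww := (htest (w x)).2
  have hν2 : ν 0 ^ 2 + ν 1 ^ 2 = 1 := by rw [← norm_sq_eq, hν]; norm_num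
  simp only [hessForm, inner_eq] at he0 he1
  simp at he0 he1
  have h5 : 0 ≤ N * inner ℝ ν (w x) ^ 2 := by positivity
  have h6 : C * ‖w x‖ ^ 2 ≤ C * W := by gcongr
  have h7 : B * (1 + ‖fderiv ℝ P x‖) ≤ B * (1 + (C₀ + 2 * C * δ + M)) := by gcongr
  simp only [ellForm] at hell
  have h8 : N * ν 0 ^ 2 + N * ν 1 ^ 2 = N := by rw [← mul_add, hν2, mul_one]
  have h9 : 2 * N = 2 * (C * (2 + W)) + B * (1 + (C₀ + 2 * C * δ + M)) + 2 := by rw [hN]; ring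
  nlinarith

lemma hessForm_add_perp (g : 𝔼 → ℝ) (x : 𝔼) {e : 𝔼} (he : ‖e‖ = 1) :
    hessForm g e x + hessForm g !₂[-e 1, e 0] x = pd 0 (pd 0 g) x + pd 1 (pd 1 g) x := by
  have h : e 0 ^ 2 + e 1 ^ 2 = 1 := by rw [← norm_sq_eq, he]; norm_num
  simp only [hessForm]
  simp
  linear_combination (pd 0 (pd 0 g) x + pd 1 (pd 1 g) x) * h

lemma hessForm_neg (g : 𝔼 → ℝ) (x e : 𝔼) : hessForm g (-e) x = hessForm g e x := by
  simp [hessForm]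

set_option maxHeartbeats 1000000 in
/-- The second-order conditions at an interior maximum of the doubled functional are contradictory. -/
lemma doubling_contradiction {P : 𝔼 → ℝ} {x y wx wy : 𝔼} {M N L B : ℝ}
    (hPx : ContDiffAt ℝ 2 P x) (hPy : ContDiffAt ℝ 2 P y) (hr : 0 < ‖x - y‖) (hM : 1 ≤ M)
    (hN : N = L ^ 2 + 4 * B + 1) (hB : 0 ≤ B) (hrN : 4 * N * ‖x - y‖ ≤ 1)
    (hw : ‖wx - wy‖ ≤ L * ‖x - y‖)
    (hx : |ellForm P wx x| ≤ B * (1 + ‖fderiv ℝ P x‖))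
    (hy : |ellForm P wy y| ≤ B * (1 + ‖fderiv ℝ P y‖))
    (hmax : ∀ᶠ p in 𝓝 (x, y), P p.1 - P p.2 - M * (‖p.1 - p.2‖ - N * ‖p.1 - p.2‖ ^ 2) ≤
      P x - P y - M * (‖x - y‖ - N * ‖x - y‖ ^ 2)) : False := by
  set d := x - y with hd
  set r := ‖d‖ with hrdef
  have hN1 : 1 ≤ N := by rw [hN]; nlinarith [sq_nonneg L]
  have hline : ∀ ξ η : 𝔼, ∀ᶠ t in 𝓝 (0 : ℝ), P (x + t • ξ) - P (y + t • η) ≤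
      P x - P y + M * (‖d + t • (ξ - η)‖ - r - N * (2 * t * inner ℝ d (ξ - η)
        + t ^ 2 * ‖ξ - η‖ ^ 2)) := by
    intro ξ η
    have hcont : ContinuousAt (fun t : ℝ => (x + t • ξ, y + t • η)) 0 := by fun_prop
    have h0 : (x + (0 : ℝ) • ξ, y + (0 : ℝ) • η) = (x, y) := by simp
    filter_upwards [hcont.eventually (h0 ▸ hmax)] with t ht
    have e1 : x + t • ξ - (y + t • η) = d + t • (ξ - η) := by rw [hd, smul_sub]; abel
    have h1 : ‖d + t • (ξ - η)‖ ^ 2 = r ^ 2 + 2 * t * inner ℝ d (ξ - η)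
        + t ^ 2 * ‖ξ - η‖ ^ 2 := by
      rw [norm_add_sq_real, inner_smul_right, norm_smul, mul_pow, Real.norm_eq_abs, sq_abs]; ring
    simp only [e1, h1] at ht
    linarith
  have hT : ∀ ξ η : 𝔼, fderiv ℝ P x ξ - fderiv ℝ P y η = M * (1 / r - 2 * N) * inner ℝ d (ξ - η) ∧
      hessForm P ξ x - hessForm P η y ≤
        2 * (M * (‖ξ - η‖ ^ 2 / (2 * r) - N * ‖ξ - η‖ ^ 2)) := by
    intro ξ η
    apply line_test_sub hPx hPy
    filter_upwards [hline ξ η] with t ht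
    refine ht.trans ?_
    have h1 := norm_sub_add_smul_le hr t (ζ := ξ - η)
    have h2 := mul_le_mul_of_nonneg_left h1 (by linarith : 0 ≤ M)
    have e : M * (1 / r - 2 * N) * inner ℝ d (ξ - η) * t +
        M * (‖ξ - η‖ ^ 2 / (2 * r) - N * ‖ξ - η‖ ^ 2) * t ^ 2 =
        M * (r + inner ℝ d (ξ - η) / r * t + ‖ξ - η‖ ^ 2 / (2 * r) * t ^ 2) - M * r
        - M * N * (2 * t * inner ℝ d (ξ - η) + t ^ 2 * ‖ξ - η‖ ^ 2) := by ring
    linarith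
  set e : 𝔼 := r⁻¹ • d with he
  have hen : ‖e‖ = 1 := by rw [he, norm_smul, norm_inv, norm_norm]; exact inv_mul_cancel₀ hr.ne'
  have hde : d = r • e := by rw [he, smul_smul, mul_inv_cancel₀ hr.ne', one_smul]
  have hin : inner ℝ d e = r := by
    rw [hde, inner_smul_left, real_inner_self_eq_norm_sq, hen]; simp
  have hT2 : hessForm P e x - hessForm P (-e) y ≤ 2 * (-4 * M * N) := by
    refine (line_test_sub (a := 2 * M * (1 - 2 * N * r)) hPx hPy ?_).2
    filter_upwards [hline e (-e), Ioi_mem_nhds (show -(r / 2) < (0 : ℝ) by linarith)] with t ht htr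
    refine ht.trans (le_of_eq ?_)
    have e1 : e - -e = (2 : ℝ) • e := by rw [two_smul]; abel
    have e2 : ‖d + t • (2 : ℝ) • e‖ = r + 2 * t := by
      have : d + t • (2 : ℝ) • e = (r + 2 * t) • e := by
        rw [add_smul, ← hde, mul_comm, ← smul_smul]
      rw [this, norm_smul, hen, mul_one, Real.norm_eq_abs, abs_of_pos]
      have : -(r / 2) < t := htr
      linarith
    rw [e1, e2, inner_smul_right, hin, norm_smul, hen]
    norm_num; ring
  rw [hessForm_neg] at hT2
  have hT3 := (hT !₂[-e 1, e 0] !₂[-e 1, e 0]).2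
  have hT4 := (hT wx wy).2
  have hc : 0 ≤ 1 / r - 2 * N := by
    rw [sub_nonneg, le_div_iff₀ hr]; nlinarith
  have hfd : ‖(M * (1 / r - 2 * N)) • d‖ ≤ M := by
    rw [norm_smul, Real.norm_eq_abs, abs_of_nonneg (by positivity)]
    change M * (1 / r - 2 * N) * r ≤ M
    have : M * (1 / r - 2 * N) * r = M - 2 * (M * N * r) := by field_simp
    have : 0 ≤ M * N * r := by positivity
    linarith
  have hfx : ‖fderiv ℝ P x‖ ≤ M := clm_norm_le_of_apply (fun ξ => by
    have := (hT ξ 0).1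
    rw [map_zero, sub_zero, sub_zero] at this
    rw [this, inner_smul_left]; simp) hfd
  have hfy : ‖fderiv ℝ P y‖ ≤ M := clm_norm_le_of_apply (fun ξ => by
    have := (hT 0 ξ).1
    rw [map_zero, zero_sub, zero_sub, inner_neg_right] at this
    rw [inner_smul_left, conj_trivial]; linarith) hfd
  have h4 : ‖wx - wy‖ ^ 2 / (2 * r) ≤ L ^ 2 / 2 := by
    rw [div_le_iff₀ (by positivity)]
    have h5 : ‖wx - wy‖ ^ 2 ≤ (L * r) ^ 2 := by gcongr
    have h6 : L ^ 2 * (r * r) ≤ L ^ 2 * r := by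
      have : r ≤ 1 := by nlinarith
      gcongr; nlinarith
    nlinarith
  have hx' := (abs_le.1 hx).1
  have hy' := (abs_le.1 hy).2
  simp only [ellForm] at hx' hy'
  rw [← hessForm_add_perp P x hen] at hx'
  rw [← hessForm_add_perp P y hen] at hy'
  have hbx : B * (1 + ‖fderiv ℝ P x‖) ≤ B * (1 + M) := by gcongr
  have hby : B * (1 + ‖fderiv ℝ P y‖) ≤ B * (1 + M) := by gcongr
  have h7 : 2 * (M * (‖wx - wy‖ ^ 2 / (2 * r) - N * ‖wx - wy‖ ^ 2)) ≤ M * L ^ 2 := by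
    have h8 : 0 ≤ N * ‖wx - wy‖ ^ 2 := by positivity
    have := mul_le_mul_of_nonneg_left (show ‖wx - wy‖ ^ 2 / (2 * r) - N * ‖wx - wy‖ ^ 2 ≤ L ^ 2 / 2
      by linarith) (by linarith : 0 ≤ M)
    linarith
  simp only [sub_self, norm_zero] at hT3
  norm_num at hT3
  have h9 : 8 * M * N = 8 * M * L ^ 2 + 32 * (M * B) + 8 * M := by rw [hN]; ring
  have h10 : B ≤ M * B := by nlinarith
  have h11 : 0 ≤ M * L ^ 2 := by positivity
  nlinarith

lemma doubling {E O : Set 𝔼} {P : 𝔼 → ℝ} {w : 𝔼 → 𝔼} {L B C₁ δ₀ : ℝ} (hE : IsCompact E)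
    (hO : IsOpen O) (hOE : O ⊆ E) (hPc : ContinuousOn P E) (hB : 0 ≤ B)
    (hC₁ : 0 ≤ C₁) (hδ₀ : 0 < δ₀)
    (hcond : ∀ x ∈ O, ContDiffAt ℝ 2 P x ∧ |ellForm P (w x) x| ≤ B * (1 + ‖fderiv ℝ P x‖))
    (hw : ∀ x ∈ O, ∀ y ∈ O, ‖w x - w y‖ ≤ L * ‖x - y‖)
    (hbd : ∀ x ∈ E, ∀ y ∈ E, ‖x - y‖ ≤ δ₀ → (x ∉ O ∨ y ∉ O) → |P x - P y| ≤ C₁ * ‖x - y‖) :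
    ∃ M ≥ 0, ∃ δ > 0, ∀ x ∈ E, ∀ y ∈ E, ‖x - y‖ ≤ δ → |P x - P y| ≤ M * ‖x - y‖ := by
  obtain ⟨M₀, hM₀⟩ := hE.exists_bound_of_continuousOn hPc
  have hM₀' : ∀ x ∈ E, |P x| ≤ |M₀| := fun x hx => (hM₀ x hx).trans (le_abs_self _)
  obtain ⟨N, hN⟩ : ∃ N, N = L ^ 2 + 4 * B + 1 := ⟨_, rfl⟩
  have hN1 : 1 ≤ N := by rw [hN]; nlinarith [sq_nonneg L]
  obtain ⟨δ, hδ, hδ0, hδN⟩ : ∃ δ > 0, δ ≤ δ₀ ∧ 4 * N * δ ≤ 1 := by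
    refine ⟨min δ₀ (1 / (4 * N)), by positivity, min_le_left _ _, ?_⟩
    calc 4 * N * min δ₀ (1 / (4 * N)) ≤ 4 * N * (1 / (4 * N)) := by gcongr; exact min_le_right _ _
      _ = 1 := by field_simp
  obtain ⟨M, hM1, hMC, hMδ⟩ : ∃ M, 1 ≤ M ∧ 2 * C₁ ≤ M ∧ 4 * |M₀| < M * δ := by
    refine ⟨1 + 2 * C₁ + 4 * |M₀| / δ, ?_, ?_, ?_⟩
    · have : 0 ≤ 4 * |M₀| / δ := by positivity
      linarith
    · have : 0 ≤ 4 * |M₀| / δ := by positivity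
      linarith
    · rw [add_mul, div_mul_cancel₀ _ hδ.ne']; nlinarith
  have hφ : ∀ r, 0 ≤ r → r ≤ δ → 3 / 4 * (M * r) ≤ M * (r - N * r ^ 2) := by
    intro r h0 h1
    have : 4 * N * r ≤ 1 := le_trans (by gcongr) hδN
    have : M * r * (4 * N * r) ≤ M * r * 1 := by gcongr
    nlinarith
  have key : ∀ x ∈ E, ∀ y ∈ E, ‖x - y‖ ≤ δ →
      P x - P y - M * (‖x - y‖ - N * ‖x - y‖ ^ 2) ≤ 0 := by
    set S : Set (𝔼 × 𝔼) := (E ×ˢ E) ∩ {p | ‖p.1 - p.2‖ ≤ δ} with hS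
    have hScomp : IsCompact S :=
      (hE.prod hE).inter_right (isClosed_le (by fun_prop) continuous_const)
    intro x₁ hx₁ y₁ hy₁ hxy₁
    have hc : ContinuousOn (fun p : 𝔼 × 𝔼 => P p.1 - P p.2 -
        M * (‖p.1 - p.2‖ - N * ‖p.1 - p.2‖ ^ 2)) S := by
      refine ContinuousOn.sub (ContinuousOn.sub ?_ ?_) (by fun_prop)
      · exact hPc.comp continuousOn_fst fun p hp => hp.1.1
      · exact hPc.comp continuousOn_snd fun p hp => hp.1.2
    obtain ⟨⟨x, y⟩, ⟨⟨hx, hy⟩, hxy⟩, hmax⟩ := hScomp.exists_isMaxOn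
      ⟨(x₁, y₁), ⟨hx₁, hy₁⟩, hxy₁⟩ hc
    refine (hmax (show (x₁, y₁) ∈ S from ⟨⟨hx₁, hy₁⟩, hxy₁⟩)).trans ?_
    by_contra! hcon
    simp only at hx hy hxy hcon hmax
    have hxy' : ‖x - y‖ ≤ δ := hxy
    have hφr := hφ _ (norm_nonneg (x - y)) hxy'
    have hOO : x ∈ O ∧ y ∈ O := by
      by_contra hn
      have h1 := (abs_le.1 (hbd x hx y hy (hxy'.trans hδ0) (by tauto))).2
      have h2 : 2 * C₁ * ‖x - y‖ ≤ M * ‖x - y‖ := by gcongr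
      have : 0 ≤ M * ‖x - y‖ := by positivity
      linarith
    have hr : 0 < ‖x - y‖ := by
      rw [norm_pos_iff, sub_ne_zero]
      rintro rfl
      simp at hcon
    have hrδ : ‖x - y‖ < δ := by
      refine lt_of_le_of_ne hxy' fun h => ?_
      rw [h] at hφr hcon
      have h1 := (abs_le.1 (hM₀' x hx)).2
      have h2 := (abs_le.1 (hM₀' y hy)).1
      have := abs_nonneg M₀
      linarith
    have hmax' : ∀ᶠ p in 𝓝 (x, y), P p.1 - P p.2 - M * (‖p.1 - p.2‖ - N * ‖p.1 - p.2‖ ^ 2) ≤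
        P x - P y - M * (‖x - y‖ - N * ‖x - y‖ ^ 2) := by
      have h1 : {p : 𝔼 × 𝔼 | ‖p.1 - p.2‖ < δ} ∈ 𝓝 (x, y) :=
        (isOpen_lt (by fun_prop) continuous_const).mem_nhds hrδ
      filter_upwards [h1, prod_mem_nhds (hO.mem_nhds hOO.1) (hO.mem_nhds hOO.2)] with p hp1 hp2
      exact hmax (show p ∈ S from ⟨⟨hOE hp2.1, hOE hp2.2⟩, hp1.le⟩)
    exact doubling_contradiction (hcond x hOO.1).1 (hcond y hOO.2).1 hr hM1 hN hB
      (le_trans (by gcongr) hδN) (hw x hOO.1 y hOO.2) (hcond x hOO.1).2 (hcond y hOO.2).2 hmax'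
  refine ⟨M, by linarith, δ, hδ, fun x hx y hy hxy => ?_⟩
  have h1 := key x hx y hy hxy
  have h2 := key y hy x hx (by rwa [norm_sub_rev])
  rw [norm_sub_rev y x] at h2
  have h3 : 0 ≤ M * (N * ‖x - y‖ ^ 2) := by positivity
  rw [abs_le]; constructor <;> linarith

/-- The gradient rotated by a right angle. -/
def perpGrad (u : 𝔼 → ℝ) (x : 𝔼) : 𝔼 := !₂[-pd 1 u x, pd 0 u x]

@[simp] lemma perpGrad_zero (u : 𝔼 → ℝ) (x : 𝔼) : perpGrad u x 0 = -pd 1 u x := by simp [perpGrad]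

@[simp] lemma perpGrad_one (u : 𝔼 → ℝ) (x : 𝔼) : perpGrad u x 1 = pd 0 u x := by simp [perpGrad]

lemma hessForm_perpGrad (u : 𝔼 → ℝ) (x : 𝔼) : hessForm u (perpGrad u x) x = tangHess u x := by
  simp only [hessForm, tangHess, perpGrad_zero, perpGrad_one]; ring

/-- The right-hand side of the equation written as `Δu + tangHess u = mcRhs f u`. -/
def mcRhs (f : ℝ → ℝ) (u : 𝔼 → ℝ) (x : 𝔼) : ℝ :=
  (1 + pd 0 u x ^ 2 + pd 1 u x ^ 2) * √(1 + pd 0 u x ^ 2 + pd 1 u x ^ 2) * f (u x)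

lemma pd_neg (g : 𝔼 → ℝ) (i : Fin 2) : pd i (fun y => -g y) = fun y => -pd i g y := by
  funext y; simp only [pd, dirDeriv]; rw [fderiv_fun_neg]; rfl

lemma hessForm_fun_neg (g : 𝔼 → ℝ) (d x : 𝔼) : hessForm (fun y => -g y) d x = -hessForm g d x := by
  simp only [hessForm, pd_neg]; ring

lemma ellForm_fun_neg (g : 𝔼 → ℝ) (d x : 𝔼) : ellForm (fun y => -g y) d x = -ellForm g d x := by
  simp only [ellForm, hessForm_fun_neg, pd_neg]; ring

/-- Weak maximum principle. -/
lemma weak_max {O : Set 𝔼} {v : 𝔼 → ℝ} {w : 𝔼 → 𝔼} {β : ℝ} (hO : IsOpen O)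
    (hOb : Bornology.IsBounded O) (hβ : 0 ≤ β) (hvc : ContinuousOn v (closure O))
    (hv : ∀ x ∈ O, ContDiffAt ℝ 2 v x ∧ -(β * ‖fderiv ℝ v x‖) ≤ ellForm v (w x) x)
    (hfr : ∀ x ∈ frontier O, v x ≤ 0) : ∀ x ∈ O, v x ≤ 0 := by
  obtain ⟨R, hR⟩ := hOb.closure.exists_norm_le
  set M : ℝ := 2 * β + 1 with hM
  have hMpos : 0 < M := by positivity
  have key : ∀ ε > 0, ∀ y ∈ O, v y ≤ ε * Real.exp (M * R) := by
    intro ε hε y hy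
    obtain ⟨x, hx, hmax⟩ := hOb.isCompact_closure.exists_isMaxOn ⟨y, subset_closure hy⟩
      (f := fun x => v x + ε * Real.exp (M * x 0)) (hvc.add (by fun_prop))
    have h1 : v y + ε * Real.exp (M * y 0) ≤ v x + ε * Real.exp (M * x 0) :=
      hmax (subset_closure hy)
    have h2 : 0 < ε * Real.exp (M * y 0) := by positivity
    have h3 : ε * Real.exp (M * x 0) ≤ ε * Real.exp (M * R) := by
      have := (le_abs_self (x 0)).trans ((abs_apply_le x 0).trans (hR x hx))
      gcongr
    by_cases hxO : x ∈ O
    swap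
    · have := hfr x ⟨hx, by rwa [hO.interior_eq]⟩
      linarith
    exfalso
    obtain ⟨hC, hell⟩ := hv x hxO
    set E := Real.exp (M * x 0) with hE
    have hEpos : 0 < E := Real.exp_pos _
    have htest : ∀ ξ : 𝔼, fderiv ℝ v x ξ = -(ε * E * M * ξ 0) ∧
        hessForm v ξ x ≤ 2 * (-(ε * E * (M * ξ 0) ^ 2 / 4)) := by
      intro ξ
      apply line_test hC
      have hcont : Filter.Tendsto (fun t : ℝ => x + t • ξ) (𝓝 0) (𝓝 x) := by
        have : ContinuousAt (fun t : ℝ => x + t • ξ) 0 := by fun_prop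
        simpa [ContinuousAt] using this
      have hsm : ∀ᶠ t in 𝓝 (0 : ℝ), 0 < 1 + M * (t * ξ 0) / 2 := by
        have : ContinuousAt (fun t : ℝ => 1 + M * (t * ξ 0) / 2) 0 := by fun_prop
        exact this.eventually (lt_mem_nhds (by simp))
      filter_upwards [hcont (hO.mem_nhds hxO), hsm] with t ht ht2
      have h4 : v (x + t • ξ) + ε * Real.exp (M * (x + t • ξ) 0) ≤ v x + ε * E :=
        hmax (subset_closure ht)
      have h5 : Real.exp (M * (x + t • ξ) 0) = E * Real.exp (M * (t * ξ 0) / 2) ^ 2 := by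
        rw [hE, ← Real.exp_nat_mul, ← Real.exp_add]; congr 1; simp; ring
      have h6 : (1 + M * (t * ξ 0) / 2) ^ 2 ≤ Real.exp (M * (t * ξ 0) / 2) ^ 2 := by
        have := Real.add_one_le_exp (M * (t * ξ 0) / 2)
        gcongr; linarith
      have h7 : ε * (E * (1 + M * (t * ξ 0) / 2) ^ 2) ≤
          ε * (E * Real.exp (M * (t * ξ 0) / 2) ^ 2) := by gcongr
      rw [h5] at h4
      nlinarith
    have hfd : ‖fderiv ℝ v x‖ ≤ ε * E * M := by
      refine ContinuousLinearMap.opNorm_le_bound _ (by positivity) fun ξ => ?_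
      rw [(htest ξ).1, norm_neg, Real.norm_eq_abs, abs_mul, abs_of_pos (by positivity)]
      have := abs_apply_le ξ 0
      gcongr
    have he0 := (htest (EuclideanSpace.single 0 1)).2
    have he1 := (htest (EuclideanSpace.single 1 1)).2
    have hww := (htest (w x)).2
    simp only [hessForm] at he0 he1
    simp at he0 he1
    have h8 : 0 ≤ ε * E * (M * w x 0) ^ 2 := by positivity
    have h9 : β * ‖fderiv ℝ v x‖ ≤ β * (ε * E * M) := by gcongr
    simp only [ellForm] at hell
    have h10 : ε * E * M ^ 2 = 2 * (β * (ε * E * M)) + ε * E * M := by rw [hM]; ring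
    have h11 : 0 < ε * E * M := by positivity
    linarith
  intro y hy
  by_contra! hcon
  have := key (v y / (2 * Real.exp (M * R))) (by positivity) y hy
  have h2 : v y / (2 * Real.exp (M * R)) * Real.exp (M * R) = v y / 2 := by field_simp
  linarith

/-- A positive solution of the Dirichlet problem on a strictly convex planar domain whose boundary
is parametrized by `γ`. -/
structure MCSetting (Ω V : Set 𝔼) (f : ℝ → ℝ) (u : 𝔼 → ℝ) (γ : ℝ → 𝔼) (T : ℝ) : Prop where
  nonempty : Ω.Nonempty
  isOpen : IsOpen Ω
  bdd : Bornology.IsBounded Ω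
  sconv : StrictConvex ℝ (closure Ω)
  fsmooth : ContDiff ℝ ∞ f
  fmono : Monotone f
  upos : ∀ x ∈ Ω, 0 < u x
  uzero : ∀ x ∈ frontier Ω, u x = 0
  uan : AnalyticOnNhd ℝ u Ω
  isOpenV : IsOpen V
  subV : closure Ω ⊆ V
  contDiffV : ContDiffOn ℝ 2 u V
  eqn : ∀ x ∈ closure Ω, pd 0 (pd 0 u) x + pd 1 (pd 1 u) x + tangHess u x = mcRhs f u x
  Tpos : 0 < T
  γsmooth : ContDiff ℝ ∞ γ
  γper : Function.Periodic γ T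
  γrange : range γ = frontier Ω
  γderiv : ∀ t, deriv γ t ≠ 0
  γcurv : ∀ t, 0 < deriv γ t 0 * deriv (deriv γ) t 1 - deriv γ t 1 * deriv (deriv γ) t 0

namespace MCSetting

variable {Ω V : Set 𝔼} {f : ℝ → ℝ} {u : 𝔼 → ℝ} {γ : ℝ → 𝔼} {T : ℝ}

lemma contDiffAt (S : MCSetting Ω V f u γ T) {x : 𝔼} (hx : x ∈ closure Ω) : ContDiffAt ℝ 2 u x :=
  S.contDiffV.contDiffAt (S.isOpenV.mem_nhds (S.subV hx))

lemma frontier_sub (_ : MCSetting Ω V f u γ T) : frontier Ω ⊆ closure Ω := frontier_subset_closure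

lemma mem_frontier (S : MCSetting Ω V f u γ T) {x : 𝔼} (hx : x ∈ closure Ω) (hn : x ∉ Ω) :
    x ∈ frontier Ω := ⟨hx, by rwa [S.isOpen.interior_eq]⟩

lemma smooth (S : MCSetting Ω V f u γ T) : ContDiffOn ℝ ∞ u Ω :=
  S.uan.contDiffOn S.isOpen.uniqueDiffOn

lemma unonneg (S : MCSetting Ω V f u γ T) {x : 𝔼} (hx : x ∈ closure Ω) : 0 ≤ u x := by
  by_cases h : x ∈ Ω
  · exact (S.upos x h).le
  · exact (S.uzero x (S.mem_frontier hx h)).ge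

lemma γmem (S : MCSetting Ω V f u γ T) (t : ℝ) : γ t ∈ frontier Ω := S.γrange ▸ mem_range_self t

lemma f_zero_neg (S : MCSetting Ω V f u γ T) : f 0 < 0 := by
  by_contra! h
  obtain ⟨x, hx⟩ := S.nonempty
  refine (S.upos x hx).not_ge (weak_max (β := 0) (w := perpGrad u) S.isOpen S.bdd le_rfl
    (fun y hy => (S.contDiffAt hy).continuousAt.continuousWithinAt)
    (fun y hy => ⟨S.contDiffAt (subset_closure hy), ?_⟩) (fun y hy => (S.uzero y hy).le) x hx)
  rw [ellForm, hessForm_perpGrad, S.eqn y (subset_closure hy), mcRhs]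
  have : 0 ≤ f (u y) := h.trans (S.fmono (S.upos y hy).le)
  simp only [zero_mul, neg_zero]
  positivity

lemma trace_neg (S : MCSetting Ω V f u γ T) {x : 𝔼} (hx : x ∈ frontier Ω) (h0 : fderiv ℝ u x = 0) :
    pd 0 (pd 0 u) x + pd 1 (pd 1 u) x < 0 := by
  have h := S.eqn x (S.frontier_sub hx)
  have e0 : pd 0 u x = 0 := by simp [pd, dirDeriv, h0]
  have e1 : pd 1 u x = 0 := by simp [pd, dirDeriv, h0]
  simp [tangHess, mcRhs, e0, e1, S.uzero x hx] at h
  have := S.f_zero_neg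
  linarith

lemma interior_closure (S : MCSetting Ω V f u γ T) : interior (closure Ω) = Ω := by
  refine Subset.antisymm (fun x hx => ?_) (interior_maximal subset_closure S.isOpen)
  by_contra hn
  have hcl := interior_subset hx
  have hfr := S.mem_frontier hcl hn
  have htest : ∀ ξ : 𝔼, fderiv ℝ (fun y => -u y) x ξ = 0 ∧ hessForm (fun y => -u y) ξ x ≤ 2 * 0 := by
    intro ξ
    apply line_test (S.contDiffAt hcl).neg
    have hcont : Filter.Tendsto (fun t : ℝ => x + t • ξ) (𝓝 0) (𝓝 x) := by
      have : ContinuousAt (fun t : ℝ => x + t • ξ) 0 := by fun_prop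
      simpa [ContinuousAt] using this
    filter_upwards [hcont (isOpen_interior.mem_nhds hx)] with t ht
    have := S.unonneg (interior_subset ht)
    rw [S.uzero x hfr]
    linarith
  have h0 : fderiv ℝ u x = 0 := by
    ext ξ
    have := (htest ξ).1
    rw [fderiv_fun_neg] at this
    simpa using this
  have h1 := S.trace_neg hfr h0
  have he0 := (htest (EuclideanSpace.single 0 1)).2
  have he1 := (htest (EuclideanSpace.single 1 1)).2
  rw [hessForm_fun_neg] at he0 he1
  simp only [hessForm] at he0 he1
  simp at he0 he1
  linarith

lemma convex (S : MCSetting Ω V f u γ T) : Convex ℝ Ω := by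
  rw [← S.interior_closure]; exact S.sconv.convex.interior

lemma segment_mem (S : MCSetting Ω V f u γ T) {x y : 𝔼} (hx : x ∈ closure Ω) (hy : y ∈ closure Ω)
    {t : ℝ} (h0 : 0 ≤ t) (h1 : t ≤ 1) : x + t • (y - x) ∈ closure Ω :=
  S.sconv.convex.add_smul_sub_mem hx hy ⟨h0, h1⟩

/-- The derivative of `u` at a boundary point in an inward direction is nonnegative. -/
lemma fderiv_nonneg (S : MCSetting Ω V f u γ T) {x y : 𝔼} (hx : x ∈ frontier Ω)
    (hy : y ∈ closure Ω) : 0 ≤ fderiv ℝ u x (y - x) := by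
  have hx' := S.frontier_sub hx
  have hd := (hasDerivAt_line (t := 0) (x := x) (d := y - x) (g := u)
    (by simpa using (S.contDiffAt hx').differentiableAt (by simp))).tendsto_slope_zero_right
  simp only [zero_smul, add_zero, zero_add] at hd
  refine ge_of_tendsto hd ?_
  filter_upwards [Ioc_mem_nhdsGT (zero_lt_one' ℝ)] with t ht
  have := S.unonneg (S.segment_mem hx' hy ht.1.le ht.2)
  rw [S.uzero x hx, sub_zero, smul_eq_mul]
  have := ht.1
  positivity

/-- The second derivative of `u` at a critical boundary point is nonnegative in inward directions. -/
lemma hessForm_nonneg (S : MCSetting Ω V f u γ T) {x y : 𝔼} (hx : x ∈ frontier Ω)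
    (hy : y ∈ closure Ω) (h0 : fderiv ℝ u x = 0) : 0 ≤ hessForm u (y - x) x := by
  by_contra! hneg
  have hx' := S.frontier_sub hx
  have hC := contDiffAt_line (S.contDiffAt hx') (y - x)
  set h : ℝ → ℝ := fun t => u (x + t • (y - x)) with hh
  have hd0 : deriv h 0 = 0 := by rw [hh, deriv_line (S.contDiffAt hx'), h0]; rfl
  have hdd : deriv (deriv h) 0 < 0 := by rwa [hh, deriv_deriv_line (S.contDiffAt hx')]
  have hmax := isLocalMax_of_deriv_deriv_neg hdd hd0 hC.continuousAt
  have h00 : h 0 = 0 := by simp [hh, S.uzero x hx]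
  have hzero : ∀ᶠ t in 𝓝[>] (0 : ℝ), h t = 0 := by
    filter_upwards [nhdsWithin_le_nhds hmax, Ioc_mem_nhdsGT (zero_lt_one' ℝ)] with t h1 h2
    exact le_antisymm (h1.trans h00.le) (S.unonneg (S.segment_mem hx' hy h2.1.le h2.2))
  have hdzero : ∀ᶠ t in 𝓝[>] (0 : ℝ), deriv h t = 0 := by
    filter_upwards [eventually_eventually_nhdsWithin.2 hzero, self_mem_nhdsWithin] with t h1 h2
    rw [IsOpen.nhdsWithin_eq isOpen_Ioi h2] at h1
    rw [Filter.EventuallyEq.deriv_eq (show h =ᶠ[𝓝 t] fun _ => 0 from h1), deriv_const]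
  have hdiff : DifferentiableAt ℝ (deriv h) 0 := differentiableAt_of_deriv_ne_zero hdd.ne
  have hslope := hdiff.hasDerivAt.tendsto_slope_zero_right
  refine hdd.ne (tendsto_nhds_unique hslope (tendsto_const_nhds.congr' ?_))
  filter_upwards [hdzero] with t ht
  simp [ht, hd0]

lemma hasDerivAt_γ (S : MCSetting Ω V f u γ T) (t : ℝ) : HasDerivAt γ (deriv γ t) t :=
  (S.γsmooth.differentiable (by simp) t).hasDerivAt

lemma hasDerivAt_γ' (S : MCSetting Ω V f u γ T) (t : ℝ) :
    HasDerivAt (deriv γ) (deriv (deriv γ) t) t := by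
  have h : ContDiff ℝ ∞ (deriv γ) := by
    have := S.γsmooth.iterate_deriv 1
    simpa using this
  exact (h.differentiable (by simp) t).hasDerivAt

lemma hasFDerivAt_fderiv (S : MCSetting Ω V f u γ T) {x : 𝔼} (hx : x ∈ closure Ω) :
    HasFDerivAt (fderiv ℝ u) (fderiv ℝ (fderiv ℝ u) x) x :=
  (((S.contDiffAt hx).fderiv_right (m := 1) (by norm_num)).differentiableAt (by simp)).hasFDerivAt

lemma fderiv_γ (S : MCSetting Ω V f u γ T) (t : ℝ) : fderiv ℝ u (γ t) (deriv γ t) = 0 := by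
  have h := (((S.contDiffAt (S.frontier_sub (S.γmem t))).differentiableAt
    (by simp)).hasFDerivAt.comp_hasDerivAt t (S.hasDerivAt_γ t)).deriv
  rw [← h]
  have : u ∘ γ = fun _ => 0 := funext fun s => S.uzero _ (S.γmem s)
  rw [this, deriv_const]

lemma hasDerivAt_fderiv_γ (S : MCSetting Ω V f u γ T) (t : ℝ) :
    HasDerivAt (fun s => fderiv ℝ u (γ s)) (fderiv ℝ (fderiv ℝ u) (γ t) (deriv γ t)) t :=
  (S.hasFDerivAt_fderiv (S.frontier_sub (S.γmem t))).comp_hasDerivAt t (S.hasDerivAt_γ t)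

lemma hessForm_γ (S : MCSetting Ω V f u γ T) (t : ℝ) :
    hessForm u (deriv γ t) (γ t) + fderiv ℝ u (γ t) (deriv (deriv γ) t) = 0 := by
  have h := ((S.hasDerivAt_fderiv_γ t).clm_apply (S.hasDerivAt_γ' t)).deriv
  rw [show (fun s => fderiv ℝ u (γ s) (deriv γ s)) = fun _ => 0 from funext S.fderiv_γ,
    deriv_const, fderiv_fderiv_eq (S.contDiffAt (S.frontier_sub (S.γmem t)))] at h
  rw [h]; simp only [hessForm]; ring

lemma exists_γ (S : MCSetting Ω V f u γ T) {x : 𝔼} (hx : x ∈ frontier Ω) : ∃ t, γ t = x := by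
  rwa [← S.γrange] at hx

/-- Hopf-type lemma: the gradient does not vanish on the boundary. -/
lemma fderiv_ne_zero (S : MCSetting Ω V f u γ T) {x : 𝔼} (hx : x ∈ frontier Ω) :
    fderiv ℝ u x ≠ 0 := by
  intro h0
  obtain ⟨t, rfl⟩ := S.exists_γ hx
  have hcl := S.frontier_sub hx
  have htr := S.trace_neg hx h0
  have hD := S.hessForm_γ t
  rw [h0, _root_.zero_apply, add_zero] at hD
  have hmixed : ∀ p ∈ closure Ω, fderiv ℝ (fderiv ℝ u) (γ t) (deriv γ t) (p - γ t) = 0 := by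
    intro p hp
    have h1 := (S.hasDerivAt_fderiv_γ t).clm_apply ((S.hasDerivAt_γ t).const_sub p)
    have h2 : IsLocalMin (fun s => fderiv ℝ u (γ s) (p - γ s)) t := by
      filter_upwards with s
      rw [h0]
      exact S.fderiv_nonneg (S.γmem s) hp
    have h3 := h2.hasDerivAt_eq_zero h1
    rwa [h0, _root_.zero_apply, add_zero] at h3
  have hlin : fderiv ℝ (fderiv ℝ u) (γ t) (deriv γ t) = 0 := by
    obtain ⟨p, hp⟩ := S.nonempty
    have hloc : (fun q => fderiv ℝ (fderiv ℝ u) (γ t) (deriv γ t) (q - γ t)) =ᶠ[𝓝 p]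
        fun _ => 0 := by
      filter_upwards [S.isOpen.mem_nhds hp] with q hq
      exact hmixed q (subset_closure hq)
    have h1 : HasFDerivAt (fun q => fderiv ℝ (fderiv ℝ u) (γ t) (deriv γ t) (q - γ t))
        (fderiv ℝ (fderiv ℝ u) (γ t) (deriv γ t)) p :=
      ((fderiv ℝ (fderiv ℝ u) (γ t) (deriv γ t)).hasFDerivAt (x := p - γ t)).comp p
        ((hasFDerivAt_id p).sub_const (γ t))
    have h2 := Filter.EventuallyEq.fderiv_eq (𝕜 := ℝ) hloc
    rw [h1.fderiv] at h2
    simpa using h2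
  have hC := S.contDiffAt hcl
  have hl0 := fderiv_fderiv_eq hC (deriv γ t) (EuclideanSpace.single 0 1)
  have hl1 := fderiv_fderiv_eq hC (deriv γ t) (EuclideanSpace.single 1 1)
  rw [hlin] at hl0 hl1
  simp at hl0 hl1
  set a := deriv γ t 0
  set b := deriv γ t 1
  have hab : 0 < a ^ 2 + b ^ 2 := by
    rw [← norm_sq_eq]; have := norm_pos_iff.2 (S.γderiv t); positivity
  have hall : ∀ d : 𝔼, (a ^ 2 + b ^ 2) * hessForm u d (γ t) =
      (a * d 1 - b * d 0) ^ 2 *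
        (pd 0 (pd 0 u) (γ t) + pd 1 (pd 1 u) (γ t)) := by
    intro d
    simp only [hessForm]
    linear_combination (-(d 0 ^ 2 - d 1 ^ 2) * a - 2 * d 0 * d 1 * b) * hl0 +
      ((d 0 ^ 2 - d 1 ^ 2) * b - 2 * d 0 * d 1 * a) * hl1
  obtain ⟨p, hp⟩ := S.nonempty
  have hzero : ∀ q ∈ Ω, a * (q - γ t) 1 - b * (q - γ t) 0 = 0 := by
    intro q hq
    have h1 := S.hessForm_nonneg hx (subset_closure hq) h0
    have h2 := hall (q - γ t)
    by_contra hne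
    have h3 : 0 < (a * (q - γ t) 1 - b * (q - γ t) 0) ^ 2 := by positivity
    nlinarith [mul_nonneg hab.le h1]
  have hcont : ContinuousAt (fun s : ℝ => p + s • (!₂[-b, a] : 𝔼)) 0 := by fun_prop
  have hev : ∀ᶠ s in 𝓝[>] (0 : ℝ), p + s • (!₂[-b, a] : 𝔼) ∈ Ω :=
    nhdsWithin_le_nhds (hcont (S.isOpen.mem_nhds (by simpa using hp)))
  obtain ⟨s, hs, hs0⟩ := (hev.and self_mem_nhdsWithin).exists
  have h1 := hzero _ hs
  have h2 := hzero _ hp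
  have hs0' : 0 < s := hs0
  simp at h1 h2
  have h3 : s * (a ^ 2 + b ^ 2) = 0 := by linear_combination h1 - h2
  have := mul_pos hs0' hab
  linarith

lemma fderiv_pos (S : MCSetting Ω V f u γ T) {x y : 𝔼} (hx : x ∈ frontier Ω) (hy : y ∈ Ω) :
    0 < fderiv ℝ u x (y - x) := by
  refine lt_of_le_of_ne (S.fderiv_nonneg hx (subset_closure hy)) fun h => S.fderiv_ne_zero hx ?_
  have hmin : IsLocalMin (fun z => fderiv ℝ u x (z - x)) y := by
    filter_upwards [S.isOpen.mem_nhds hy] with z hz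
    rw [← h]
    exact S.fderiv_nonneg hx (subset_closure hz)
  exact hmin.hasFDerivAt_eq_zero (((fderiv ℝ u x).hasFDerivAt (x := y - x)).comp y
    ((hasFDerivAt_id y).sub_const x))

lemma grad_pos (S : MCSetting Ω V f u γ T) {x : 𝔼} (hx : x ∈ frontier Ω) :
    0 < pd 0 u x ^ 2 + pd 1 u x ^ 2 := by
  by_contra! h
  have e0 : pd 0 u x = 0 := by nlinarith [sq_nonneg (pd 0 u x), sq_nonneg (pd 1 u x)]
  have e1 : pd 1 u x = 0 := by nlinarith [sq_nonneg (pd 0 u x), sq_nonneg (pd 1 u x)]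
  refine S.fderiv_ne_zero hx ?_
  ext d
  rw [fderiv_apply_eq, e0, e1]; simp

lemma fderiv_γ''_nonneg (S : MCSetting Ω V f u γ T) (t : ℝ) :
    0 ≤ fderiv ℝ u (γ t) (deriv (deriv γ) t) := by
  by_contra! hneg
  set A := fderiv ℝ u (γ t)
  have hd : ∀ s, HasDerivAt (fun s => A (γ s - γ t)) (A (deriv γ s)) s := fun s =>
    (A.hasFDerivAt (x := γ s - γ t)).comp_hasDerivAt s ((S.hasDerivAt_γ s).sub_const (γ t))
  have hd1 : deriv (fun s => A (γ s - γ t)) = fun s => A (deriv γ s) := funext fun s => (hd s).deriv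
  have hd2 : HasDerivAt (fun s => A (deriv γ s)) (A (deriv (deriv γ) t)) t :=
    (A.hasFDerivAt (x := deriv γ t)).comp_hasDerivAt t (S.hasDerivAt_γ' t)
  have h0 : A (γ t - γ t) = 0 := by simp
  have hmax := isLocalMax_of_deriv_deriv_neg (f := fun s => A (γ s - γ t)) (x₀ := t)
    (by rw [hd1, hd2.deriv]; exact hneg) (by rw [hd1]; exact S.fderiv_γ t) (hd t).continuousAt
  have hzero : (fun s => A (γ s - γ t)) =ᶠ[𝓝 t] fun _ => 0 := by
    filter_upwards [hmax] with s hs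
    exact le_antisymm (hs.trans h0.le)
      (S.fderiv_nonneg (S.γmem t) (S.frontier_sub (S.γmem s)))
  have h1 := hzero.deriv.deriv_eq
  rw [hd1, hd2.deriv] at h1
  simp at h1
  exact hneg.ne h1

/-- Signed curvature of the boundary curve. -/
lemma exists_neg_smul (S : MCSetting Ω V f u γ T) (t : ℝ) :
    ∃ μ < 0, deriv γ t = μ • perpGrad u (γ t) ∧ 0 < fderiv ℝ u (γ t) (deriv (deriv γ) t) ∧
      deriv γ t 0 * deriv (deriv γ) t 1 - deriv γ t 1 * deriv (deriv γ) t 0 =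
        -μ ^ 3 * -tangHess u (γ t) := by
  have hq := S.grad_pos (S.γmem t)
  have h1 := S.fderiv_γ t
  have h2 := S.fderiv_γ''_nonneg t
  have h3 := S.γcurv t
  have h4 := S.hessForm_γ t
  rw [fderiv_apply_eq] at h1 h2 h4
  set p := pd 0 u (γ t)
  set q := pd 1 u (γ t)
  obtain ⟨μ, hμ⟩ : ∃ μ, μ = (deriv γ t 1 * p - deriv γ t 0 * q) / (p ^ 2 + q ^ 2) := ⟨_, rfl⟩
  have e0 : deriv γ t 0 = μ * -q := by
    rw [hμ]; field_simp; linear_combination p * h1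
  have e1 : deriv γ t 1 = μ * p := by
    rw [hμ]; field_simp; linear_combination q * h1
  have e : deriv γ t = μ • perpGrad u (γ t) := by
    ext i; fin_cases i <;> simp [e0, e1, p, q]
  have h5 : hessForm u (deriv γ t) (γ t) = μ ^ 2 * tangHess u (γ t) := by
    rw [← hessForm_perpGrad, e]; simp only [hessForm, PiLp.smul_apply, smul_eq_mul]; ring
  have h6 : deriv γ t 0 * deriv (deriv γ) t 1 - deriv γ t 1 * deriv (deriv γ) t 0 =
      -μ * (deriv (deriv γ) t 0 * p + deriv (deriv γ) t 1 * q) := by rw [e0, e1]; ring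
  rw [h6] at h3
  have hμneg : μ < 0 := by
    by_contra! hn
    nlinarith
  refine ⟨μ, hμneg, e, ?_, ?_⟩
  · rw [fderiv_apply_eq]
    exact pos_of_mul_pos_right h3 (by linarith)
  · rw [h6]; linear_combination (-μ) * h4 + μ * h5

lemma tangHess_neg (S : MCSetting Ω V f u γ T) {x : 𝔼} (hx : x ∈ frontier Ω) :
    tangHess u x < 0 := by
  obtain ⟨t, rfl⟩ := S.exists_γ hx
  obtain ⟨μ, hμ, -, -, h⟩ := S.exists_neg_smul t
  have h1 := S.γcurv t
  rw [h] at h1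
  have : 0 < -μ ^ 3 := by have := pow_pos (neg_pos.2 hμ) 3; nlinarith
  have := pos_of_mul_pos_right h1 this.le
  linarith

end MCSetting

/-- The curvature of the level lines of `u` (with sign). -/
def levelCurv (u : 𝔼 → ℝ) (x : 𝔼) : ℝ := tangHess u x / √(pd 0 u x ^ 2 + pd 1 u x ^ 2) ^ 3

lemma norm_taylor_le {E : Type*} [NormedAddCommGroup E] [NormedSpace ℝ E] {h h' h'' : ℝ → E}
    {a b K : ℝ} (hh : ∀ t, HasDerivAt h (h' t) t) (hh' : ∀ t, HasDerivAt h' (h'' t) t)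
    (hK : ∀ t ∈ Icc a b, ‖h'' t‖ ≤ K) {s t : ℝ} (hs : s ∈ Icc a b) (ht : t ∈ Icc a b) :
    ‖h t - h s - (t - s) • h' s‖ ≤ K * |t - s| ^ 2 := by
  have hsub : uIcc s t ⊆ Icc a b := uIcc_subset_Icc hs ht
  have hK0 : 0 ≤ K := (norm_nonneg _).trans (hK s hs)
  have h1 : ∀ τ ∈ uIcc s t, ‖h' τ - h' s‖ ≤ K * |t - s| := by
    intro τ hτ
    have := (convex_Icc a b).norm_image_sub_le_of_norm_hasDerivWithin_le
      (fun x _ => (hh' x).hasDerivWithinAt) hK hs (hsub hτ)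
    refine this.trans ?_
    rw [Real.norm_eq_abs]
    have := abs_sub_left_of_mem_uIcc hτ
    gcongr
  have h2 := (convex_uIcc s t).norm_image_sub_le_of_norm_hasDerivWithin_le
    (f := fun τ => h τ - τ • h' s) (f' := fun τ => h' τ - h' s)
    (fun x _ => by
      have := ((hh x).sub ((hasDerivAt_id x).smul_const (h' s))).hasDerivWithinAt (s := uIcc s t)
      exact this.congr_deriv (by simp)) h1 left_mem_uIcc right_mem_uIcc
  have e : h t - t • h' s - (h s - s • h' s) = h t - h s - (t - s) • h' s := by
    rw [sub_smul]; abel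
  simp only [e] at h2
  rw [Real.norm_eq_abs] at h2
  linarith

namespace MCSetting

variable {Ω V : Set 𝔼} {f : ℝ → ℝ} {u : 𝔼 → ℝ} {γ : ℝ → 𝔼} {T : ℝ}

lemma frontier_isCompact (S : MCSetting Ω V f u γ T) : IsCompact (frontier Ω) :=
  S.bdd.isCompact_closure.of_isClosed_subset isClosed_frontier S.frontier_sub

lemma closure_isCompact (S : MCSetting Ω V f u γ T) : IsCompact (closure Ω) :=
  S.bdd.isCompact_closure

lemma levelCurv_γ (S : MCSetting Ω V f u γ T) (t : ℝ) : levelCurv u (γ t) =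
    -((deriv γ t 0 * deriv (deriv γ) t 1 - deriv γ t 1 * deriv (deriv γ) t 0) /
      ‖deriv γ t‖ ^ 3) := by
  obtain ⟨μ, hμ, e, -, h⟩ := S.exists_neg_smul t
  have hq := Real.sqrt_pos.2 (S.grad_pos (S.γmem t))
  have hn : ‖perpGrad u (γ t)‖ = √(pd 0 u (γ t) ^ 2 + pd 1 u (γ t) ^ 2) := by
    rw [← Real.sqrt_sq (norm_nonneg _), norm_sq_eq]; simp [add_comm]
  rw [h, e, norm_smul, hn, Real.norm_eq_abs, abs_of_neg hμ, levelCurv]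
  have := hμ.ne
  field_simp

lemma smooth_γ' (S : MCSetting Ω V f u γ T) : ContDiff ℝ ∞ (deriv γ) := by
  have := S.γsmooth.iterate_deriv 1
  simpa using this

lemma smooth_γ'' (S : MCSetting Ω V f u γ T) : ContDiff ℝ ∞ (deriv (deriv γ)) := by
  have := S.γsmooth.iterate_deriv 2
  simpa using this

lemma exists_smooth_curv (S : MCSetting Ω V f u γ T) :
    ∃ k : ℝ → ℝ, ContDiff ℝ ∞ k ∧ ∀ t, levelCurv u (γ t) = k t := by
  refine ⟨_, ?_, S.levelCurv_γ⟩
  have h1 := S.smooth_γ'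
  have h2 := S.smooth_γ''
  have hc : ∀ {g : ℝ → 𝔼}, ContDiff ℝ ∞ g → ∀ i, ContDiff ℝ ∞ fun t => g t i := fun hg i =>
    (contDiff_piLp 2).1 hg i
  refine ContDiff.neg (ContDiff.div (((hc h1 0).mul (hc h2 1)).sub ((hc h1 1).mul (hc h2 0)))
    ((h1.norm ℝ S.γderiv).pow 3) fun t => ?_)
  have := norm_pos_iff.2 (S.γderiv t)
  positivity

lemma exists_local_param (S : MCSetting Ω V f u γ T) (t₀ : ℝ) : ∃ a b c δ : ℝ, 0 < c ∧ 0 < δ ∧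
    (∀ x ∈ frontier Ω, ‖x - γ t₀‖ ≤ δ → ∃ t ∈ Icc a b, γ t = x) ∧
    ∀ s ∈ Icc a b, ∀ t ∈ Icc a b, c * |t - s| ≤ ‖γ t - γ s‖ := by
  set D := deriv γ t₀ with hD
  have hDpos : 0 < ‖D‖ := norm_pos_iff.2 (S.γderiv t₀)
  set n : 𝔼 := !₂[pd 0 u (γ t₀), pd 1 u (γ t₀)] with hn
  have hC := S.contDiffAt (S.frontier_sub (S.γmem t₀))
  have hdn : 0 < fderiv ℝ u (γ t₀) n := by
    have := S.grad_pos (S.γmem t₀)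
    rw [fderiv_apply_eq]; simp [hn]; linarith
  obtain ⟨η, hη, hball⟩ : ∃ η > 0, ∀ x, ‖x - γ t₀‖ < η → 0 < fderiv ℝ u x n := by
    have hcont : ContinuousAt (fun x => fderiv ℝ u x n) (γ t₀) :=
      ((hC.fderiv_right (m := 1) (by norm_num)).continuousAt).clm_apply continuousAt_const
    obtain ⟨η, hη, h⟩ := Metric.eventually_nhds_iff.1 (hcont.eventually (lt_mem_nhds hdn))
    exact ⟨η, hη, fun x hx => h (by rwa [dist_eq_norm])⟩
  obtain ⟨ρ, hρ, hρ1, hρ2⟩ : ∃ ρ > 0, (∀ t, |t - t₀| ≤ ρ → ‖D‖ ^ 2 / 2 ≤ inner ℝ D (deriv γ t)) ∧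
      ∀ t, |t - t₀| ≤ ρ → ‖γ t - γ t₀‖ < η := by
    have h1 : ContinuousAt (fun t => inner ℝ D (deriv γ t)) t₀ :=
      continuousAt_const.inner S.smooth_γ'.continuous.continuousAt
    have h2 : ContinuousAt (fun t => ‖γ t - γ t₀‖) t₀ := by
      have := S.γsmooth.continuous; fun_prop
    have h3 : ‖D‖ ^ 2 / 2 < inner ℝ D (deriv γ t₀) := by
      rw [← hD, real_inner_self_eq_norm_sq]; have := pow_pos hDpos 2; linarith
    obtain ⟨ρ, hρ, h⟩ := Metric.eventually_nhds_iff.1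
      ((h1.eventually (lt_mem_nhds h3)).and
        (h2.eventually (Iio_mem_nhds (show ‖γ t₀ - γ t₀‖ < η by simpa using hη))))
    refine ⟨ρ / 2, by positivity, fun t ht => ?_, fun t ht => ?_⟩
    · exact (h (by rw [Real.dist_eq]; linarith)).1.le
    · exact (h (by rw [Real.dist_eq]; linarith)).2
  have hIcc : ∀ t ∈ Icc (t₀ - ρ) (t₀ + ρ), |t - t₀| ≤ ρ := fun t ht => by
    rw [abs_le]; constructor <;> linarith [ht.1, ht.2]
  set F : ℝ → ℝ := fun t => inner ℝ D (γ t - γ t₀) with hF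
  have hFd : ∀ t, HasDerivAt F (inner ℝ D (deriv γ t)) t := fun t => by
    have := (hasDerivAt_const t D).inner ℝ ((S.hasDerivAt_γ t).sub_const (γ t₀))
    simpa using this
  have hFmono : ∀ s ∈ Icc (t₀ - ρ) (t₀ + ρ), ∀ t ∈ Icc (t₀ - ρ) (t₀ + ρ), s ≤ t →
      ‖D‖ ^ 2 / 2 * (t - s) ≤ F t - F s := by
    intro s hs t ht hst
    refine (convex_Icc (t₀ - ρ) (t₀ + ρ)).mul_sub_le_image_sub_of_le_deriv
      (fun x _ => (hFd x).continuousAt.continuousWithinAt)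
      (fun x _ => (hFd x).differentiableAt.differentiableWithinAt) (fun x hx => ?_) s hs t ht hst
    rw [(hFd x).deriv]
    exact hρ1 x (hIcc x (interior_subset hx))
  have hF0 : F t₀ = 0 := by simp [hF]
  have ht₀ : t₀ ∈ Icc (t₀ - ρ) (t₀ + ρ) := ⟨by linarith, by linarith⟩
  have hl : t₀ - ρ ∈ Icc (t₀ - ρ) (t₀ + ρ) := ⟨by linarith, by linarith⟩
  have hr : t₀ + ρ ∈ Icc (t₀ - ρ) (t₀ + ρ) := ⟨by linarith, by linarith⟩
  refine ⟨t₀ - ρ, t₀ + ρ, ‖D‖ / 2, min (‖D‖ * ρ / 2) (η / 2), by positivity, by positivity, ?_, ?_⟩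
  · intro x hx hxδ
    have hx1 := hxδ.trans (min_le_left _ _)
    have hx2 := hxδ.trans (min_le_right _ _)
    have h1 := hFmono _ hl _ ht₀ (by linarith)
    have h2 := hFmono _ ht₀ _ hr (by linarith)
    have h3 : |inner ℝ D (x - γ t₀)| ≤ ‖D‖ ^ 2 / 2 * ρ := by
      refine (abs_real_inner_le_norm _ _).trans ?_
      calc ‖D‖ * ‖x - γ t₀‖ ≤ ‖D‖ * (‖D‖ * ρ / 2) := by gcongr
        _ = _ := by ring
    rw [abs_le] at h3
    rw [hF0] at h1 h2
    obtain ⟨t, ht, hFt⟩ := intermediate_value_Icc (show t₀ - ρ ≤ t₀ + ρ by linarith)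
      (f := F) (fun t _ => (hFd t).continuousAt.continuousWithinAt)
      (show inner ℝ D (x - γ t₀) ∈ Icc _ _ from ⟨by linarith, by linarith⟩)
    refine ⟨t, ht, ?_⟩
    have horth : inner ℝ D (x - γ t) = 0 := by
      have : x - γ t = (x - γ t₀) - (γ t - γ t₀) := by abel
      rw [this, inner_sub_right, ← hFt]; simp [hF]
    obtain ⟨μ, hμ, e, -, -⟩ := S.exists_neg_smul t₀
    have hq := S.grad_pos (S.γmem t₀)
    rw [hD, e, inner_smul_left, inner_eq] at horth
    simp [hμ.ne] at horth
    set p := pd 0 u (γ t₀)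
    set q := pd 1 u (γ t₀)
    obtain ⟨s, hs⟩ : ∃ s, s = (p * (x - γ t) 0 + q * (x - γ t) 1) / (p ^ 2 + q ^ 2) := ⟨_, rfl⟩
    have hxs : x - γ t = s • n := by
      ext i
      fin_cases i
      · simp [hn, hs]; field_simp; linear_combination -q * horth
      · simp [hn, hs]; field_simp; linear_combination p * horth
    have h4 := S.fderiv_nonneg hx (S.frontier_sub (S.γmem t))
    have h5 := S.fderiv_nonneg (S.γmem t) (S.frontier_sub hx)
    have h6 := hball x (by linarith)
    have h7 := hball (γ t) (hρ2 t (hIcc t ht))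
    rw [← neg_sub x, hxs, map_neg, map_smul, smul_eq_mul] at h4
    rw [hxs, map_smul, smul_eq_mul] at h5
    have hs1 : 0 ≤ s := by by_contra! hc; nlinarith
    have hs2 : s ≤ 0 := by by_contra! hc; nlinarith
    rw [le_antisymm hs2 hs1, zero_smul, sub_eq_zero] at hxs
    exact hxs.symm
  · intro s hs t ht
    have key : ∀ s ∈ Icc (t₀ - ρ) (t₀ + ρ), ∀ t ∈ Icc (t₀ - ρ) (t₀ + ρ), s ≤ t →
        ‖D‖ / 2 * |t - s| ≤ ‖γ t - γ s‖ := by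
      intro s hs t ht hst
      have h1 := hFmono s hs t ht hst
      have h2 : F t - F s = inner ℝ D (γ t - γ s) := by
        simp only [hF]; rw [← inner_sub_right]; congr 1; abel
      have h3 := h1.trans (h2.le.trans (real_inner_le_norm _ _))
      rw [abs_of_nonneg (sub_nonneg.2 hst)]
      refine le_of_mul_le_mul_left ?_ hDpos
      linarith
    rcases le_total s t with h | h
    · exact key s hs t ht h
    · rw [abs_sub_comm, norm_sub_rev]; exact key t ht s hs h

/-- The level curvature restricted to the boundary is `C^{1,1}`. -/
lemma levelCurv_boundary_taylor (S : MCSetting Ω V f u γ T) : ∃ C ≥ 0, ∀ x₀ ∈ frontier Ω,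
    ∃ g : 𝔼, ‖g‖ ≤ C ∧ ∀ x ∈ frontier Ω,
      |levelCurv u x - levelCurv u x₀ - inner ℝ g (x - x₀)| ≤ C * ‖x - x₀‖ ^ 2 := by
  obtain ⟨k, hk, hkγ⟩ := S.exists_smooth_curv
  have hk1 : ContDiff ℝ ∞ (deriv k) := by
    have := hk.iterate_deriv 1
    simpa using this
  have hk2 : ContDiff ℝ ∞ (deriv (deriv k)) := by
    have := hk.iterate_deriv 2
    simpa using this
  have hkd : ∀ t, HasDerivAt k (deriv k t) t := fun t => (hk.differentiable (by simp) t).hasDerivAt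
  have hkd' : ∀ t, HasDerivAt (deriv k) (deriv (deriv k) t) t := fun t =>
    (hk1.differentiable (by simp) t).hasDerivAt
  obtain ⟨B, hB⟩ : ∃ B, ∀ x ∈ frontier Ω, |levelCurv u x| ≤ B := by
    obtain ⟨B, hB⟩ := (isCompact_Icc (a := (0 : ℝ)) (b := T)).exists_bound_of_continuousOn
      hk.continuous.continuousOn
    refine ⟨B, fun x hx => ?_⟩
    obtain ⟨t, rfl⟩ := S.exists_γ hx
    obtain ⟨s, hs, hst⟩ := S.γper.exists_mem_Ico₀ S.Tpos t
    rw [hst, hkγ]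
    exact hB s ⟨hs.1, hs.2.le⟩
  let p : Set 𝔼 → Prop := fun X => ∃ C ≥ 0, ∀ x₀ ∈ X ∩ frontier Ω,
    ∃ g : 𝔼, ‖g‖ ≤ C ∧ ∀ x ∈ frontier Ω,
      |levelCurv u x - levelCurv u x₀ - inner ℝ g (x - x₀)| ≤ C * ‖x - x₀‖ ^ 2
  suffices h : p (frontier Ω) by simpa [p] using h
  refine S.frontier_isCompact.induction_on (p := p) ⟨0, le_rfl, by simp⟩ ?_ ?_ ?_
  · rintro X Y hXY ⟨C, hC, h⟩
    exact ⟨C, hC, fun x₀ hx₀ => h x₀ ⟨hXY hx₀.1, hx₀.2⟩⟩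
  · rintro X Y ⟨C, hC, h⟩ ⟨C', hC', h'⟩
    refine ⟨max C C', le_max_of_le_left hC, ?_⟩
    rintro x₀ ⟨hx₀ | hx₀, hfr⟩
    · obtain ⟨g, hg, h1⟩ := h x₀ ⟨hx₀, hfr⟩
      exact ⟨g, hg.trans (le_max_left _ _), fun x hx => (h1 x hx).trans
        (by gcongr; exact le_max_left _ _)⟩
    · obtain ⟨g, hg, h1⟩ := h' x₀ ⟨hx₀, hfr⟩
      exact ⟨g, hg.trans (le_max_right _ _), fun x hx => (h1 x hx).trans
        (by gcongr; exact le_max_right _ _)⟩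
  intro z hz
  obtain ⟨t₀, rfl⟩ := S.exists_γ hz
  obtain ⟨a, b, c, δ, hc, hδ, hcov, hlow⟩ := S.exists_local_param t₀
  have hbound : ∀ {E : Type} [NormedAddCommGroup E] {h : ℝ → E}, Continuous h →
      ∃ K ≥ 0, ∀ t ∈ Icc a b, ‖h t‖ ≤ K := fun {E} _ {h} hh => by
    obtain ⟨K, hK⟩ := isCompact_Icc.exists_bound_of_continuousOn hh.continuousOn
    exact ⟨|K|, abs_nonneg _, fun t ht => (hK t ht).trans (le_abs_self _)⟩
  obtain ⟨K₁, hK₁0, hK₁⟩ := hbound hk2.continuous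
  obtain ⟨K₂, hK₂0, hK₂⟩ := hbound S.smooth_γ''.continuous
  set G : ℝ → 𝔼 := fun t => (deriv k t / ‖deriv γ t‖ ^ 2) • deriv γ t with hG
  have hGc : Continuous G := by
    have h1 := S.smooth_γ'.continuous
    have h2 := hk1.continuous
    refine Continuous.smul (h2.div (by fun_prop) fun t => ?_) h1
    have := norm_pos_iff.2 (S.γderiv t)
    positivity
  obtain ⟨K₃, hK₃0, hK₃⟩ := hbound hGc
  set C : ℝ := K₃ + (K₁ + K₃ * K₂) / c ^ 2 + (2 * |B| + K₃ * (δ / 2)) / (δ / 2) ^ 2 + K₃ / (δ / 2)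
    with hCdef
  have p1 : 0 ≤ (K₁ + K₃ * K₂) / c ^ 2 := by positivity
  have p2 : 0 ≤ (2 * |B| + K₃ * (δ / 2)) / (δ / 2) ^ 2 := by positivity
  have p3 : 0 ≤ K₃ / (δ / 2) := by positivity
  refine ⟨ball (γ t₀) (δ / 2), mem_nhdsWithin_of_mem_nhds (ball_mem_nhds _ (by positivity)), C,
    by positivity, ?_⟩
  rintro x₀ ⟨hx₀b, hx₀⟩
  rw [mem_ball, dist_eq_norm] at hx₀b
  obtain ⟨s, hs, rfl⟩ := hcov x₀ hx₀ (by linarith)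
  refine ⟨G s, (hK₃ s hs).trans (by linarith), fun x hx => ?_⟩
  by_cases hnear : ‖x - γ s‖ ≤ δ / 2
  · obtain ⟨t, ht, rfl⟩ := hcov x hx (by
      calc ‖x - γ t₀‖ = ‖(x - γ s) + (γ s - γ t₀)‖ := by congr 1; abel
        _ ≤ _ := norm_add_le _ _
        _ ≤ δ := by linarith)
    have h1 := norm_taylor_le hkd hkd' hK₁ hs ht
    have h2 := norm_taylor_le S.hasDerivAt_γ S.hasDerivAt_γ' hK₂ hs ht
    rw [hkγ, hkγ]
    have h3 : inner ℝ (G s) ((t - s) • deriv γ s) = (t - s) * deriv k s := by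
      have := norm_pos_iff.2 (S.γderiv s)
      simp only [hG]
      rw [inner_smul_left, inner_smul_right, real_inner_self_eq_norm_sq, conj_trivial]
      field_simp
    have h4 : k t - k s - inner ℝ (G s) (γ t - γ s) = (k t - k s - (t - s) • deriv k s) -
        inner ℝ (G s) (γ t - γ s - (t - s) • deriv γ s) := by
      rw [inner_sub_right _ (γ t - γ s), h3, smul_eq_mul]; ring
    have h5 : |inner ℝ (G s) (γ t - γ s - (t - s) • deriv γ s)| ≤ K₃ * (K₂ * |t - s| ^ 2) := by
      refine (abs_real_inner_le_norm _ _).trans ?_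
      have := hK₃ s hs
      gcongr
    have h6 : |t - s| ^ 2 ≤ ‖γ t - γ s‖ ^ 2 / c ^ 2 := by
      rw [le_div_iff₀ (by positivity), ← mul_pow, mul_comm]
      have := hlow s hs t ht
      gcongr
    rw [h4]
    refine (abs_sub _ _).trans ?_
    rw [Real.norm_eq_abs] at h1
    calc _ ≤ (K₁ + K₃ * K₂) * |t - s| ^ 2 := by linarith
      _ ≤ (K₁ + K₃ * K₂) * (‖γ t - γ s‖ ^ 2 / c ^ 2) := by gcongr
      _ = (K₁ + K₃ * K₂) / c ^ 2 * ‖γ t - γ s‖ ^ 2 := by ring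
      _ ≤ _ := by gcongr; linarith
  · push Not at hnear
    have h1 := hB x hx
    have h2 := hB (γ s) hx₀
    have h3 : |inner ℝ (G s) (x - γ s)| ≤ K₃ * ‖x - γ s‖ := by
      refine (abs_real_inner_le_norm _ _).trans ?_
      have := hK₃ s hs
      gcongr
    have h4 : |levelCurv u x - levelCurv u (γ s) - inner ℝ (G s) (x - γ s)| ≤
        2 * |B| + K₃ * ‖x - γ s‖ := by
      have := le_abs_self B
      rw [abs_le] at *
      constructor <;> linarith
    have h5 : 2 * |B| ≤ (2 * |B| + K₃ * (δ / 2)) / (δ / 2) ^ 2 * ‖x - γ s‖ ^ 2 := by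
      have : (2 * |B| + K₃ * (δ / 2)) / (δ / 2) ^ 2 * (δ / 2) ^ 2 ≤
        (2 * |B| + K₃ * (δ / 2)) / (δ / 2) ^ 2 * ‖x - γ s‖ ^ 2 := by gcongr
      rw [div_mul_cancel₀ _ (by positivity)] at this
      have : 0 ≤ K₃ * (δ / 2) := by positivity
      linarith
    have h6 : K₃ * ‖x - γ s‖ ≤ K₃ / (δ / 2) * ‖x - γ s‖ ^ 2 := by
      have : K₃ / (δ / 2) * (δ / 2 * ‖x - γ s‖) ≤ K₃ / (δ / 2) * (‖x - γ s‖ * ‖x - γ s‖) := by gcongr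
      calc K₃ * ‖x - γ s‖ = K₃ / (δ / 2) * (δ / 2 * ‖x - γ s‖) := by field_simp
        _ ≤ _ := this
        _ = _ := by ring
    refine h4.trans ?_
    have p4 : 0 ≤ (K₃ + (K₁ + K₃ * K₂) / c ^ 2) * ‖x - γ s‖ ^ 2 := by positivity
    rw [hCdef]
    linarith

end MCSetting

section calculus

variable {N : Set 𝔼} {g h : 𝔼 → ℝ} {x : 𝔼}

lemma pd_pd_congr (hN : IsOpen N) (hgh : ∀ y ∈ N, g y = h y) (hx : x ∈ N) (i j : Fin 2) :
    pd i (pd j g) x = pd i (pd j h) x :=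
  pd_congr hN (fun _ hy => pd_congr hN hgh hy j) hx i

lemma pd_pd_add (hN : IsOpen N) (hg : ContDiffOn ℝ ∞ g N) (hh : ContDiffOn ℝ ∞ h N) (hx : x ∈ N)
    (i j : Fin 2) :
    pd i (pd j fun y => g y + h y) x = pd i (pd j g) x + pd i (pd j h) x := by
  rw [pd_congr hN (fun y hy => pd_add (smooth_diffAt hN hg hy) (smooth_diffAt hN hh hy) j) hx i,
    pd_add (smooth_diffAt hN (smooth_pd hN hg j) hx) (smooth_diffAt hN (smooth_pd hN hh j) hx)]

lemma pd_pd_sub (hN : IsOpen N) (hg : ContDiffOn ℝ ∞ g N) (hh : ContDiffOn ℝ ∞ h N) (hx : x ∈ N)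
    (i j : Fin 2) :
    pd i (pd j fun y => g y - h y) x = pd i (pd j g) x - pd i (pd j h) x := by
  rw [pd_congr hN (fun y hy => pd_sub (smooth_diffAt hN hg hy) (smooth_diffAt hN hh hy) j) hx i,
    pd_sub (smooth_diffAt hN (smooth_pd hN hg j) hx) (smooth_diffAt hN (smooth_pd hN hh j) hx)]

lemma pd_pd_mul (hN : IsOpen N) (hg : ContDiffOn ℝ ∞ g N) (hh : ContDiffOn ℝ ∞ h N) (hx : x ∈ N)
    (i j : Fin 2) :
    pd i (pd j fun y => g y * h y) x = pd i (pd j g) x * h x + pd j g x * pd i h x +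
      (pd i g x * pd j h x + g x * pd i (pd j h) x) := by
  have dg := fun y hy => smooth_diffAt hN hg (x := y) hy
  have dh := fun y hy => smooth_diffAt hN hh (x := y) hy
  have dg' := smooth_diffAt hN (smooth_pd hN hg j) hx
  have dh' := smooth_diffAt hN (smooth_pd hN hh j) hx
  rw [pd_congr hN (fun y hy => pd_mul (dg y hy) (dh y hy) j) hx i,
    pd_add (dg'.fun_mul (dh x hx)) ((dg x hx).fun_mul dh'), pd_mul dg' (dh x hx),
    pd_mul (dg x hx) dh']

lemma smooth_comp_real {ψ : ℝ → ℝ} {U : Set ℝ} (hψ : ContDiffOn ℝ ∞ ψ U)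
    (hg : ContDiffOn ℝ ∞ g N) (hgU : MapsTo g N U) : ContDiffOn ℝ ∞ (fun y => ψ (g y)) N :=
  hψ.comp hg hgU

lemma pd_pd_comp {ψ : ℝ → ℝ} {U : Set ℝ} (hU : IsOpen U) (hψ : ContDiffOn ℝ ∞ ψ U) (hN : IsOpen N)
    (hg : ContDiffOn ℝ ∞ g N) (hgU : MapsTo g N U) (hx : x ∈ N) (i j : Fin 2) :
    pd i (pd j fun y => ψ (g y)) x =
      deriv (deriv ψ) (g x) * pd i g x * pd j g x + deriv ψ (g x) * pd i (pd j g) x := by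
  have dψ : ∀ s ∈ U, HasDerivAt ψ (deriv ψ s) s := fun s hs =>
    ((hψ.contDiffAt (hU.mem_nhds hs)).differentiableAt (by simp)).hasDerivAt
  have hψ' : ContDiffOn ℝ ∞ (deriv ψ) U := hψ.deriv_of_isOpen hU (by simp)
  have dψ' : ∀ s ∈ U, HasDerivAt (deriv ψ) (deriv (deriv ψ) s) s := fun s hs =>
    ((hψ'.contDiffAt (hU.mem_nhds hs)).differentiableAt (by simp)).hasDerivAt
  have dg := fun y hy => smooth_diffAt hN hg (x := y) hy
  rw [pd_congr hN (fun y hy => pd_comp (dψ _ (hgU hy)) (dg y hy) j) hx i,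
    pd_mul (smooth_diffAt hN (smooth_comp_real hψ' hg hgU) hx)
      (smooth_diffAt hN (smooth_pd hN hg j) hx), pd_comp (dψ' _ (hgU hx)) (dg x hx)]

lemma ellForm_mul (hN : IsOpen N) (hg : ContDiffOn ℝ ∞ g N) (hh : ContDiffOn ℝ ∞ h N) (hx : x ∈ N)
    (w : 𝔼) : ellForm (fun y => g y * h y) w x = ellForm g w x * h x + g x * ellForm h w x +
      2 * (pd 0 g x * pd 0 h x + pd 1 g x * pd 1 h x +
        (w 0 * pd 0 g x + w 1 * pd 1 g x) * (w 0 * pd 0 h x + w 1 * pd 1 h x)) := by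
  simp only [ellForm, hessForm, pd_pd_mul hN hg hh hx]; ring

lemma ellForm_sub (hN : IsOpen N) (hg : ContDiffOn ℝ ∞ g N) (hh : ContDiffOn ℝ ∞ h N) (hx : x ∈ N)
    (w : 𝔼) : ellForm (fun y => g y - h y) w x = ellForm g w x - ellForm h w x := by
  simp only [ellForm, hessForm, pd_pd_sub hN hg hh hx]; ring

lemma ellForm_congr (hN : IsOpen N) (hgh : ∀ y ∈ N, g y = h y) (hx : x ∈ N) (w : 𝔼) :
    ellForm g w x = ellForm h w x := by
  simp only [ellForm, hessForm, pd_pd_congr hN hgh hx]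

lemma pd_fourth_comm (hN : IsOpen N) (hg : ContDiffOn ℝ ∞ g N) (hx : x ∈ N) (i j k : Fin 2) :
    pd k (pd k (pd i (pd j g))) x = pd i (pd j (pd k (pd k g))) x := by
  have s := smooth_pd hN hg
  have e1 : ∀ y ∈ N, pd k (pd i (pd j g)) y = pd i (pd j (pd k g)) y := fun y hy => by
    rw [smooth_pd_comm hN (s j) hy k i]
    exact pd_congr hN (fun z hz => smooth_pd_comm hN hg hz k j) hy i
  rw [pd_congr hN e1 hx k, smooth_pd_comm hN (smooth_pd hN (s k) j) hx k i]
  exact pd_congr hN (fun z hz => smooth_pd_comm hN (s k) hz k j) hx i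

end calculus

/-- `g` is bounded on `N` by a multiple of `1 + |τ|`. -/
def WtBdd (N : Set 𝔼) (τ g : 𝔼 → ℝ) : Prop := ∃ C ≥ 0, ∀ x ∈ N, |g x| ≤ C * (1 + |τ x|)

/-- `g` is bounded on `N`. -/
def BddFun (N : Set 𝔼) (g : 𝔼 → ℝ) : Prop := ∃ C ≥ 0, ∀ x ∈ N, |g x| ≤ C

section weights

variable {N : Set 𝔼} {τ g h : 𝔼 → ℝ}

lemma BddFun.wt (hg : BddFun N g) : WtBdd N τ g := by
  obtain ⟨C, hC, h⟩ := hg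
  exact ⟨C, hC, fun x hx => (h x hx).trans (le_mul_of_one_le_right hC (by simp))⟩

lemma BddFun.add (hg : BddFun N g) (hh : BddFun N h) : BddFun N fun x => g x + h x := by
  obtain ⟨C, hC, h1⟩ := hg
  obtain ⟨D, hD, h2⟩ := hh
  exact ⟨C + D, by positivity, fun x hx => (abs_add_le _ _).trans (add_le_add (h1 x hx) (h2 x hx))⟩

lemma BddFun.mul (hg : BddFun N g) (hh : BddFun N h) : BddFun N fun x => g x * h x := by
  obtain ⟨C, hC, h1⟩ := hg
  obtain ⟨D, hD, h2⟩ := hh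
  refine ⟨C * D, by positivity, fun x hx => ?_⟩
  rw [abs_mul]
  exact mul_le_mul (h1 x hx) (h2 x hx) (abs_nonneg _) hC

lemma BddFun.neg (hg : BddFun N g) : BddFun N fun x => -g x := by
  obtain ⟨C, hC, h1⟩ := hg
  exact ⟨C, hC, fun x hx => by rw [abs_neg]; exact h1 x hx⟩

lemma BddFun.const (c : ℝ) : BddFun N fun _ => c := ⟨|c|, abs_nonneg _, fun _ _ => le_rfl⟩

lemma BddFun.congr (hg : BddFun N g) (e : ∀ x ∈ N, h x = g x) : BddFun N h := by
  obtain ⟨C, hC, h1⟩ := hg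
  exact ⟨C, hC, fun x hx => by rw [e x hx]; exact h1 x hx⟩

lemma WtBdd.congr (hg : WtBdd N τ g) (e : ∀ x ∈ N, h x = g x) : WtBdd N τ h := by
  obtain ⟨C, hC, h1⟩ := hg
  exact ⟨C, hC, fun x hx => by rw [e x hx]; exact h1 x hx⟩

lemma WtBdd.add (hg : WtBdd N τ g) (hh : WtBdd N τ h) : WtBdd N τ fun x => g x + h x := by
  obtain ⟨C, hC, h1⟩ := hg
  obtain ⟨D, hD, h2⟩ := hh
  exact ⟨C + D, by positivity, fun x hx => (abs_add_le _ _).trans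
    ((add_le_add (h1 x hx) (h2 x hx)).trans_eq (by ring))⟩

lemma WtBdd.neg (hg : WtBdd N τ g) : WtBdd N τ fun x => -g x := by
  obtain ⟨C, hC, h1⟩ := hg
  exact ⟨C, hC, fun x hx => by rw [abs_neg]; exact h1 x hx⟩

lemma WtBdd.sub (hg : WtBdd N τ g) (hh : WtBdd N τ h) : WtBdd N τ fun x => g x - h x :=
  (hg.add hh.neg).congr fun _ _ => sub_eq_add_neg _ _

lemma BddFun.mul_wt (hg : BddFun N g) (hh : WtBdd N τ h) : WtBdd N τ fun x => g x * h x := by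
  obtain ⟨C, hC, h1⟩ := hg
  obtain ⟨D, hD, h2⟩ := hh
  refine ⟨C * D, by positivity, fun x hx => ?_⟩
  rw [abs_mul, mul_assoc]
  exact mul_le_mul (h1 x hx) (h2 x hx) (abs_nonneg _) hC

lemma WtBdd.mul_bdd (hg : WtBdd N τ g) (hh : BddFun N h) : WtBdd N τ fun x => g x * h x :=
  (hh.mul_wt hg).congr fun _ _ => mul_comm _ _

/-- Smooth functions that are bounded with their first derivatives on `N` and whose second
derivatives are controlled by the weight `τ`. -/
structure TameTwo (N : Set 𝔼) (τ g : 𝔼 → ℝ) : Prop where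
  smooth : ContDiffOn ℝ ∞ g N
  b0 : BddFun N g
  b1 : ∀ i, BddFun N (pd i g)
  b2 : ∀ i j, WtBdd N τ (pd i (pd j g))

lemma TameTwo.add (hN : IsOpen N) (hg : TameTwo N τ g) (hh : TameTwo N τ h) :
    TameTwo N τ fun x => g x + h x where
  smooth := hg.smooth.add hh.smooth
  b0 := hg.b0.add hh.b0
  b1 i := ((hg.b1 i).add (hh.b1 i)).congr fun _ hx =>
    pd_add (smooth_diffAt hN hg.smooth hx) (smooth_diffAt hN hh.smooth hx) i
  b2 i j := ((hg.b2 i j).add (hh.b2 i j)).congr fun _ hx =>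
    pd_pd_add hN hg.smooth hh.smooth hx i j

lemma TameTwo.mul (hN : IsOpen N) (hg : TameTwo N τ g) (hh : TameTwo N τ h) :
    TameTwo N τ fun x => g x * h x where
  smooth := hg.smooth.mul hh.smooth
  b0 := hg.b0.mul hh.b0
  b1 i := (((hg.b1 i).mul hh.b0).add (hg.b0.mul (hh.b1 i))).congr fun _ hx =>
    pd_mul (smooth_diffAt hN hg.smooth hx) (smooth_diffAt hN hh.smooth hx) i
  b2 i j := ((((hg.b2 i j).mul_bdd hh.b0).add ((hg.b1 j).mul (hh.b1 i)).wt).add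
    (((hg.b1 i).mul (hh.b1 j)).wt.add (hg.b0.mul_wt (hh.b2 i j)))).congr fun _ hx =>
      pd_pd_mul hN hg.smooth hh.smooth hx i j

lemma TameTwo.const (c : ℝ) : TameTwo N τ fun _ => c := by
  have h : ∀ c i, pd i (fun _ : 𝔼 => c) = fun _ => 0 := fun c i => by
    funext x; simp [pd, dirDeriv]
  exact ⟨contDiffOn_const, .const c, fun i => by rw [h]; exact .const 0,
    fun i j => by rw [h, h]; exact (BddFun.const 0).wt⟩

lemma TameTwo.comp {ψ : ℝ → ℝ} {U K : Set ℝ} (hU : IsOpen U) (hK : IsCompact K) (hKU : K ⊆ U)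
    (hψ : ContDiffOn ℝ ∞ ψ U) (hN : IsOpen N) (hg : TameTwo N τ g) (hgK : ∀ x ∈ N, g x ∈ K) :
    TameTwo N τ fun x => ψ (g x) := by
  have hψ' : ContDiffOn ℝ ∞ (deriv ψ) U := hψ.deriv_of_isOpen hU (by simp)
  have hψ'' : ContDiffOn ℝ ∞ (deriv (deriv ψ)) U := hψ'.deriv_of_isOpen hU (by simp)
  have hgU : MapsTo g N U := fun x hx => hKU (hgK x hx)
  have hb : ∀ {φ : ℝ → ℝ}, ContDiffOn ℝ ∞ φ U → BddFun N fun x => φ (g x) := fun {φ} hφ => by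
    obtain ⟨C, hC⟩ := hK.exists_bound_of_continuousOn (hφ.continuousOn.mono hKU)
    exact ⟨|C|, abs_nonneg _, fun x hx => (hC _ (hgK x hx)).trans (le_abs_self _)⟩
  refine ⟨smooth_comp_real hψ hg.smooth hgU, hb hψ, fun i => ?_, fun i j => ?_⟩
  · refine ((hb hψ').mul (hg.b1 i)).congr fun x hx => pd_comp ?_ (smooth_diffAt hN hg.smooth hx) i
    exact ((hψ.contDiffAt (hU.mem_nhds (hgU hx))).differentiableAt (by simp)).hasDerivAt
  · exact ((((hb hψ'').mul (hg.b1 i)).mul (hg.b1 j)).wt.add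
      ((hb hψ').mul_wt (hg.b2 i j))).congr fun x hx => pd_pd_comp hU hψ hN hg.smooth hgU hx i j

end weights

lemma WtBdd.trans {N : Set 𝔼} {τ σ g : 𝔼 → ℝ} (hg : WtBdd N τ g) (hτ : WtBdd N σ τ) :
    WtBdd N σ g := by
  obtain ⟨C, hC, h1⟩ := hg
  obtain ⟨D, hD, h2⟩ := hτ
  refine ⟨C * (1 + D), by positivity, fun x hx => (h1 x hx).trans ?_⟩
  rw [mul_assoc]
  refine mul_le_mul_of_nonneg_left ?_ hC
  have := h2 x hx
  have := abs_nonneg (σ x)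
  nlinarith

lemma WtBdd.abs {N : Set 𝔼} {τ g : 𝔼 → ℝ} (hg : WtBdd N τ g) : WtBdd N τ fun x => |g x| := by
  obtain ⟨C, hC, h1⟩ := hg
  exact ⟨C, hC, fun x hx => by rw [abs_abs]; exact h1 x hx⟩

/-- The sum of the absolute values of the third derivatives. -/
def thirdSize (u : 𝔼 → ℝ) (x : 𝔼) : ℝ :=
  |pd 0 (pd 0 (pd 0 u)) x| + |pd 0 (pd 0 (pd 1 u)) x| + |pd 0 (pd 1 (pd 1 u)) x| +
    |pd 1 (pd 1 (pd 1 u)) x|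

lemma pd_third_comm {N : Set 𝔼} {u : 𝔼 → ℝ} (hN : IsOpen N) (hu : ContDiffOn ℝ ∞ u N) {x : 𝔼}
    (hx : x ∈ N) (i j k : Fin 2) : pd i (pd j (pd k u)) x = pd i (pd k (pd j u)) x :=
  pd_congr hN (fun _ hy => smooth_pd_comm hN hu hy j k) hx i

lemma abs_third_le {N : Set 𝔼} {u : 𝔼 → ℝ} (hN : IsOpen N) (hu : ContDiffOn ℝ ∞ u N) {x : 𝔼}
    (hx : x ∈ N) (i j k : Fin 2) : |pd i (pd j (pd k u)) x| ≤ thirdSize u x := by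
  have e1 := pd_third_comm hN hu hx
  have e2 := fun i j k => smooth_pd_comm hN (smooth_pd hN hu k) hx i j
  have n0 := abs_nonneg (pd 0 (pd 0 (pd 0 u)) x)
  have n1 := abs_nonneg (pd 0 (pd 0 (pd 1 u)) x)
  have n2 := abs_nonneg (pd 0 (pd 1 (pd 1 u)) x)
  have n3 := abs_nonneg (pd 1 (pd 1 (pd 1 u)) x)
  have h001 : pd 0 (pd 1 (pd 0 u)) x = pd 0 (pd 0 (pd 1 u)) x := e1 0 1 0
  have h100 : pd 1 (pd 0 (pd 0 u)) x = pd 0 (pd 0 (pd 1 u)) x := (e2 1 0 0).trans h001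
  have h101 : pd 1 (pd 0 (pd 1 u)) x = pd 0 (pd 1 (pd 1 u)) x := e2 1 0 1
  have h110 : pd 1 (pd 1 (pd 0 u)) x = pd 0 (pd 1 (pd 1 u)) x := (e1 1 1 0).trans h101
  fin_cases i <;> fin_cases j <;> fin_cases k <;>
    simp only [Fin.zero_eta, Fin.mk_one, Fin.isValue, h001, h100, h101, h110, thirdSize] <;>
    linarith

lemma wtBdd_third {N : Set 𝔼} {u : 𝔼 → ℝ} (hN : IsOpen N) (hu : ContDiffOn ℝ ∞ u N)
    (i j k : Fin 2) : WtBdd N (thirdSize u) (pd i (pd j (pd k u))) :=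
  ⟨1, zero_le_one, fun x hx => by
    linarith [abs_third_le hN hu hx i j k, le_abs_self (thirdSize u x)]⟩

/-- The data needed to control the curvature of the level lines on an open set. -/
structure LevelSetting (N : Set 𝔼) (f : ℝ → ℝ) (u : 𝔼 → ℝ) (q₀ : ℝ) : Prop where
  isOpen : IsOpen N
  smooth : ContDiffOn ℝ ∞ u N
  fsmooth : ContDiff ℝ ∞ f
  pos : 0 < q₀
  lower : ∀ x ∈ N, q₀ ≤ pd 0 u x ^ 2 + pd 1 u x ^ 2
  b0 : BddFun N u
  b1 : ∀ i, BddFun N (pd i u)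
  b2 : ∀ i j, BddFun N (pd i (pd j u))
  eqn : ∀ x ∈ N, pd 0 (pd 0 u) x + pd 1 (pd 1 u) x + tangHess u x = mcRhs f u x

namespace LevelSetting

variable {N : Set 𝔼} {f : ℝ → ℝ} {u : 𝔼 → ℝ} {q₀ : ℝ}

lemma tame_u (S : LevelSetting N f u q₀) : TameTwo N (thirdSize u) u :=
  ⟨S.smooth, S.b0, S.b1, fun i j => (S.b2 i j).wt⟩

lemma tame_pd (S : LevelSetting N f u q₀) (i : Fin 2) : TameTwo N (thirdSize u) (pd i u) :=
  ⟨smooth_pd S.isOpen S.smooth i, S.b1 i, fun j => S.b2 j i,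
    fun j k => wtBdd_third S.isOpen S.smooth j k i⟩

lemma tame_sq (S : LevelSetting N f u q₀) :
    TameTwo N (thirdSize u) fun x => pd 0 u x ^ 2 + pd 1 u x ^ 2 := by
  simp only [sq]
  exact ((S.tame_pd 0).mul S.isOpen (S.tame_pd 0)).add S.isOpen
    ((S.tame_pd 1).mul S.isOpen (S.tame_pd 1))

lemma tame_comp_sq (S : LevelSetting N f u q₀) {ψ : ℝ → ℝ} (hψ : ContDiffOn ℝ ∞ ψ (Ioi 0)) :
    TameTwo N (thirdSize u) fun x => ψ (pd 0 u x ^ 2 + pd 1 u x ^ 2) := by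
  obtain ⟨C, hC, h⟩ := S.tame_sq.b0
  exact S.tame_sq.comp isOpen_Ioi (K := Icc q₀ C) isCompact_Icc (fun s hs => S.pos.trans_le hs.1) hψ
    S.isOpen fun x hx => ⟨S.lower x hx, (le_abs_self _).trans (h x hx)⟩

lemma tame_mcRhs (S : LevelSetting N f u q₀) : TameTwo N (thirdSize u) (mcRhs f u) := by
  have h1 : TameTwo N (thirdSize u) fun x => f (u x) := by
    obtain ⟨C, hC, h⟩ := S.b0
    exact S.tame_u.comp isOpen_univ (K := Icc (-C) C) isCompact_Icc (subset_univ _)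
      S.fsmooth.contDiffOn S.isOpen fun x hx => abs_le.1 (h x hx)
  have hψ : ContDiffOn ℝ ∞ (fun s : ℝ => (1 + s) * √(1 + s)) (Ioi 0) := by
    refine (contDiffOn_const.add contDiffOn_id).mul ((contDiffOn_const.add contDiffOn_id).sqrt ?_)
    intro s hs
    have : (0 : ℝ) < s := hs
    simp only [id]; positivity
  have h2 := (S.tame_comp_sq hψ).mul S.isOpen h1
  have e : mcRhs f u = fun x => (1 + (pd 0 u x ^ 2 + pd 1 u x ^ 2)) *
      √(1 + (pd 0 u x ^ 2 + pd 1 u x ^ 2)) * f (u x) := by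
    funext x; simp only [mcRhs, add_assoc]
  rw [e]; exact h2

end LevelSetting

/-- The Laplacian. -/
def lapl (g : 𝔼 → ℝ) (x : 𝔼) : ℝ := pd 0 (pd 0 g) x + pd 1 (pd 1 g) x

lemma lapl_pd_pd {N : Set 𝔼} {u : 𝔼 → ℝ} (hN : IsOpen N) (hu : ContDiffOn ℝ ∞ u N) {x : 𝔼}
    (hx : x ∈ N) (i j : Fin 2) : lapl (pd i (pd j u)) x = pd i (pd j (lapl u)) x := by
  have s := fun k => smooth_pd hN (smooth_pd hN hu k) k
  unfold lapl
  rw [pd_pd_add hN (s 0) (s 1) hx, pd_fourth_comm hN hu hx, pd_fourth_comm hN hu hx]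

lemma smooth_lapl {N : Set 𝔼} {u : 𝔼 → ℝ} (hN : IsOpen N) (hu : ContDiffOn ℝ ∞ u N) :
    ContDiffOn ℝ ∞ (lapl u) N :=
  (smooth_pd hN (smooth_pd hN hu 0) 0).add (smooth_pd hN (smooth_pd hN hu 1) 1)

/-- First-order bounds for second derivatives. -/
structure TameOne (N : Set 𝔼) (τ g : 𝔼 → ℝ) : Prop where
  smooth : ContDiffOn ℝ ∞ g N
  b0 : BddFun N g
  b1 : ∀ i, WtBdd N τ (pd i g)

section

variable {N : Set 𝔼} {τ g h : 𝔼 → ℝ}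

lemma TameTwo.one (hg : TameTwo N τ g) : TameOne N τ g := ⟨hg.smooth, hg.b0, fun i => (hg.b1 i).wt⟩

lemma TameOne.add (hN : IsOpen N) (hg : TameOne N τ g) (hh : TameOne N τ h) :
    TameOne N τ fun x => g x + h x where
  smooth := hg.smooth.add hh.smooth
  b0 := hg.b0.add hh.b0
  b1 i := ((hg.b1 i).add (hh.b1 i)).congr fun _ hx =>
    pd_add (smooth_diffAt hN hg.smooth hx) (smooth_diffAt hN hh.smooth hx) i

lemma TameOne.mul (hN : IsOpen N) (hg : TameOne N τ g) (hh : TameOne N τ h) :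
    TameOne N τ fun x => g x * h x where
  smooth := hg.smooth.mul hh.smooth
  b0 := hg.b0.mul hh.b0
  b1 i := (((hg.b1 i).mul_bdd hh.b0).add (hg.b0.mul_wt (hh.b1 i))).congr fun _ hx =>
    pd_mul (smooth_diffAt hN hg.smooth hx) (smooth_diffAt hN hh.smooth hx) i

lemma lapl_mul_wt (hN : IsOpen N) (hg : TameTwo N τ g) (hh : TameOne N τ h) :
    WtBdd N τ fun x => lapl (fun y => g y * h y) x - g x * lapl h x := by
  have hl : WtBdd N τ (lapl g) := (hg.b2 0 0).add (hg.b2 1 1)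
  have h1 := (hl.mul_bdd hh.b0).add ((BddFun.const 2).mul_wt
    (((hg.b1 0).mul_wt (hh.b1 0)).add ((hg.b1 1).mul_wt (hh.b1 1))))
  refine h1.congr fun x hx => ?_
  simp only [lapl, pd_pd_mul hN hg.smooth hh.smooth hx]; ring

lemma ellForm_mul_wt (hN : IsOpen N) (hg : TameOne N τ g) (hh : TameTwo N τ h) {w : 𝔼 → 𝔼}
    (hw : ∀ i, BddFun N fun x => w x i) (hgw : WtBdd N τ fun x => ellForm g (w x) x) :
    WtBdd N τ fun x => ellForm (fun y => g y * h y) (w x) x := by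
  have h2 : WtBdd N τ fun x => ellForm h (w x) x := by
    have := ((hh.b2 0 0).add (hh.b2 1 1)).add (((((hw 0).mul (hw 0)).mul_wt (hh.b2 0 0)).add
      (((BddFun.const 2).mul ((hw 0).mul (hw 1))).mul_wt (hh.b2 0 1))).add
        (((hw 1).mul (hw 1)).mul_wt (hh.b2 1 1)))
    exact this.congr fun x hx => by simp only [ellForm, hessForm]; ring
  have hd := fun i => hg.b1 i
  have h3 := ((hgw.mul_bdd hh.b0).add (hg.b0.mul_wt h2)).add ((BddFun.const 2).mul_wt
    ((((hd 0).mul_bdd (hh.b1 0)).add ((hd 1).mul_bdd (hh.b1 1))).add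
    ((((hw 0).mul_wt (hd 0)).add ((hw 1).mul_wt (hd 1))).mul_bdd
      (((hw 0).mul (hh.b1 0)).add ((hw 1).mul (hh.b1 1))))))
  exact h3.congr fun x hx => ellForm_mul hN hg.smooth hh.smooth hx _

end

namespace LevelSetting

variable {N : Set 𝔼} {f : ℝ → ℝ} {u : 𝔼 → ℝ} {q₀ : ℝ}

lemma tameOne_pd_pd (S : LevelSetting N f u q₀) (i j : Fin 2) :
    TameOne N (thirdSize u) (pd i (pd j u)) :=
  ⟨smooth_pd S.isOpen (smooth_pd S.isOpen S.smooth j) i, S.b2 i j,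
    fun k => wtBdd_third S.isOpen S.smooth k i j⟩

lemma tame_coeff (S : LevelSetting N f u q₀) (c : ℝ) (i j : Fin 2) :
    TameTwo N (thirdSize u) fun x => c * (pd i u x * pd j u x) :=
  (TameTwo.const c).mul S.isOpen ((S.tame_pd i).mul S.isOpen (S.tame_pd j))

lemma tangHess_eq (u : 𝔼 → ℝ) : tangHess u = fun x =>
    1 * (pd 1 u x * pd 1 u x) * pd 0 (pd 0 u) x + (-2) * (pd 0 u x * pd 1 u x) * pd 0 (pd 1 u) x +
      1 * (pd 0 u x * pd 0 u x) * pd 1 (pd 1 u) x := by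
  funext x; simp only [tangHess]; ring

lemma tameOne_tangHess (S : LevelSetting N f u q₀) : TameOne N (thirdSize u) (tangHess u) := by
  rw [tangHess_eq]
  have h := fun c i j k l => (S.tame_coeff c i j).one.mul S.isOpen (S.tameOne_pd_pd k l)
  exact ((h 1 1 1 0 0).add S.isOpen (h (-2) 0 1 0 1)).add S.isOpen (h 1 0 0 1 1)

lemma bdd_perpGrad (S : LevelSetting N f u q₀) (i : Fin 2) : BddFun N fun x => perpGrad u x i := by
  fin_cases i
  · exact (S.b1 1).neg.congr fun x _ => by simp
  · exact (S.b1 0).congr fun x _ => by simp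

lemma ellForm_lapl_wt (S : LevelSetting N f u q₀) :
    WtBdd N (thirdSize u) fun x => ellForm (lapl u) (perpGrad u x) x := by
  have hN := S.isOpen
  have h := fun c i j k l => lapl_mul_wt hN (S.tame_coeff c i j) (S.tameOne_pd_pd k l)
  have hs := fun c i j k l => ((S.tame_coeff c i j).smooth.mul (S.tameOne_pd_pd k l).smooth)
  have hT : ∀ x ∈ N, lapl (tangHess u) x = lapl (mcRhs f u) x - lapl (lapl u) x := fun x hx => by
    have e : ∀ y ∈ N, tangHess u y = mcRhs f u y - lapl u y := fun y hy => by
      rw [← S.eqn y hy, lapl]; ring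
    have s1 := S.tame_mcRhs.smooth
    have s2 := smooth_lapl hN S.smooth
    have le : ∀ g : 𝔼 → ℝ, lapl g x = pd 0 (pd 0 g) x + pd 1 (pd 1 g) x := fun _ => rfl
    rw [le, le, le, pd_pd_congr hN e hx, pd_pd_congr hN e hx, pd_pd_sub hN s1 s2 hx,
      pd_pd_sub hN s1 s2 hx]
    ring
  have hsum : ∀ x ∈ N, lapl (tangHess u) x =
      lapl (fun y => 1 * (pd 1 u y * pd 1 u y) * pd 0 (pd 0 u) y) x +
      lapl (fun y => (-2) * (pd 0 u y * pd 1 u y) * pd 0 (pd 1 u) y) x +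
      lapl (fun y => 1 * (pd 0 u y * pd 0 u y) * pd 1 (pd 1 u) y) x := fun x hx => by
    have s1 := hs 1 1 1 0 0
    have s2 := hs (-2) 0 1 0 1
    have s3 := hs 1 0 0 1 1
    rw [tangHess_eq]
    simp only [lapl]
    rw [pd_pd_add hN (s1.add s2) s3 hx, pd_pd_add hN (s1.add s2) s3 hx, pd_pd_add hN s1 s2 hx,
      pd_pd_add hN s1 s2 hx]
    ring
  have hG : WtBdd N (thirdSize u) (lapl (mcRhs f u)) :=
    (S.tame_mcRhs.b2 0 0).add (S.tame_mcRhs.b2 1 1)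
  refine (hG.sub (((h 1 1 1 0 0).add (h (-2) 0 1 0 1)).add (h 1 0 0 1 1))).congr fun x hx => ?_
  have e1 := hT x hx
  rw [hsum x hx] at e1
  have c := lapl_pd_pd hN S.smooth hx
  have e2 : lapl (lapl u) x = pd 0 (pd 0 (lapl u)) x + pd 1 (pd 1 (lapl u)) x := rfl
  simp only [ellForm, hessForm, perpGrad_zero, perpGrad_one, c]
  linear_combination e1 - e2

lemma ellForm_tangHess_wt (S : LevelSetting N f u q₀) :
    WtBdd N (thirdSize u) fun x => ellForm (tangHess u) (perpGrad u x) x := by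
  have hN := S.isOpen
  have hw := S.bdd_perpGrad
  have hG : WtBdd N (thirdSize u) fun x => ellForm (mcRhs f u) (perpGrad u x) x := by
    have hh := S.tame_mcRhs
    have := ((hh.b2 0 0).add (hh.b2 1 1)).add (((((hw 0).mul (hw 0)).mul_wt (hh.b2 0 0)).add
      (((BddFun.const 2).mul ((hw 0).mul (hw 1))).mul_wt (hh.b2 0 1))).add
        (((hw 1).mul (hw 1)).mul_wt (hh.b2 1 1)))
    exact this.congr fun x hx => by simp only [ellForm, hessForm]; ring
  refine (hG.sub S.ellForm_lapl_wt).congr fun x hx => ?_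
  rw [← ellForm_sub hN S.tame_mcRhs.smooth (smooth_lapl hN S.smooth) hx]
  refine ellForm_congr hN (fun y hy => ?_) hx _
  rw [← S.eqn y hy, lapl]; ring

lemma smooth_sqrt_cube : ContDiffOn ℝ ∞ (fun s : ℝ => √s ^ 3) (Ioi 0) :=
  (contDiffOn_id.sqrt fun _ hs => (ne_of_gt hs)).pow 3

lemma tame_cube (S : LevelSetting N f u q₀) :
    TameTwo N (thirdSize u) fun x => √(pd 0 u x ^ 2 + pd 1 u x ^ 2) ^ 3 :=
  S.tame_comp_sq smooth_sqrt_cube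

lemma tame_inv_cube (S : LevelSetting N f u q₀) :
    TameTwo N (thirdSize u) fun x => (√(pd 0 u x ^ 2 + pd 1 u x ^ 2) ^ 3)⁻¹ :=
  S.tame_comp_sq (smooth_sqrt_cube.inv fun s hs => by
    have := Real.sqrt_pos.2 (show 0 < s from hs); positivity)

lemma levelCurv_eq (u : 𝔼 → ℝ) : levelCurv u = fun x =>
    tangHess u x * (√(pd 0 u x ^ 2 + pd 1 u x ^ 2) ^ 3)⁻¹ := by
  funext x; rw [levelCurv, div_eq_mul_inv]

lemma tameOne_levelCurv (S : LevelSetting N f u q₀) : TameOne N (thirdSize u) (levelCurv u) := by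
  rw [levelCurv_eq]; exact S.tameOne_tangHess.mul S.isOpen S.tame_inv_cube.one

lemma ellForm_levelCurv_wt (S : LevelSetting N f u q₀) :
    WtBdd N (thirdSize u) fun x => ellForm (levelCurv u) (perpGrad u x) x := by
  rw [levelCurv_eq]
  exact ellForm_mul_wt S.isOpen S.tameOne_tangHess S.tame_inv_cube S.bdd_perpGrad
    S.ellForm_tangHess_wt

/-- The third derivatives of `u` are controlled by the gradient of the level line curvature. -/
lemma thirdSize_wt (S : LevelSetting N f u q₀) :
    WtBdd N (fun x => ‖fderiv ℝ (levelCurv u) x‖) (thirdSize u) := by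
  have hN := S.isOpen
  set σ : 𝔼 → ℝ := fun x => ‖fderiv ℝ (levelCurv u) x‖ with hσ
  have hP : ∀ i, WtBdd N σ (pd i (levelCurv u)) := fun i => by
    refine ⟨1, zero_le_one, fun x _ => ?_⟩
    have h := (fderiv ℝ (levelCurv u) x).le_opNorm (EuclideanSpace.single i 1)
    simp only [PiLp.norm_single, norm_one, mul_one, Real.norm_eq_abs] at h
    have h2 : |σ x| = ‖fderiv ℝ (levelCurv u) x‖ := abs_of_nonneg (norm_nonneg _)
    rw [h2]
    change |fderiv ℝ (levelCurv u) x (EuclideanSpace.single i 1)| ≤ _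
    linarith
  have hPs := S.tameOne_levelCurv
  have hQ := S.tame_cube
  have eT : ∀ y ∈ N, tangHess u y = levelCurv u y * √(pd 0 u y ^ 2 + pd 1 u y ^ 2) ^ 3 :=
    fun y hy => by
      have := Real.sqrt_pos.2 (S.pos.trans_le (S.lower y hy))
      rw [levelCurv]; field_simp
  have hT : ∀ i, WtBdd N σ (pd i (tangHess u)) := fun i => by
    refine (((hP i).mul_bdd hQ.b0).add (hPs.b0.mul (hQ.b1 i)).wt).congr fun x hx => ?_
    rw [pd_congr hN eT hx i, pd_mul (smooth_diffAt hN hPs.smooth hx) (smooth_diffAt hN hQ.smooth hx)]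
  have hL : ∀ i, WtBdd N σ (pd i (lapl u)) := fun i => by
    have e : ∀ y ∈ N, lapl u y = mcRhs f u y - tangHess u y := fun y hy => by
      rw [← S.eqn y hy, lapl]; ring
    refine ((S.tame_mcRhs.b1 i).wt.sub (hT i)).congr fun x hx => ?_
    rw [pd_congr hN e hx i, pd_sub (smooth_diffAt hN S.tame_mcRhs.smooth hx)
      (smooth_diffAt hN S.tameOne_tangHess.smooth hx)]
  have hLe : ∀ i, ∀ x ∈ N, pd i (lapl u) x = pd i (pd 0 (pd 0 u)) x + pd i (pd 1 (pd 1 u)) x :=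
    fun i x hx => pd_add (smooth_diffAt hN (S.tameOne_pd_pd 0 0).smooth hx)
      (smooth_diffAt hN (S.tameOne_pd_pd 1 1).smooth hx) i
  -- the part of the derivative of `tangHess u` without third derivatives of `u`
  set r : Fin 2 → 𝔼 → ℝ := fun i x => pd i (tangHess u) x -
    (pd 1 u x ^ 2 * pd i (pd 0 (pd 0 u)) x - 2 * (pd 0 u x * pd 1 u x) * pd i (pd 0 (pd 1 u)) x +
      pd 0 u x ^ 2 * pd i (pd 1 (pd 1 u)) x) with hr
  have hrb : ∀ i, BddFun N (r i) := fun i => by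
    have h := fun c j k l m => (((S.tame_coeff c j k).b1 i).mul (S.b2 l m))
    refine (((h 1 1 1 0 0).add (h (-2) 0 1 0 1)).add (h 1 0 0 1 1)).congr fun x hx => ?_
    have d := fun c j k => smooth_diffAt hN (S.tame_coeff c j k).smooth hx
    have d2 := fun l m => smooth_diffAt hN (S.tameOne_pd_pd l m).smooth hx
    simp only [hr]
    rw [pd_congr hN (fun y _ => congrFun (tangHess_eq u) y) hx i,
      pd_add (((d 1 1 1).fun_mul (d2 0 0)).fun_add ((d (-2) 0 1).fun_mul (d2 0 1)))
        ((d 1 0 0).fun_mul (d2 1 1)), pd_add ((d 1 1 1).fun_mul (d2 0 0))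
        ((d (-2) 0 1).fun_mul (d2 0 1)), pd_mul (d 1 1 1) (d2 0 0), pd_mul (d (-2) 0 1) (d2 0 1),
      pd_mul (d 1 0 0) (d2 1 1)]
    ring
  have hA : BddFun N fun x => pd 1 u x * pd 1 u x + -(pd 0 u x * pd 0 u x) :=
    ((S.b1 1).mul (S.b1 1)).add ((S.b1 0).mul (S.b1 0)).neg
  have hB : BddFun N fun x => -2 * (pd 0 u x * pd 1 u x) :=
    (BddFun.const (-2)).mul ((S.b1 0).mul (S.b1 1))
  have hC : BddFun N fun x => pd 0 u x * pd 0 u x := (S.b1 0).mul (S.b1 0)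
  have hR0 : WtBdd N σ fun x => pd 0 (tangHess u) x - r 0 x -
      pd 0 u x * pd 0 u x * pd 0 (lapl u) x := ((hT 0).sub (hrb 0).wt).sub (hC.mul_wt (hL 0))
  have hR1 : WtBdd N σ fun x => pd 1 (tangHess u) x - r 1 x - -2 * (pd 0 u x * pd 1 u x) *
      pd 0 (lapl u) x - pd 0 u x * pd 0 u x * pd 1 (lapl u) x :=
    (((hT 1).sub (hrb 1).wt).sub (hB.mul_wt (hL 0))).sub (hC.mul_wt (hL 1))
  have hD : BddFun N fun x => ((pd 0 u x ^ 2 + pd 1 u x ^ 2) ^ 2)⁻¹ := by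
    refine ⟨(q₀ ^ 2)⁻¹, by positivity, fun x hx => ?_⟩
    have h0 := S.pos
    have h1 := S.lower x hx
    rw [abs_of_nonneg (by positivity)]
    exact inv_anti₀ (by positivity) (pow_le_pow_left₀ h0.le h1 2)
  have comm : ∀ x ∈ N, pd 1 (pd 0 (pd 0 u)) x = pd 0 (pd 0 (pd 1 u)) x ∧
      pd 1 (pd 0 (pd 1 u)) x = pd 0 (pd 1 (pd 1 u)) x := fun x hx =>
    ⟨(smooth_pd_comm hN (smooth_pd hN S.smooth 0) hx 1 0).trans (pd_third_comm hN S.smooth hx 0 1 0),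
      smooth_pd_comm hN (smooth_pd hN S.smooth 1) hx 1 0⟩
  have ht0 : WtBdd N σ (pd 0 (pd 0 (pd 0 u))) := by
    refine (hD.mul_wt ((hA.mul_wt hR0).sub (hB.mul_wt hR1))).congr fun x hx => ?_
    have hq : 0 < pd 0 u x ^ 2 + pd 1 u x ^ 2 := S.pos.trans_le (S.lower x hx)
    obtain ⟨c1, c2⟩ := comm x hx
    simp only [hr, hLe 0 x hx, hLe 1 x hx, c1, c2]
    field_simp
    ring
  have ht1 : WtBdd N σ (pd 0 (pd 0 (pd 1 u))) := by
    refine (hD.mul_wt ((hA.mul_wt hR1).add (hB.mul_wt hR0))).congr fun x hx => ?_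
    have hq : 0 < pd 0 u x ^ 2 + pd 1 u x ^ 2 := S.pos.trans_le (S.lower x hx)
    obtain ⟨c1, c2⟩ := comm x hx
    simp only [hr, hLe 0 x hx, hLe 1 x hx, c1, c2]
    field_simp
    ring
  have ht2 : WtBdd N σ (pd 0 (pd 1 (pd 1 u))) := ((hL 0).sub ht0).congr fun x hx => by
    rw [hLe 0 x hx]; ring
  have ht3 : WtBdd N σ (pd 1 (pd 1 (pd 1 u))) := ((hL 1).sub ht1).congr fun x hx => by
    rw [hLe 1 x hx, (comm x hx).1]; ring
  exact ((ht0.abs.add ht1.abs).add ht2.abs).add ht3.abs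

/-- The level line curvature satisfies an elliptic differential inequality. -/
lemma ellForm_levelCurv_bound (S : LevelSetting N f u q₀) : ∃ B ≥ 0, ∀ x ∈ N,
    |ellForm (levelCurv u) (perpGrad u x) x| ≤ B * (1 + ‖fderiv ℝ (levelCurv u) x‖) := by
  obtain ⟨B, hB, h⟩ := S.ellForm_levelCurv_wt.trans S.thirdSize_wt
  exact ⟨B, hB, fun x hx => (h x hx).trans_eq (by rw [abs_of_nonneg (norm_nonneg _)])⟩

end LevelSetting

lemma norm_fderiv_le_pd (g : 𝔼 → ℝ) (x : 𝔼) : ‖fderiv ℝ g x‖ ≤ |pd 0 g x| + |pd 1 g x| := by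
  refine ContinuousLinearMap.opNorm_le_bound _ (by positivity) fun d => ?_
  rw [fderiv_apply_eq, Real.norm_eq_abs]
  refine (abs_add_le _ _).trans ?_
  rw [abs_mul, abs_mul]
  nlinarith [mul_le_mul_of_nonneg_right (abs_apply_le d 0) (abs_nonneg (pd 0 g x)),
    mul_le_mul_of_nonneg_right (abs_apply_le d 1) (abs_nonneg (pd 1 g x))]

lemma lipschitz_of_pd {O : Set 𝔼} (hc : Convex ℝ O) {g : 𝔼 → ℝ}
    (hg : ∀ x ∈ O, DifferentiableAt ℝ g x) {C : ℝ} (hC : ∀ i, ∀ x ∈ O, |pd i g x| ≤ C) :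
    ∀ x ∈ O, ∀ y ∈ O, |g x - g y| ≤ (C + C) * ‖x - y‖ := fun _ hx _ hy =>
  hc.norm_image_sub_le_of_norm_fderiv_le hg
    (fun z hz => (norm_fderiv_le_pd g z).trans (add_le_add (hC 0 z hz) (hC 1 z hz))) hy hx

lemma lipschitz_closure {O : Set 𝔼} {g : 𝔼 → ℝ} (hg : ContinuousOn g (closure O)) {C : ℝ}
    (h : ∀ x ∈ O, ∀ y ∈ O, |g x - g y| ≤ C * ‖x - y‖) :
    ∀ x ∈ closure O, ∀ y ∈ closure O, |g x - g y| ≤ C * ‖x - y‖ := by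
  intro x hx y hy
  have hxy : ((x, y) : 𝔼 × 𝔼) ∈ closure (O ×ˢ O) := by rw [closure_prod_eq]; exact ⟨hx, hy⟩
  have hc : ContinuousOn (fun p : 𝔼 × 𝔼 => |g p.1 - g p.2|) (closure (O ×ˢ O)) := by
    rw [closure_prod_eq]
    exact ((hg.comp continuousOn_fst fun p hp => hp.1).sub
      (hg.comp continuousOn_snd fun p hp => hp.2)).abs
  have hc2 : ContinuousOn (fun p : 𝔼 × 𝔼 => C * ‖p.1 - p.2‖) (closure (O ×ˢ O)) := by fun_prop
  exact ContinuousWithinAt.closure_le (f := fun p : 𝔼 × 𝔼 => |g p.1 - g p.2|)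
    (g := fun p => C * ‖p.1 - p.2‖) hxy ((hc _ hxy).mono subset_closure)
    ((hc2 _ hxy).mono subset_closure) fun p hp => h _ hp.1 _ hp.2

namespace MCSetting

variable {Ω V : Set 𝔼} {f : ℝ → ℝ} {u : 𝔼 → ℝ} {γ : ℝ → 𝔼} {T : ℝ}

lemma contDiffOn_pd_one (S : MCSetting Ω V f u γ T) (i : Fin 2) : ContDiffOn ℝ 1 (pd i u) V :=
  contDiffOn_pd S.isOpenV S.contDiffV (by norm_num) i

lemma continuousOn_u (S : MCSetting Ω V f u γ T) : ContinuousOn u (closure Ω) :=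
  S.contDiffV.continuousOn.mono S.subV

lemma continuousOn_pd (S : MCSetting Ω V f u γ T) (i : Fin 2) :
    ContinuousOn (pd i u) (closure Ω) :=
  (S.contDiffOn_pd_one i).continuousOn.mono S.subV

lemma continuousOn_pd_pd (S : MCSetting Ω V f u γ T) (i j : Fin 2) :
    ContinuousOn (pd i (pd j u)) (closure Ω) :=
  (contDiffOn_pd S.isOpenV (S.contDiffOn_pd_one j) (m := 0) (by norm_num) i).continuousOn.mono S.subV

lemma bddFun_of_continuousOn (S : MCSetting Ω V f u γ T) {g : 𝔼 → ℝ}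
    (hg : ContinuousOn g (closure Ω)) : BddFun (closure Ω) g := by
  obtain ⟨C, hC⟩ := S.closure_isCompact.exists_bound_of_continuousOn hg
  exact ⟨|C|, abs_nonneg _, fun x hx => (hC x hx).trans (le_abs_self _)⟩

lemma frontier_nonempty (S : MCSetting Ω V f u γ T) : (frontier Ω).Nonempty := ⟨_, S.γmem 0⟩

lemma mem_of_infDist_pos (S : MCSetting Ω V f u γ T) {x : 𝔼} (hx : x ∈ closure Ω)
    (h : 0 < infDist x (frontier Ω)) : x ∈ Ω := by
  by_contra hn
  rw [infDist_zero_of_mem (S.mem_frontier hx hn)] at h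
  exact h.false

/-- The gradient is bounded below in a neighbourhood of the boundary. -/
lemma exists_collar (S : MCSetting Ω V f u γ T) : ∃ ρ > 0, ∃ q₀ > 0, ∀ x ∈ closure Ω,
    infDist x (frontier Ω) ≤ ρ → q₀ ≤ pd 0 u x ^ 2 + pd 1 u x ^ 2 := by
  have hq : ContinuousOn (fun x => pd 0 u x ^ 2 + pd 1 u x ^ 2) (closure Ω) :=
    ((S.continuousOn_pd 0).pow 2).add ((S.continuousOn_pd 1).pow 2)
  obtain ⟨x₀, hx₀, hmin⟩ := S.frontier_isCompact.exists_isMinOn S.frontier_nonempty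
    (hq.mono S.frontier_sub)
  set m := pd 0 u x₀ ^ 2 + pd 1 u x₀ ^ 2 with hm
  have hmpos : 0 < m := S.grad_pos hx₀
  have hK : IsCompact (closure Ω ∩ (fun x => pd 0 u x ^ 2 + pd 1 u x ^ 2) ⁻¹' Iic (m / 2)) :=
    S.closure_isCompact.of_isClosed_subset (hq.preimage_isClosed_of_isClosed isClosed_closure
      isClosed_Iic) inter_subset_left
  rcases eq_empty_or_nonempty (closure Ω ∩ (fun x => pd 0 u x ^ 2 + pd 1 u x ^ 2) ⁻¹' Iic (m / 2))
    with he | hne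
  · refine ⟨1, one_pos, m / 2, by positivity, fun x hx _ => ?_⟩
    by_contra! hlt
    exact (he.le ⟨hx, hlt.le⟩ : x ∈ (∅ : Set 𝔼))
  obtain ⟨y, hy, hymin⟩ := hK.exists_isMinOn hne (continuous_infDist_pt (frontier Ω)).continuousOn
  have hypos : 0 < infDist y (frontier Ω) := by
    refine (isClosed_frontier.notMem_iff_infDist_pos S.frontier_nonempty).1 fun h => ?_
    have h1 : m ≤ pd 0 u y ^ 2 + pd 1 u y ^ 2 := hmin h
    have h2 : pd 0 u y ^ 2 + pd 1 u y ^ 2 ≤ m / 2 := hy.2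
    linarith
  refine ⟨infDist y (frontier Ω) / 2, by positivity, m / 2, by positivity, fun x hx hd => ?_⟩
  by_contra! hlt
  have : infDist y (frontier Ω) ≤ infDist x (frontier Ω) := hymin ⟨hx, hlt.le⟩
  linarith

/-- The set of points of `Ω` at distance less than `ρ` from the boundary. -/
def _root_.collar (Ω : Set 𝔼) (ρ : ℝ) : Set 𝔼 := {x | x ∈ Ω ∧ infDist x (frontier Ω) < ρ}

lemma levelSetting (S : MCSetting Ω V f u γ T) {ρ q₀ : ℝ} (hq₀ : 0 < q₀)
    (hq : ∀ x ∈ closure Ω, infDist x (frontier Ω) ≤ ρ → q₀ ≤ pd 0 u x ^ 2 + pd 1 u x ^ 2) :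
    LevelSetting (collar Ω ρ) f u q₀ := by
  have hmono : ∀ {g}, ContinuousOn g (closure Ω) → BddFun (collar Ω ρ) g := fun hg => by
    obtain ⟨C, hC, h⟩ := S.bddFun_of_continuousOn hg
    exact ⟨C, hC, fun x hx => h x (subset_closure hx.1)⟩
  exact {
    isOpen := S.isOpen.inter (isOpen_lt (continuous_infDist_pt _) continuous_const)
    smooth := S.smooth.mono fun x hx => hx.1
    fsmooth := S.fsmooth
    pos := hq₀
    lower := fun x hx => hq x (subset_closure hx.1) hx.2.le
    b0 := hmono S.continuousOn_u
    b1 := fun i => hmono (S.continuousOn_pd i)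
    b2 := fun i j => hmono (S.continuousOn_pd_pd i j)
    eqn := fun x hx => S.eqn x (subset_closure hx.1) }

lemma exists_normal (S : MCSetting Ω V f u γ T) {x₀ : 𝔼} (hx₀ : x₀ ∈ frontier Ω) :
    ∃ ν : 𝔼, ‖ν‖ = 1 ∧ ∀ x ∈ closure Ω, 0 ≤ inner ℝ ν (x - x₀) := by
  have hg : gradient u x₀ ≠ 0 := fun h => by
    have := S.grad_pos hx₀
    rw [← norm_gradient_sq, h] at this
    simp at this
  refine ⟨‖gradient u x₀‖⁻¹ • gradient u x₀, norm_smul_inv_norm hg, fun x hx => ?_⟩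
  rw [real_inner_smul_left, inner_gradient_left]
  exact mul_nonneg (by positivity) (S.fderiv_nonneg hx₀ hx)

lemma continuousOn_levelCurv (S : MCSetting Ω V f u γ T) {E : Set 𝔼} (hE : E ⊆ closure Ω)
    (hq : ∀ x ∈ E, 0 < pd 0 u x ^ 2 + pd 1 u x ^ 2) : ContinuousOn (levelCurv u) E := by
  have h1 := fun i => (S.continuousOn_pd i).mono hE
  have h2 := fun i j => (S.continuousOn_pd_pd i j).mono hE
  unfold levelCurv tangHess
  refine ((((h1 1).pow 2).mul (h2 0 0)).sub ((continuousOn_const.mul ((h1 0).mul (h1 1))).mul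
    (h2 0 1))).add (((h1 0).pow 2).mul (h2 1 1)) |>.div
    ((((h1 0).pow 2).add ((h1 1).pow 2)).sqrt.pow 3) fun x hx => ?_
  have := Real.sqrt_pos.2 (hq x hx)
  positivity

lemma norm_perpGrad_sq (u : 𝔼 → ℝ) (x : 𝔼) :
    ‖perpGrad u x‖ ^ 2 = pd 0 u x ^ 2 + pd 1 u x ^ 2 := by
  rw [norm_sq_eq, perpGrad_zero, perpGrad_one]; ring

/-- The level line curvature satisfies a Lipschitz estimate at boundary points. -/
lemma levelCurv_boundary_lipschitz (S : MCSetting Ω V f u γ T) {ρ q₀ : ℝ} (hρ : 0 < ρ)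
    (hq₀ : 0 < q₀)
    (hq : ∀ x ∈ closure Ω, infDist x (frontier Ω) ≤ ρ → q₀ ≤ pd 0 u x ^ 2 + pd 1 u x ^ 2) :
    ∃ C > 0, ∃ δ > 0, ∀ x₀ ∈ frontier Ω, ∀ x ∈ closure Ω, ‖x - x₀‖ ≤ δ →
      |levelCurv u x - levelCurv u x₀| ≤ C * ‖x - x₀‖ := by
  have SL := S.levelSetting hq₀ hq
  obtain ⟨B, hB, hell⟩ := SL.ellForm_levelCurv_bound
  obtain ⟨C₀, hC₀, htaylor⟩ := S.levelCurv_boundary_taylor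
  obtain ⟨W, hW, hWb⟩ := S.bddFun_of_continuousOn
    (((S.continuousOn_pd 0).pow 2).add ((S.continuousOn_pd 1).pow 2))
  set E : Set 𝔼 := closure Ω ∩ {x | infDist x (frontier Ω) ≤ ρ} with hE
  have hEc : IsCompact E := S.closure_isCompact.inter_right
    (isClosed_le (continuous_infDist_pt _) continuous_const)
  have hPc : ContinuousOn (levelCurv u) E := S.continuousOn_levelCurv inter_subset_left
    fun x hx => hq₀.trans_le (hq x hx.1 hx.2)
  obtain ⟨M₀, hM₀⟩ := hEc.exists_bound_of_continuousOn hPc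
  have hM₀' : ∀ x ∈ E, |levelCurv u x| ≤ |M₀| := fun x hx => (hM₀ x hx).trans (le_abs_self _)
  obtain ⟨δ, hδ, hδρ, hBδ⟩ : ∃ δ > 0, δ ≤ ρ ∧ B * δ ≤ 1 / 2 := by
    refine ⟨min ρ (1 / (2 * (B + 1))), by positivity, min_le_left _ _, ?_⟩
    calc B * min ρ (1 / (2 * (B + 1))) ≤ B * (1 / (2 * (B + 1))) := by
          gcongr; exact min_le_right _ _
      _ ≤ 1 / 2 := by
          rw [mul_one_div, div_le_div_iff₀ (by positivity) (by positivity)]; linarith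
  obtain ⟨C, hC, hbar⟩ := boundary_barrier B W C₀ |M₀| δ hB hW hC₀ (abs_nonneg _) hδ hBδ
  refine ⟨C, hC, δ, hδ, fun x₀ hx₀ x hx hxδ => ?_⟩
  obtain ⟨ν, hν, hsup⟩ := S.exists_normal hx₀
  obtain ⟨g, hg, hgt⟩ := htaylor x₀ hx₀
  have hsub : closure Ω ∩ closedBall x₀ δ ⊆ E := fun y hy =>
    ⟨hy.1, ((infDist_le_dist_of_mem hx₀).trans hy.2).trans hδρ⟩
  have hx₀E : x₀ ∈ E := hsub ⟨S.frontier_sub hx₀, mem_closedBall_self hδ.le⟩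
  have hxm : x ∈ closure Ω ∩ closedBall x₀ δ := ⟨hx, by rwa [mem_closedBall, dist_eq_norm]⟩
  have hcol : ∀ y ∈ Ω ∩ ball x₀ δ, y ∈ collar Ω ρ := fun y hy =>
    ⟨hy.1, ((infDist_le_dist_of_mem hx₀).trans_lt hy.2).trans_le hδρ⟩
  have hcond : ∀ y ∈ Ω ∩ ball x₀ δ, ContDiffAt ℝ 2 (levelCurv u) y ∧ ‖perpGrad u y‖ ^ 2 ≤ W := by
    intro y hy
    refine ⟨(SL.tameOne_levelCurv.smooth.contDiffAt (SL.isOpen.mem_nhds (hcol y hy))).of_le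
      (by norm_cast), ?_⟩
    rw [norm_perpGrad_sq]
    exact (le_abs_self _).trans (hWb y (subset_closure hy.1))
  have h1 := hbar Ω (levelCurv u) (perpGrad u) x₀ ν g S.isOpen hν hsup hg (hPc.mono hsub)
    (fun y hy => hM₀' y (hsub hy)) (hM₀' x₀ hx₀E)
    (fun y hy => ⟨(hcond y hy).1, (hcond y hy).2, (abs_le.1 (hell y (hcol y hy))).1⟩)
    (fun y hy => by have := (abs_le.1 (hgt y hy.1)).2; linarith) x hxm
  have h2 := hbar Ω (fun y => -levelCurv u y) (perpGrad u) x₀ ν (-g) S.isOpen hν hsup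
    (by rwa [norm_neg]) (hPc.mono hsub).neg
    (fun y hy => by rw [abs_neg]; exact hM₀' y (hsub hy)) (by rw [abs_neg]; exact hM₀' x₀ hx₀E)
    (fun y hy => ⟨(hcond y hy).1.neg, (hcond y hy).2, by
      rw [ellForm_fun_neg, fderiv_fun_neg, norm_neg]
      exact neg_le_neg (abs_le.1 (hell y (hcol y hy))).2⟩)
    (fun y hy => by have := (abs_le.1 (hgt y hy.1)).1; rw [inner_neg_left]; linarith) x hxm
  rw [abs_le]
  constructor <;> linarith

lemma perpGrad_lipschitz (S : MCSetting Ω V f u γ T) : ∃ L : ℝ, ∀ x ∈ Ω, ∀ y ∈ Ω,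
    ‖perpGrad u x - perpGrad u y‖ ≤ L * ‖x - y‖ := by
  have h : ∀ j, ∃ L : ℝ, ∀ x ∈ Ω, ∀ y ∈ Ω, |pd j u x - pd j u y| ≤ L * ‖x - y‖ := fun j => by
    obtain ⟨C, -, hC⟩ := S.bddFun_of_continuousOn (S.continuousOn_pd_pd 0 j)
    obtain ⟨D, -, hD⟩ := S.bddFun_of_continuousOn (S.continuousOn_pd_pd 1 j)
    refine ⟨_, lipschitz_of_pd S.convex
      (fun x hx => smooth_diffAt S.isOpen (smooth_pd S.isOpen S.smooth j) hx) (C := max C D)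
      fun i x hx => ?_⟩
    fin_cases i
    · exact (hC x (subset_closure hx)).trans (le_max_left _ _)
    · exact (hD x (subset_closure hx)).trans (le_max_right _ _)
  obtain ⟨L0, h0⟩ := h 0
  obtain ⟨L1, h1⟩ := h 1
  refine ⟨L0 + L1, fun x hx y hy => (norm_le_abs_add _).trans ?_⟩
  have a0 := h0 x hx y hy
  have a1 := h1 x hx y hy
  have e0 : |(perpGrad u x - perpGrad u y) 0| = |pd 1 u x - pd 1 u y| := by
    rw [PiLp.sub_apply, perpGrad_zero, perpGrad_zero, ← abs_neg]; ring_nf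
  have e1 : |(perpGrad u x - perpGrad u y) 1| = |pd 0 u x - pd 0 u y| := by
    rw [PiLp.sub_apply, perpGrad_one, perpGrad_one]
  rw [e0, e1]; linarith

/-- The third derivatives of `u` are bounded near the boundary. -/
lemma thirdSize_bdd_collar (S : MCSetting Ω V f u γ T) :
    ∃ ρ > 0, BddFun (collar Ω ρ) (thirdSize u) := by
  obtain ⟨ρ', hρ', q₀, hq₀, hq⟩ := S.exists_collar
  obtain ⟨ρ, rfl⟩ : ∃ ρ, ρ' = 2 * ρ := ⟨ρ' / 2, by ring⟩
  have hρ : 0 < ρ := by linarith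
  have SL' := S.levelSetting hq₀ hq
  have hq1 : ∀ x ∈ closure Ω, infDist x (frontier Ω) ≤ ρ → q₀ ≤ pd 0 u x ^ 2 + pd 1 u x ^ 2 :=
    fun x hx h => hq x hx (by linarith)
  have SL := S.levelSetting hq₀ hq1
  obtain ⟨B, hB, hell⟩ := SL.ellForm_levelCurv_bound
  obtain ⟨C₁, hC₁, δ, hδ, hbdry⟩ := S.levelCurv_boundary_lipschitz hρ hq₀ hq1
  obtain ⟨L, hL⟩ := S.perpGrad_lipschitz
  set E : Set 𝔼 := closure Ω ∩ {x | infDist x (frontier Ω) ≤ ρ} with hE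
  have hEc : IsCompact E := S.closure_isCompact.inter_right
    (isClosed_le (continuous_infDist_pt _) continuous_const)
  have hPc : ContinuousOn (levelCurv u) E := S.continuousOn_levelCurv inter_subset_left
    fun x hx => hq₀.trans_le (hq1 x hx.1 hx.2)
  have hsm := SL'.tameOne_levelCurv.smooth
  -- the inner part of the collar
  set F : Set 𝔼 := closure Ω ∩ {x | ρ / 2 ≤ infDist x (frontier Ω)} ∩
    {x | infDist x (frontier Ω) ≤ 3 * ρ / 2} with hF
  have hFc : IsCompact F := (S.closure_isCompact.inter_right
    (isClosed_le continuous_const (continuous_infDist_pt _))).inter_right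
    (isClosed_le (continuous_infDist_pt _) continuous_const)
  have hFN : F ⊆ collar Ω (2 * ρ) := fun x hx => by
    have h1 : ρ / 2 ≤ infDist x (frontier Ω) := hx.1.2
    have h2 : infDist x (frontier Ω) ≤ 3 * ρ / 2 := hx.2
    exact ⟨S.mem_of_infDist_pos hx.1.1 (by linarith), by linarith⟩
  obtain ⟨M₁, hM₁⟩ := hFc.exists_bound_of_continuousOn
    (((hsm.fderiv_of_isOpen SL'.isOpen (m := 0) (by simp)).continuousOn).mono hFN)
  have hinner : ∀ x ∈ closure Ω, infDist x (frontier Ω) = ρ → ∀ y ∈ closure Ω, ‖x - y‖ ≤ ρ / 2 →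
      |levelCurv u x - levelCurv u y| ≤ |M₁| * ‖x - y‖ := by
    intro x hx hxρ y hy hxy
    have hseg : segment ℝ y x ⊆ F := by
      intro z hz
      have hzc : z ∈ closure Ω := S.sconv.convex.segment_subset hy hx hz
      have hzx : dist z x ≤ ρ / 2 := by
        have := segment_subset_closedBall_right y x hz
        rw [mem_closedBall, dist_comm y x, dist_eq_norm x y] at this
        exact this.trans hxy
      have h1 : infDist z (frontier Ω) ≤ infDist x (frontier Ω) + dist z x :=
        infDist_le_infDist_add_dist
      have h2 : infDist x (frontier Ω) ≤ infDist z (frontier Ω) + dist x z :=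
        infDist_le_infDist_add_dist
      rw [dist_comm x z] at h2
      refine ⟨⟨hzc, ?_⟩, ?_⟩
      · change ρ / 2 ≤ infDist z (frontier Ω); linarith
      · change infDist z (frontier Ω) ≤ 3 * ρ / 2; linarith
    exact (convex_segment y x).norm_image_sub_le_of_norm_fderiv_le
      (fun z hz => smooth_diffAt SL'.isOpen hsm (hFN (hseg hz)))
      (fun z hz => (hM₁ z (hseg hz)).trans (le_abs_self _)) (left_mem_segment ℝ y x)
      (right_mem_segment ℝ y x)
  have hbd1 : ∀ x ∈ E, ∀ y ∈ E, ‖x - y‖ ≤ min δ (ρ / 2) → x ∉ collar Ω ρ →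
      |levelCurv u x - levelCurv u y| ≤ (C₁ + |M₁|) * ‖x - y‖ := by
    intro x hx y hy hxy hxn
    have n1 : 0 ≤ C₁ * ‖x - y‖ := by positivity
    have n2 : 0 ≤ |M₁| * ‖x - y‖ := by positivity
    rw [add_mul]
    by_cases hxf : x ∈ frontier Ω
    · have := hbdry x hxf y hy.1 (by rw [norm_sub_rev]; exact hxy.trans (min_le_left _ _))
      rw [abs_sub_comm, norm_sub_rev] at this
      linarith
    · have hxΩ : x ∈ Ω := by by_contra h; exact hxf (S.mem_frontier hx.1 h)
      have hxρ : infDist x (frontier Ω) = ρ := by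
        refine le_antisymm hx.2 ?_
        by_contra! h
        exact hxn ⟨hxΩ, h⟩
      have := hinner x hx.1 hxρ y hy.1 (hxy.trans (min_le_right _ _))
      linarith
  obtain ⟨M, hM, δ', hδ', hlip⟩ := doubling (O := collar Ω ρ) (w := perpGrad u) (L := L) hEc
    SL.isOpen (fun x hx => ⟨subset_closure hx.1, hx.2.le⟩) hPc hB (C₁ := C₁ + |M₁|)
    (by positivity) (δ₀ := min δ (ρ / 2)) (by positivity)
    (fun x hx => ⟨(SL.tameOne_levelCurv.smooth.contDiffAt (SL.isOpen.mem_nhds hx)).of_le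
      (by norm_cast), hell x hx⟩)
    (fun x hx y hy => hL x hx.1 y hy.1)
    (fun x hx y hy hxy hn => by
      rcases hn with hn | hn
      · exact hbd1 x hx y hy hxy hn
      · rw [abs_sub_comm, norm_sub_rev]
        exact hbd1 y hy x hx (by rwa [norm_sub_rev]) hn)
  refine ⟨ρ, hρ, ?_⟩
  have hσ : BddFun (collar Ω ρ) fun x => ‖fderiv ℝ (levelCurv u) x‖ := by
    refine ⟨M, hM, fun x hx => ?_⟩
    rw [abs_of_nonneg (norm_nonneg _)]
    refine norm_fderiv_le_of_lip' ℝ hM ?_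
    filter_upwards [SL.isOpen.mem_nhds hx, closedBall_mem_nhds x hδ'] with y hy hyδ
    exact hlip y ⟨subset_closure hy.1, hy.2.le⟩ x ⟨subset_closure hx.1, hx.2.le⟩
      (by rwa [← dist_eq_norm])
  obtain ⟨C, hC, h1⟩ := SL.thirdSize_wt
  obtain ⟨D, hD, h2⟩ := hσ
  exact ⟨C * (1 + D), by positivity, fun x hx => (h1 x hx).trans (by gcongr; exact h2 x hx)⟩

lemma thirdSize_bdd (S : MCSetting Ω V f u γ T) : BddFun Ω (thirdSize u) := by
  obtain ⟨ρ, hρ, C, hC, h⟩ := S.thirdSize_bdd_collar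
  have hs := S.smooth
  have hc : ∀ i j k, ContinuousOn (pd i (pd j (pd k u))) Ω := fun i j k =>
    (smooth_pd S.isOpen (smooth_pd S.isOpen (smooth_pd S.isOpen hs k) j) i).continuousOn
  have hcont : ContinuousOn (thirdSize u) Ω :=
    (((hc 0 0 0).abs.add (hc 0 0 1).abs).add (hc 0 1 1).abs).add (hc 1 1 1).abs
  have hK : IsCompact (closure Ω ∩ {x | ρ ≤ infDist x (frontier Ω)}) :=
    S.closure_isCompact.inter_right (isClosed_le continuous_const (continuous_infDist_pt _))
  obtain ⟨D, hD⟩ := hK.exists_bound_of_continuousOn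
    (hcont.mono fun x hx => S.mem_of_infDist_pos hx.1 (hρ.trans_le hx.2))
  refine ⟨C + |D|, by positivity, fun x hx => ?_⟩
  by_cases hxρ : infDist x (frontier Ω) < ρ
  · have := h x ⟨hx, hxρ⟩
    have := abs_nonneg D
    linarith
  · have : |thirdSize u x| ≤ D := hD x ⟨subset_closure hx, not_lt.1 hxρ⟩
    have := le_abs_self D
    linarith

/-- The second derivatives of `u` are Lipschitz up to the boundary. -/
lemma pd_pd_lipschitz (S : MCSetting Ω V f u γ T) : ∃ C ≥ 0, ∀ i j, ∀ x ∈ closure Ω,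
    ∀ y ∈ closure Ω, |pd i (pd j u) x - pd i (pd j u) y| ≤ C * ‖x - y‖ := by
  obtain ⟨D, hD, h1⟩ := S.thirdSize_bdd
  have h3 : ∀ i j k, ∀ x ∈ Ω, |pd i (pd j (pd k u)) x| ≤ D := fun i j k x hx =>
    (abs_third_le S.isOpen S.smooth hx i j k).trans ((le_abs_self _).trans (h1 x hx))
  refine ⟨D + D, by positivity, fun i j => lipschitz_closure (S.continuousOn_pd_pd i j) ?_⟩
  exact lipschitz_of_pd S.convex (fun x hx => smooth_diffAt S.isOpen
    (smooth_pd S.isOpen (smooth_pd S.isOpen S.smooth j) i) hx) fun k x hx => h3 k i j x hx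

end MCSetting

section crossing

open Complex

lemma eq_of_exp_const {s : Set ℂ} (hs : IsPreconnected s) {g : ℂ → ℂ} (hg : ContinuousOn g s)
    {c : ℂ} (hc : ∀ z ∈ s, exp (g z) = c) {x y : ℂ} (hx : x ∈ s) (hy : y ∈ s) : g x = g y := by
  have hcount : (exp ⁻¹' {c}).Countable := by
    refine (countable_range fun n : ℤ => g x + n * (2 * Real.pi * I)).mono fun z hz => ?_
    obtain ⟨n, hn⟩ := exp_eq_exp_iff_exists_int.1 ((mem_singleton_iff.1 hz).trans (hc x hx).symm)
    exact ⟨n, hn.symm⟩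
  exact hcount.isTotallyDisconnected (g '' s) (image_subset_iff.2 hc) (hs.image g hg)
    (mem_image_of_mem g hx) (mem_image_of_mem g hy)

lemma div_mem_slitPlane {a b : ℂ} (hb : b ≠ 0) (h : ‖a - b‖ < ‖b‖) : a / b ∈ slitPlane := by
  have h1 : a / b = 1 + (a - b) / b := by field_simp; ring
  rw [h1]
  refine mem_slitPlane_of_norm_lt_one ?_
  rw [norm_div, div_lt_one (norm_pos_iff.2 hb)]
  exact h

/-- A continuous branch of the logarithm of `(z - p) / (z - q)` off a connected set containing
both `p` and `q`. -/
lemma exists_log_ratio {K S : Set ℂ} (hK : IsClosed K) (hS : IsPreconnected S)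
    (hd : Disjoint S K) {p q : ℂ} (hp : p ∈ S) (hq : q ∈ S) :
    ∃ L : ℂ → ℂ, ContinuousOn L K ∧ ∀ z ∈ K, exp (L z) * (z - q) = z - p := by
  have hne : ∀ {z w}, w ∈ S → z ∈ K → z - w ≠ 0 := fun hw hz h =>
    disjoint_left.1 hd hw (by rwa [← sub_eq_zero.1 h])
  refine hS.induction₂ (fun p q => ∃ L : ℂ → ℂ, ContinuousOn L K ∧
    ∀ z ∈ K, exp (L z) * (z - q) = z - p) ?_ ?_ ?_ hp hq
  · intro q hq
    have hqK : Kᶜ ∈ 𝓝 q := hK.isOpen_compl.mem_nhds (disjoint_left.1 hd hq)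
    obtain ⟨ε, hε, hball⟩ := Metric.mem_nhds_iff.1 hqK
    filter_upwards [self_mem_nhdsWithin, nhdsWithin_le_nhds (ball_mem_nhds q (half_pos hε))]
      with p hpS hp
    refine ⟨fun z => log ((z - q) / (z - p)), ?_, fun z hz => ?_⟩
    · refine ContinuousOn.clog ((by fun_prop : ContinuousOn (fun z : ℂ => z - q) K).div
        (by fun_prop) fun z hz => hne hpS hz) fun z hz => ?_
      refine div_mem_slitPlane (hne hpS hz) ?_
      have h1 : ε ≤ ‖z - q‖ := by
        by_contra! h
        exact hball (mem_ball_iff_norm.2 h) hz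
      have h2 : ‖p - q‖ < ε / 2 := mem_ball_iff_norm.1 hp
      have h3 : ‖z - q‖ ≤ ‖z - p‖ + ‖p - q‖ := norm_sub_le_norm_sub_add_norm_sub z p q
      rw [show z - q - (z - p) = p - q by ring]
      linarith
    · rw [exp_log (div_ne_zero (hne hq hz) (hne hpS hz)), div_mul_cancel₀ _ (hne hpS hz)]
  · rintro p q r hp hq hr ⟨L, hL, h⟩ ⟨M, hM, h'⟩
    refine ⟨fun z => L z + M z, hL.add hM, fun z hz => ?_⟩
    rw [exp_add, mul_assoc, h' z hz, h z hz]
  · rintro p q hp hq ⟨L, hL, h⟩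
    refine ⟨fun z => -L z, hL.neg, fun z hz => ?_⟩
    rw [← h z hz, ← mul_assoc, ← exp_add]; simp

lemma one_sub_mem_slitPlane {c : ℝ} (hc : 0 ≤ c) {θ : ℝ} (h : Real.sin θ ≠ 0 ∨ Real.cos θ ≤ 0) :
    1 - c * exp (θ * I) ∈ slitPlane := by
  rw [mem_slitPlane_iff]
  rw [exp_mul_I, ← ofReal_cos, ← ofReal_sin]
  simp only [sub_re, sub_im, one_re, one_im, mul_re, mul_im, add_re, add_im, ofReal_re, ofReal_im,
    I_re, I_im]
  rcases hc.eq_or_lt with rfl | hc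
  · left; simp
  rcases h with h | h
  · right
    simp [h, hc.ne']
  · left
    nlinarith

lemma tendsto_arg_one_sub {r θ : ℝ} (hr : 0 < r) (h : θ ∈ Ioo (-Real.pi) Real.pi) :
    Filter.Tendsto (fun t : ℝ => arg (1 - (r / t : ℝ) * exp ((θ + Real.pi : ℝ) * I)))
      (𝓝[>] 0) (𝓝 θ) := by
  have hexp : exp ((θ + Real.pi : ℝ) * I) = -exp (θ * I) := by
    push_cast; rw [add_mul, exp_add, exp_pi_mul_I]; ring
  have harg : arg (exp (θ * I)) = θ := by
    rw [exp_mul_I, arg_cos_add_sin_mul_I ⟨h.1, h.2.le⟩]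
  have hslit : exp (θ * I) ∈ slitPlane := by
    rw [mem_slitPlane_iff_arg, harg]; exact ⟨h.2.ne, exp_ne_zero _⟩
  have hlim : Filter.Tendsto (fun t : ℝ => arg ((t / r : ℝ) + exp (θ * I))) (𝓝[>] 0) (𝓝 θ) := by
    have hc : ContinuousAt (fun t : ℝ => arg ((t / r : ℝ) + exp (θ * I))) 0 := by
      refine ContinuousAt.comp (f := fun t : ℝ => ((t / r : ℝ) + exp (θ * I) : ℂ)) (g := arg) ?_ ?_
      · exact continuousAt_arg (by simpa using hslit)
      · fun_prop
    have h0 := hc.tendsto.mono_left (nhdsWithin_le_nhds (s := Ioi 0))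
    simpa [harg] using h0
  refine hlim.congr' ?_
  filter_upwards [self_mem_nhdsWithin] with t ht
  have ht : 0 < t := ht
  have hpos : 0 < r / t := by positivity
  rw [← arg_real_mul _ hpos, hexp]
  congr 1
  have : (t : ℂ) ≠ 0 := by exact_mod_cast ht.ne'
  have : (r : ℂ) ≠ 0 := by exact_mod_cast hr.ne'
  push_cast
  field_simp
  ring

/-- Two disjoint connected planar sets cannot alternate along four rays in cyclic order. -/
lemma crossing {P M : Set ℂ} (hPo : IsOpen P) (hP : IsPreconnected P) (hM : IsPreconnected M)
    (hd : Disjoint P M) (h0P : (0 : ℂ) ∉ P) (h0M : (0 : ℂ) ∉ M) {φ r : ℝ} (hφ : 0 < φ)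
    (hφ2 : φ ≤ Real.pi / 2) (hr : 0 < r)
    (h1 : ∀ t : ℝ, 0 < t → t ≤ r → (t : ℂ) ∈ P)
    (h2 : ∀ t : ℝ, 0 < t → t ≤ r → (t : ℂ) * exp (φ * I) ∈ M)
    (h3 : ∀ t : ℝ, 0 < t → t ≤ r → (t : ℂ) * exp (2 * φ * I) ∈ P)
    (h4 : ∀ t : ℝ, 0 < t → t ≤ r → (t : ℂ) * exp (-φ * I) ∈ M) : False := by
  have hπ := Real.pi_pos
  have hrP := h1 r hr le_rfl
  have hrP2 := h3 r hr le_rfl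
  obtain ⟨A, hAP, hAc, hAconn, hrA, hrA2⟩ : ∃ A ⊆ P, IsCompact A ∧ IsPreconnected A ∧
      (r : ℂ) ∈ A ∧ r * exp (2 * φ * I) ∈ A := by
    have hj := (((hPo.isConnected_iff_isPathConnected).1 ⟨⟨_, hrP⟩, hP⟩).joinedIn _ hrP _ hrP2)
    refine ⟨range hj.somePath, range_subset_iff.2 hj.somePath_mem,
      isCompact_range hj.somePath.continuous, isPreconnected_range hj.somePath.continuous,
      ⟨0, by simp⟩, ⟨1, by simp⟩⟩
  set B : Set ℂ := (fun s : ℝ => (s : ℂ)) '' Icc 0 r ∪ (fun s : ℝ => s * exp (2 * φ * I)) '' Icc 0 r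
    with hB
  have hBc : IsCompact B := (isCompact_Icc.image (by fun_prop)).union
    (isCompact_Icc.image (by fun_prop))
  have hBconn : IsPreconnected B := by
    refine IsPreconnected.union 0 ⟨0, by simp [hr.le]⟩ ⟨0, by simp [hr.le]⟩
      (isPreconnected_Icc.image _ (by fun_prop)) (isPreconnected_Icc.image _ (by fun_prop))
  have hBM : Disjoint M B := by
    refine disjoint_right.2 ?_
    rintro z (⟨s, hs, rfl⟩ | ⟨s, hs, rfl⟩) hz
    · rcases hs.1.eq_or_lt with rfl | hs0
      · exact h0M (by simpa using hz)
      · exact disjoint_left.1 hd (h1 s hs0 hs.2) hz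
    · rcases hs.1.eq_or_lt with rfl | hs0
      · exact h0M (by simpa using hz)
      · exact disjoint_left.1 hd (h3 s hs0 hs.2) hz
  have hAM : Disjoint M A := (hd.mono_left hAP).symm
  obtain ⟨ε, hε, hball⟩ := Metric.mem_nhds_iff.1
    (hAc.isClosed.isOpen_compl.mem_nhds fun h : (0 : ℂ) ∈ A => h0P (hAP h))
  have hAε : ∀ z ∈ A, ε ≤ ‖z‖ := fun z hz => by
    by_contra! h
    exact hball (by simpa using h) hz
  have hrB : (r : ℂ) ∈ B := Or.inl ⟨r, ⟨hr.le, le_rfl⟩, rfl⟩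
  have hrB2 : (r : ℂ) * exp (2 * φ * I) ∈ B := Or.inr ⟨r, ⟨hr.le, le_rfl⟩, rfl⟩
  have hexp1 : ‖exp (φ * I)‖ = 1 := by simp
  have hexp2 : ‖exp (-φ * I)‖ = 1 := by
    have := norm_exp_ofReal_mul_I (-φ); push_cast at this; exact this
  set g : ℝ → ℂ → ℂ := fun t z => (z - t * exp (φ * I)) / (z - t * exp (-φ * I)) with hg
  set a : ℝ → ℝ → ℝ := fun θ t => arg (1 - (r / t : ℝ) * exp (θ * I)) with ha
  have key : ∀ t : ℝ, 0 < t → t ≤ r → t < ε / 3 →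
      (a (-φ) t - a φ t) - (a φ t - a (3 * φ) t) =
        arg (g t r) - arg (g t (r * exp (2 * φ * I))) := by
    intro t ht htr htε
    have htC : (t : ℂ) ≠ 0 := by exact_mod_cast ht.ne'
    set p : ℂ := t * exp (φ * I) with hp
    set q : ℂ := t * exp (-φ * I) with hq
    have hpM : p ∈ M := h2 t ht htr
    have hqM : q ∈ M := h4 t ht htr
    have hpn : ‖p‖ = t := by rw [hp, norm_mul, hexp1, norm_real, Real.norm_of_nonneg ht.le, mul_one]
    have hqn : ‖q‖ = t := by rw [hq, norm_mul, hexp2, norm_real, Real.norm_of_nonneg ht.le, mul_one]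
    have hp0 : p ≠ 0 := by rw [← norm_pos_iff, hpn]; exact ht
    have hq0 : q ≠ 0 := by rw [← norm_pos_iff, hqn]; exact ht
    obtain ⟨L, hL, hLe⟩ := exists_log_ratio (hAc.union hBc).isClosed hM
      (disjoint_union_right.2 ⟨hAM, hBM⟩) hpM hqM
    have hne : ∀ {z w}, w ∈ M → z ∈ A ∪ B → z - w ≠ 0 := fun {z w} hw hz h => by
      rw [sub_eq_zero] at h
      exact disjoint_left.1 (disjoint_union_right.2 ⟨hAM, hBM⟩) hw (h ▸ hz)
    have hLA : L r - log (g t r) = L (r * exp (2 * φ * I)) - log (g t (r * exp (2 * φ * I))) := by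
      refine eq_of_exp_const hAconn (g := fun z => L z - log (g t z)) (c := 1)
        ((hL.mono subset_union_left).sub (ContinuousOn.clog
          (((by fun_prop : ContinuousOn (fun z : ℂ => z - p) A)).div (by fun_prop)
          fun z hz => hne hqM (Or.inl hz)) fun z hz => ?_)) (fun z hz => ?_) hrA hrA2
      · refine div_mem_slitPlane (hne hqM (Or.inl hz)) ?_
        rw [show z - p - (z - q) = q - p by ring]
        have := norm_sub_le q p
        have := norm_sub_norm_le z q
        have := hAε z hz
        linarith
      · have hzq := hne hqM (Or.inl hz)
        have hzp := hne hpM (Or.inl hz)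
        rw [exp_sub, exp_log (div_ne_zero hzp hzq), ← hLe z (Or.inl hz), mul_div_assoc,
          div_self hzq, mul_one, div_self (exp_ne_zero _)]
    have e0 : exp (2 * φ * I) = exp (φ * I) * exp (φ * I) := by
      rw [← exp_add]; ring_nf
    have e00 : exp ((3 * φ : ℝ) * I) = exp (φ * I) * exp (φ * I) * exp (φ * I) := by
      rw [← exp_add, ← exp_add]; push_cast; ring_nf
    have e1 : ∀ s : ℝ, (s : ℂ) / p = (s / t : ℝ) * exp ((-φ : ℝ) * I) := fun s => by
      rw [hp, ofReal_neg, neg_mul, exp_neg]; push_cast; field_simp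
    have e2 : ∀ s : ℝ, (s : ℂ) / q = (s / t : ℝ) * exp (φ * I) := fun s => by
      rw [hq, neg_mul, exp_neg]; push_cast; field_simp
    have e3 : ∀ s : ℝ, (s : ℂ) * exp (2 * φ * I) / p = (s / t : ℝ) * exp (φ * I) := fun s => by
      rw [hp, e0]; push_cast; field_simp
    have e4 : ∀ s : ℝ, (s : ℂ) * exp (2 * φ * I) / q = (s / t : ℝ) * exp ((3 * φ : ℝ) * I) :=
      fun s => by rw [hq, e0, neg_mul, exp_neg, e00]; push_cast; field_simp
    have hLB : L r - (log (1 - r / p) - log (1 - r / q)) = L (r * exp (2 * φ * I)) -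
        (log (1 - r * exp (2 * φ * I) / p) - log (1 - r * exp (2 * φ * I) / q)) := by
      have hs : 0 < Real.sin φ := Real.sin_pos_of_pos_of_lt_pi hφ (by linarith)
      have slit : ∀ z ∈ B, 1 - z / p ∈ slitPlane ∧ 1 - z / q ∈ slitPlane := by
        rintro z (⟨s, hs', rfl⟩ | ⟨s, hs', rfl⟩)
        all_goals have hst : 0 ≤ s / t := div_nonneg hs'.1 ht.le
        · simp only [e1, e2]
          exact ⟨one_sub_mem_slitPlane hst (Or.inl (by simp [hs.ne'])),
            one_sub_mem_slitPlane hst (Or.inl hs.ne')⟩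
        · simp only [e3, e4]
          refine ⟨one_sub_mem_slitPlane hst (Or.inl hs.ne'), one_sub_mem_slitPlane hst ?_⟩
          by_cases h : Real.pi / 2 ≤ 3 * φ
          · right; exact Real.cos_nonpos_of_pi_div_two_le_of_le h (by linarith)
          · left; exact (Real.sin_pos_of_pos_of_lt_pi (by linarith) (by linarith)).ne'
      refine eq_of_exp_const hBconn (g := fun z => L z - (log (1 - z / p) - log (1 - z / q)))
        (c := p / q) ((hL.mono subset_union_right).sub (ContinuousOn.sub
          (ContinuousOn.clog (by fun_prop) fun z hz => (slit z hz).1)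
          (ContinuousOn.clog (by fun_prop) fun z hz => (slit z hz).2))) (fun z hz => ?_) hrB hrB2
      have hzq := hne hqM (Or.inr hz)
      have hzp := hne hpM (Or.inr hz)
      rw [exp_sub, exp_sub, exp_log (slitPlane_ne_zero (slit z hz).1),
        exp_log (slitPlane_ne_zero (slit z hz).2), show exp (L z) = (z - p) / (z - q) by
          rw [eq_div_iff hzq]; exact hLe z (Or.inr hz)]
      have hzp' : p - z ≠ 0 := by rw [← neg_sub]; exact neg_ne_zero.2 hzp
      have hzq' : q - z ≠ 0 := by rw [← neg_sub]; exact neg_ne_zero.2 hzq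
      field_simp
      ring
    have hfin : (log (1 - r / p) - log (1 - r / q)) - (log (1 - r * exp (2 * φ * I) / p) -
        log (1 - r * exp (2 * φ * I) / q)) = log (g t r) - log (g t (r * exp (2 * φ * I))) := by
      linear_combination hLA - hLB
    have := congrArg im hfin
    rw [e1, e2, e3, e4] at this
    simpa only [sub_im, log_im] using this
  have ta1 : Filter.Tendsto (a (-φ)) (𝓝[>] 0) (𝓝 (Real.pi - φ)) := by
    have := tendsto_arg_one_sub hr (θ := Real.pi - φ) ⟨by linarith, by linarith⟩
    have e : exp ((Real.pi - φ + Real.pi : ℝ) * I) = exp ((-φ : ℝ) * I) := by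
      rw [← exp_periodic ((-φ : ℝ) * I)]; push_cast; ring_nf
    simpa only [e] using this
  have ta2 : Filter.Tendsto (a φ) (𝓝[>] 0) (𝓝 (φ - Real.pi)) := by
    simpa only [sub_add_cancel] using
        tendsto_arg_one_sub hr (θ := φ - Real.pi) ⟨by linarith, by linarith⟩
  have ta3 : Filter.Tendsto (a (3 * φ)) (𝓝[>] 0) (𝓝 (3 * φ - Real.pi)) := by
    simpa only [sub_add_cancel] using
        tendsto_arg_one_sub hr (θ := 3 * φ - Real.pi) ⟨by linarith, by linarith⟩
  have tg : ∀ z : ℂ, z ≠ 0 → Filter.Tendsto (fun t => arg (g t z)) (𝓝[>] 0) (𝓝 0) := by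
    intro z hz
    have hc : ContinuousAt (fun t : ℝ => arg (g t z)) 0 := by
      refine ContinuousAt.comp (f := fun t : ℝ => g t z) (g := arg) ?_ ?_
      · refine continuousAt_arg ?_
        simp [hg, hz]
      · refine ContinuousAt.div (by fun_prop) (by fun_prop) (by simpa using hz)
    have h0 := hc.tendsto.mono_left (nhdsWithin_le_nhds (s := Ioi 0))
    simpa [hg, hz] using h0
  have hrC : (r : ℂ) ≠ 0 := by exact_mod_cast hr.ne'
  have hlim := (((ta1.sub ta2).sub (ta2.sub ta3)).sub
    ((tg r hrC).sub (tg (r * exp (2 * φ * I)) (mul_ne_zero hrC (exp_ne_zero _)))))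
  have hz : Filter.Tendsto (fun _ : ℝ => (0 : ℝ)) (𝓝[>] 0) (𝓝 0) := tendsto_const_nhds
  have := tendsto_nhds_unique (hlim.congr' ?_) hz
  · linarith
  · filter_upwards [self_mem_nhdsWithin, nhdsWithin_le_nhds (Iio_mem_nhds hr),
      nhdsWithin_le_nhds (Iio_mem_nhds (show 0 < ε / 3 by positivity))] with t ht htr htε
    have := key t ht (le_of_lt htr) htε
    linarith

end crossing

section linear

variable {N : Set 𝔼} {g h : 𝔼 → ℝ} {x : 𝔼}

lemma pd_lin (hN : IsOpen N) (hg : ContDiffOn ℝ ∞ g N) (hh : ContDiffOn ℝ ∞ h N) (hx : x ∈ N)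
    (a b : ℝ) (i : Fin 2) : pd i (fun y => a * g y + b * h y) x = a * pd i g x + b * pd i h x := by
  have dg := smooth_diffAt hN hg hx
  have dh := smooth_diffAt hN hh hx
  rw [pd_add (dg.const_mul a) (dh.const_mul b), pd_const_mul dg, pd_const_mul dh]

lemma pd_pd_lin (hN : IsOpen N) (hg : ContDiffOn ℝ ∞ g N) (hh : ContDiffOn ℝ ∞ h N) (hx : x ∈ N)
    (a b : ℝ) (i j : Fin 2) :
    pd i (pd j fun y => a * g y + b * h y) x = a * pd i (pd j g) x + b * pd i (pd j h) x := by
  rw [pd_congr hN (fun y hy => pd_lin hN hg hh hy a b j) hx,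
    pd_lin hN (smooth_pd hN hg j) (smooth_pd hN hh j) hx]

lemma ellForm_lin (hN : IsOpen N) (hg : ContDiffOn ℝ ∞ g N) (hh : ContDiffOn ℝ ∞ h N) (hx : x ∈ N)
    (a b : ℝ) (w : 𝔼) :
    ellForm (fun y => a * g y + b * h y) w x = a * ellForm g w x + b * ellForm h w x := by
  simp only [ellForm, hessForm, pd_pd_lin hN hg hh hx]; ring

end linear

/-- `1 + |∇u|²`. -/
def areaSq (u : 𝔼 → ℝ) (x : 𝔼) : ℝ := 1 + pd 0 u x ^ 2 + pd 1 u x ^ 2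

lemma areaSq_pos (u : 𝔼 → ℝ) (x : 𝔼) : 0 < areaSq u x := by unfold areaSq; positivity

/-- First-order coefficients of the linearized equation. -/
def driftZero (f : ℝ → ℝ) (u : 𝔼 → ℝ) (x : 𝔼) : ℝ :=
  3 * √(areaSq u x) * f (u x) * pd 0 u x + 2 * pd 1 u x * pd 0 (pd 1 u) x -
    2 * pd 0 u x * pd 1 (pd 1 u) x

/-- First-order coefficients of the linearized equation. -/
def driftOne (f : ℝ → ℝ) (u : 𝔼 → ℝ) (x : 𝔼) : ℝ :=
  3 * √(areaSq u x) * f (u x) * pd 1 u x - 2 * pd 1 u x * pd 0 (pd 0 u) x +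
    2 * pd 0 u x * pd 0 (pd 1 u) x

/-- Zeroth-order coefficient of the linearized equation. -/
def potential (f : ℝ → ℝ) (u : 𝔼 → ℝ) (x : 𝔼) : ℝ :=
  areaSq u x * √(areaSq u x) * deriv f (u x)

namespace MCSetting

variable {Ω V : Set 𝔼} {f : ℝ → ℝ} {u : 𝔼 → ℝ} {γ : ℝ → 𝔼} {T : ℝ}

lemma potential_nonneg (S : MCSetting Ω V f u γ T) (x : 𝔼) : 0 ≤ potential f u x := by
  have := areaSq_pos u x
  have := S.fmono.deriv_nonneg (x := u x)
  unfold potential; positivity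

lemma smooth_areaSq (S : MCSetting Ω V f u γ T) : ContDiffOn ℝ ∞ (areaSq u) Ω :=
  (contDiffOn_const.add ((smooth_pd S.isOpen S.smooth 0).pow 2)).add
    ((smooth_pd S.isOpen S.smooth 1).pow 2)

lemma smooth_sqrt_areaSq (S : MCSetting Ω V f u γ T) : ContDiffOn ℝ ∞ (fun x => √(areaSq u x)) Ω :=
  S.smooth_areaSq.sqrt fun x _ => (areaSq_pos u x).ne'

lemma smooth_potential (S : MCSetting Ω V f u γ T) : ContDiffOn ℝ ∞ (potential f u) Ω :=
  (S.smooth_areaSq.mul S.smooth_sqrt_areaSq).mul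
    (((contDiff_infty_iff_deriv.1 S.fsmooth).2).comp_contDiffOn S.smooth)

lemma smooth_driftZero (S : MCSetting Ω V f u γ T) : ContDiffOn ℝ ∞ (driftZero f u) Ω := by
  have h1 := smooth_pd S.isOpen S.smooth
  have h2 := fun i j => smooth_pd S.isOpen (h1 j) i
  exact ((((contDiffOn_const.mul S.smooth_sqrt_areaSq).mul (S.fsmooth.comp_contDiffOn S.smooth)).mul
    (h1 0)).add ((contDiffOn_const.mul (h1 1)).mul (h2 0 1))).sub
    ((contDiffOn_const.mul (h1 0)).mul (h2 1 1))

lemma smooth_driftOne (S : MCSetting Ω V f u γ T) : ContDiffOn ℝ ∞ (driftOne f u) Ω := by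
  have h1 := smooth_pd S.isOpen S.smooth
  have h2 := fun i j => smooth_pd S.isOpen (h1 j) i
  exact ((((contDiffOn_const.mul S.smooth_sqrt_areaSq).mul (S.fsmooth.comp_contDiffOn S.smooth)).mul
    (h1 1)).sub ((contDiffOn_const.mul (h1 1)).mul (h2 0 0))).add
    ((contDiffOn_const.mul (h1 0)).mul (h2 0 1))

lemma continuousOn_sqrt_areaSq (S : MCSetting Ω V f u γ T) :
    ContinuousOn (fun x => √(areaSq u x)) (closure Ω) :=
  ((continuousOn_const.add ((S.continuousOn_pd 0).pow 2)).add ((S.continuousOn_pd 1).pow 2)).sqrt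

lemma bdd_driftZero (S : MCSetting Ω V f u γ T) : BddFun (closure Ω) (driftZero f u) := by
  have h1 := S.continuousOn_pd
  have h2 := S.continuousOn_pd_pd
  exact S.bddFun_of_continuousOn (((((continuousOn_const.mul S.continuousOn_sqrt_areaSq).mul
    (S.fsmooth.continuous.comp_continuousOn S.continuousOn_u)).mul
    (h1 0)).add ((continuousOn_const.mul (h1 1)).mul (h2 0 1))).sub
    ((continuousOn_const.mul (h1 0)).mul (h2 1 1)))

lemma bdd_driftOne (S : MCSetting Ω V f u γ T) : BddFun (closure Ω) (driftOne f u) := by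
  have h1 := S.continuousOn_pd
  have h2 := S.continuousOn_pd_pd
  exact S.bddFun_of_continuousOn (((((continuousOn_const.mul S.continuousOn_sqrt_areaSq).mul
    (S.fsmooth.continuous.comp_continuousOn S.continuousOn_u)).mul
    (h1 1)).sub ((continuousOn_const.mul (h1 1)).mul (h2 0 0))).add
    ((continuousOn_const.mul (h1 0)).mul (h2 0 1)))

/-- The linearized equation for a partial derivative. -/
lemma linearized_pd (S : MCSetting Ω V f u γ T) {x : 𝔼} (hx : x ∈ Ω) (k : Fin 2) :
    ellForm (pd k u) (perpGrad u x) x = potential f u x * pd k u x +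
      driftZero f u x * pd 0 (pd k u) x + driftOne f u x * pd 1 (pd k u) x := by
  have hO := S.isOpen
  have hu := S.smooth
  have h1 := smooth_pd hO hu
  have h2 := fun i j => smooth_pd hO (h1 j) i
  have d1 := fun i => smooth_diffAt hO (h1 i) hx
  have d2 := fun i j => smooth_diffAt hO (h2 i j) hx
  have hc : ∀ i j, pd k (pd i (pd j u)) x = pd i (pd j (pd k u)) x := fun i j => by
    rw [smooth_pd_comm hO (h1 j) hx k i, pd_third_comm hO hu hx]
  have hk : ∀ i, pd k (pd i u) x = pd i (pd k u) x := fun i => smooth_pd_comm hO hu hx k i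
  have e10 := smooth_pd_comm hO hu hx 1 0
  have heq := pd_congr hO (fun y hy => S.eqn y (subset_closure hy)) hx k
  have dT : pd k (fun y => tangHess u y) x =
      pd 1 u x ^ 2 * pd 0 (pd 0 (pd k u)) x - 2 * (pd 0 u x * pd 1 u x) * pd 0 (pd 1 (pd k u)) x +
        pd 0 u x ^ 2 * pd 1 (pd 1 (pd k u)) x + (2 * pd 1 u x * pd 1 (pd k u) x * pd 0 (pd 0 u) x -
        2 * (pd 0 (pd k u) x * pd 1 u x + pd 0 u x * pd 1 (pd k u) x) * pd 0 (pd 1 u) x +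
        2 * pd 0 u x * pd 0 (pd k u) x * pd 1 (pd 1 u) x) := by
    have e : (fun y => tangHess u y) = fun y => (pd 1 u y * pd 1 u y) * pd 0 (pd 0 u) y -
        2 * ((pd 0 u y * pd 1 u y) * pd 0 (pd 1 u) y) + (pd 0 u y * pd 0 u y) * pd 1 (pd 1 u) y := by
      funext y; simp only [tangHess]; ring
    have m := fun i j => (d1 i).fun_mul (d1 j)
    have m00 := (m 1 1).fun_mul (d2 0 0)
    have m01 := (m 0 1).fun_mul (d2 0 1)
    have m11 := (m 0 0).fun_mul (d2 1 1)
    rw [e, pd_add (m00.fun_sub (m01.const_mul 2)) m11, pd_sub m00 (m01.const_mul 2), pd_const_mul m01,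
      pd_mul (m 1 1) (d2 0 0), pd_mul (m 0 1) (d2 0 1), pd_mul (m 0 0) (d2 1 1),
      pd_mul (d1 1) (d1 1), pd_mul (d1 0) (d1 1), pd_mul (d1 0) (d1 0), hc, hc, hc, hk, hk]
    ring
  have dA : pd k (areaSq u) x = 2 * (pd 0 u x * pd 0 (pd k u) x + pd 1 u x * pd 1 (pd k u) x) := by
    have e : areaSq u = fun y => 1 + (pd 0 u y * pd 0 u y + pd 1 u y * pd 1 u y) := by
      funext y; simp only [areaSq]; ring
    have m := fun i => (d1 i).fun_mul (d1 i)
    rw [e, pd_add (differentiableAt_const _) ((m 0).fun_add (m 1)), pd_add (m 0) (m 1),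
      pd_mul (d1 0) (d1 0), pd_mul (d1 1) (d1 1), hk, hk]
    simp [pd, dirDeriv]; ring
  have hA := areaSq_pos u x
  have hs := Real.sqrt_pos.2 hA
  have hss := Real.mul_self_sqrt hA.le
  have dR : pd k (fun y => mcRhs f u y) x = potential f u x * pd k u x +
      3 * √(areaSq u x) * f (u x) * (pd 0 u x * pd 0 (pd k u) x + pd 1 u x * pd 1 (pd k u) x) := by
    have dA' : DifferentiableAt ℝ (areaSq u) x := smooth_diffAt hO S.smooth_areaSq hx
    have dS' : DifferentiableAt ℝ (fun y => √(areaSq u y)) x :=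
      smooth_diffAt hO S.smooth_sqrt_areaSq hx
    have df : HasDerivAt f (deriv f (u x)) (u x) :=
      (S.fsmooth.differentiable (by simp)).differentiableAt.hasDerivAt
    have du := smooth_diffAt hO hu hx
    have dfu : DifferentiableAt ℝ (fun y => f (u y)) x := df.differentiableAt.comp x du
    have e : (fun y => mcRhs f u y) = fun y => (areaSq u y * √(areaSq u y)) * f (u y) := rfl
    rw [e, pd_mul (dA'.fun_mul dS') dfu, pd_mul dA' dS',
      pd_comp (Real.hasDerivAt_sqrt hA.ne') dA', pd_comp df du, dA, potential]
    field_simp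
    have : √(areaSq u x) ^ 2 = areaSq u x := Real.sq_sqrt hA.le
    rw [this]
    ring
  have dL : pd k (fun y => pd 0 (pd 0 u) y + pd 1 (pd 1 u) y + tangHess u y) x =
      pd 0 (pd 0 (pd k u)) x + pd 1 (pd 1 (pd k u)) x + pd k (fun y => tangHess u y) x := by
    rw [pd_add ((d2 0 0).fun_add (d2 1 1)), pd_add (d2 0 0) (d2 1 1), hc, hc]
    have : ContDiffOn ℝ ∞ (tangHess u) Ω := by
      rw [LevelSetting.tangHess_eq]
      exact (((contDiffOn_const.mul ((h1 1).mul (h1 1))).mul (h2 0 0)).add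
        ((contDiffOn_const.mul ((h1 0).mul (h1 1))).mul (h2 0 1))).add
        ((contDiffOn_const.mul ((h1 0).mul (h1 0))).mul (h2 1 1))
    exact smooth_diffAt hO this hx
  rw [dL, dT, dR] at heq
  simp only [ellForm, hessForm, perpGrad_zero, perpGrad_one, driftZero, driftOne]
  linear_combination heq

/-- The linearized equation for a directional derivative. -/
lemma linearized (S : MCSetting Ω V f u γ T) {x : 𝔼} (hx : x ∈ Ω) (e : 𝔼) :
    ellForm (dirDeriv e u) (perpGrad u x) x = potential f u x * dirDeriv e u x +
      driftZero f u x * pd 0 (dirDeriv e u) x + driftOne f u x * pd 1 (dirDeriv e u) x := by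
  have h1 := smooth_pd S.isOpen S.smooth
  rw [dirDeriv_eq, ellForm_lin S.isOpen (h1 0) (h1 1) hx, S.linearized_pd hx, S.linearized_pd hx,
    pd_lin S.isOpen (h1 0) (h1 1) hx, pd_lin S.isOpen (h1 0) (h1 1) hx]
  ring

/-- The directional derivative is a subsolution of a linear equation where it is nonnegative. -/
lemma linearized_le (S : MCSetting Ω V f u γ T) (e : 𝔼) : ∃ β ≥ 0, ∀ x ∈ Ω, 0 ≤ dirDeriv e u x →
    -(β * ‖fderiv ℝ (dirDeriv e u) x‖) ≤ ellForm (dirDeriv e u) (perpGrad u x) x := by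
  obtain ⟨C, hC, h1⟩ := S.bdd_driftZero
  obtain ⟨D, hD, h2⟩ := S.bdd_driftOne
  refine ⟨C + D, by positivity, fun x hx h0 => ?_⟩
  rw [S.linearized hx]
  have h3 := mul_nonneg (S.potential_nonneg x) h0
  have hp : ∀ i, |pd i (dirDeriv e u) x| ≤ ‖fderiv ℝ (dirDeriv e u) x‖ := fun i => by
    simpa [pd, dirDeriv] using (fderiv ℝ (dirDeriv e u) x).le_opNorm (EuclideanSpace.single i 1)
  have h4 : |driftZero f u x * pd 0 (dirDeriv e u) x| ≤ C * ‖fderiv ℝ (dirDeriv e u) x‖ := by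
    rw [abs_mul]; exact mul_le_mul (h1 x (subset_closure hx)) (hp 0) (abs_nonneg _) hC
  have h5 : |driftOne f u x * pd 1 (dirDeriv e u) x| ≤ D * ‖fderiv ℝ (dirDeriv e u) x‖ := by
    rw [abs_mul]; exact mul_le_mul (h2 x (subset_closure hx)) (hp 1) (abs_nonneg _) hD
  linarith [neg_abs_le (driftZero f u x * pd 0 (dirDeriv e u) x),
    neg_abs_le (driftOne f u x * pd 1 (dirDeriv e u) x)]

end MCSetting

/-- The part of `Ω` where `u` increases in the direction `e`. -/
def posSet (Ω : Set 𝔼) (u : 𝔼 → ℝ) (e : 𝔼) : Set 𝔼 := {x | x ∈ Ω ∧ 0 < dirDeriv e u x}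

/-- `u` increases in the direction `e` along the part in `Ω` of the ray from `y` in the
direction `-e`. -/
def RayPos (Ω : Set 𝔼) (u : 𝔼 → ℝ) (e y : 𝔼) : Prop :=
  ∀ s : ℝ, 0 ≤ s → y - s • e ∈ Ω → 0 < dirDeriv e u (y - s • e)

namespace MCSetting

variable {Ω V : Set 𝔼} {f : ℝ → ℝ} {u : 𝔼 → ℝ} {γ : ℝ → 𝔼} {T : ℝ} {e : 𝔼}

lemma continuousAt_dirDeriv (S : MCSetting Ω V f u γ T) (e : 𝔼) {x : 𝔼} (hx : x ∈ closure Ω) :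
    ContinuousAt (dirDeriv e u) x :=
  ((S.contDiffAt hx).continuousAt_fderiv (by simp)).clm_apply continuousAt_const

lemma isOpen_posSet (S : MCSetting Ω V f u γ T) (e : 𝔼) : IsOpen (posSet Ω u e) := by
  refine isOpen_iff_mem_nhds.2 fun x hx => ?_
  filter_upwards [S.isOpen.mem_nhds hx.1,
    (S.continuousAt_dirDeriv e (subset_closure hx.1)).eventually (lt_mem_nhds hx.2)] with y h1 h2
  exact ⟨h1, h2⟩

lemma ray_mem (S : MCSetting Ω V f u γ T) {x : 𝔼} (hx : x ∈ Ω) {s t : ℝ} (hs : x - s • e ∈ Ω)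
    (ht : 0 ≤ t) (hts : t ≤ s) : x - t • e ∈ Ω := by
  rcases ht.eq_or_lt with rfl | h
  · simpa using hx
  have hs0 : 0 < s := h.trans_le hts
  have := S.convex.add_smul_sub_mem hx hs (t := t / s) ⟨by positivity, by
    rw [div_le_one hs0]; exact hts⟩
  convert this using 1
  rw [sub_sub_cancel_left, smul_neg, smul_smul, div_mul_cancel₀ _ hs0.ne', sub_eq_add_neg]

lemma eventually_rayPos (S : MCSetting Ω V f u γ T) (he : e ≠ 0) {z : 𝔼} (hz : z ∈ frontier Ω)
    (hv : 0 < dirDeriv e u z) : ∀ᶠ x in 𝓝 z, x ∈ Ω → RayPos Ω u e x := by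
  have hzc := S.frontier_sub hz
  obtain ⟨r, hr, hb⟩ := Metric.eventually_nhds_iff_ball.1
    ((S.continuousAt_dirDeriv e hzc).eventually (lt_mem_nhds (half_lt_self hv)))
  set c := dirDeriv e u z / 2 with hc
  have hc0 : 0 < c := half_pos hv
  have hn : 0 < ‖e‖ := norm_pos_iff.2 he
  set s₁ := r / 2 / ‖e‖ with hs₁
  have hs₁0 : 0 < s₁ := by positivity
  have hu : ∀ᶠ x in 𝓝 z, u x < c * s₁ :=
    (S.contDiffAt hzc).continuousAt.eventually (gt_mem_nhds (by rw [S.uzero z hz]; positivity))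
  filter_upwards [hu, Metric.ball_mem_nhds z (half_pos hr)] with x h1 h2 hx s hs hxs
  have hball : ∀ t : ℝ, 0 ≤ t → t ≤ s₁ → x - t • e ∈ ball z r := fun t h0 ht => by
    have h3 : ‖t • e‖ ≤ r / 2 := by
      rw [norm_smul, Real.norm_of_nonneg h0]
      calc t * ‖e‖ ≤ s₁ * ‖e‖ := by gcongr
        _ = r / 2 := by rw [hs₁]; field_simp
    rw [mem_ball_iff_norm] at h2 ⊢
    calc ‖x - t • e - z‖ = ‖(x - z) - t • e‖ := by congr 1; abel
      _ ≤ ‖x - z‖ + ‖t • e‖ := norm_sub_le _ _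
      _ < r := by linarith
  rcases lt_or_ge s s₁ with h | h
  · exact hc0.trans (hb _ (hball s hs h.le))
  · exfalso
    have hx₁ : x - s₁ • e ∈ Ω := S.ray_mem hx hxs hs₁0.le h
    have hd : ∀ t ∈ Icc (0 : ℝ) s₁, HasDerivAt (fun t : ℝ => u (x - t • e))
        (-dirDeriv e u (x - t • e)) t := fun t ht => by
      have h4 := S.ray_mem hx hx₁ ht.1 ht.2
      have h5 : HasFDerivAt u (fderiv ℝ u (x - t • e)) (x - t • e) :=
        (smooth_diffAt S.isOpen S.smooth h4).hasFDerivAt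
      have h6 : HasDerivAt (fun t : ℝ => x - t • e) (-((1 : ℝ) • e)) t :=
        ((hasDerivAt_id t).smul_const e).const_sub x
      refine (h5.comp_hasDerivAt t h6).congr_deriv ?_
      rw [one_smul, map_neg]; rfl
    have := (convex_Icc (0 : ℝ) s₁).image_sub_le_mul_sub_of_deriv_le (f := fun t => u (x - t • e))
      (C := -c) (fun t ht => (hd t ht).continuousAt.continuousWithinAt)
      (fun t ht => (hd t (interior_subset ht)).differentiableAt.differentiableWithinAt)
      (fun t ht => by
        have ht' := interior_subset ht
        rw [(hd t ht').deriv]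
        exact neg_le_neg (hb _ (hball t ht'.1 ht'.2)).le)
      0 (left_mem_Icc.2 hs₁0.le) s₁ (right_mem_Icc.2 hs₁0.le) hs₁0.le
    simp only [zero_smul, sub_zero] at this
    linarith [S.upos _ hx₁]

lemma exists_exit (S : MCSetting Ω V f u γ T) (he : e ≠ 0) {x : 𝔼} (hx : x ∈ Ω) :
    ∃ s > (0 : ℝ), x - s • e ∈ frontier Ω ∧ (∀ t, 0 ≤ t → t < s → x - t • e ∈ Ω) ∧
      0 < dirDeriv e u (x - s • e) := by
  set A : Set ℝ := {s | 0 ≤ s ∧ x - s • e ∉ Ω} with hA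
  have hcont : Continuous fun s : ℝ => x - s • e := by fun_prop
  have hAc : IsClosed A := isClosed_Ici.inter (S.isOpen.isClosed_compl.preimage hcont)
  have hne : A.Nonempty := by
    obtain ⟨R, hR⟩ := S.bdd.exists_norm_le
    have hn : 0 < ‖e‖ := norm_pos_iff.2 he
    have hR0 : 0 ≤ R := (norm_nonneg x).trans (hR x hx)
    refine ⟨(2 * R + 1) / ‖e‖, by positivity, fun h => ?_⟩
    have h1 := hR _ h
    have h2 : ‖((2 * R + 1) / ‖e‖) • e‖ = 2 * R + 1 := by
      rw [norm_smul, Real.norm_of_nonneg (by positivity)]; field_simp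
    have h3 := norm_sub_norm_le (((2 * R + 1) / ‖e‖) • e) x
    rw [norm_sub_rev] at h3
    linarith [hR x hx]
  have hbd : BddBelow A := ⟨0, fun s hs => hs.1⟩
  have hmem := hAc.csInf_mem hne hbd
  set s := sInf A
  have hlt : ∀ t, 0 ≤ t → t < s → x - t • e ∈ Ω := fun t h0 h1 => by
    by_contra h; exact (notMem_of_lt_csInf h1 hbd) ⟨h0, h⟩
  have hs : 0 < s := hmem.1.lt_of_ne fun h => hmem.2 (by rw [← h]; simpa using hx)
  have hcl : x - s • e ∈ closure Ω := by
    have h1 : s ∈ closure (Ico 0 s) := by rw [closure_Ico hs.ne]; exact right_mem_Icc.2 hs.le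
    exact map_mem_closure (f := fun s : ℝ => x - s • e) hcont h1 fun t ht => hlt t ht.1 ht.2
  have hfr := S.mem_frontier hcl hmem.2
  refine ⟨s, hs, hfr, hlt, ?_⟩
  have := S.fderiv_pos hfr hx
  rw [sub_sub_cancel, map_smul, smul_eq_mul] at this
  exact pos_of_mul_pos_right this hs.le

lemma exists_frontier_pos (S : MCSetting Ω V f u γ T) {O : Set 𝔼} (hO : IsOpen O)
    (hOs : O ⊆ posSet Ω u e) (hne : O.Nonempty) : ∃ z ∈ frontier O, 0 < dirDeriv e u z := by
  by_contra! hcon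
  obtain ⟨β, hβ, h⟩ := S.linearized_le e
  have hOΩ : O ⊆ Ω := fun x hx => (hOs hx).1
  obtain ⟨x, hx⟩ := hne
  refine (hOs hx).2.not_ge (weak_max (v := dirDeriv e u) (w := perpGrad u) hO
    (S.bdd.subset hOΩ) hβ (fun y hy => ?_) (fun y hy =>
    And.intro ?_ (h y (hOΩ hy) (hOs hy).2.le)) hcon x hx)
  · exact (S.continuousAt_dirDeriv e (closure_mono hOΩ hy)).continuousWithinAt
  · exact ((smooth_dirDeriv S.isOpen S.smooth e).contDiffAt (S.isOpen.mem_nhds (hOΩ hy))).of_le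
      (by norm_cast)

lemma ray_mem_of_rayPos (S : MCSetting Ω V f u γ T) {O₁ O₂ : Set 𝔼} (h₁ : IsOpen O₁)
    (h₂ : IsOpen O₂) (hd : Disjoint O₁ O₂) (hc : posSet Ω u e = O₁ ∪ O₂) {y : 𝔼} (hy : y ∈ O₁)
    (hr : RayPos Ω u e y) {s : ℝ} (hs : 0 ≤ s) (hys : y - s • e ∈ Ω) : y - s • e ∈ O₁ := by
  have hyΩ : y ∈ Ω := by
    have : y ∈ posSet Ω u e := hc ▸ Or.inl hy
    exact this.1
  have hp : IsPreconnected ((fun t : ℝ => y - t • e) '' Icc 0 s) :=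
    isPreconnected_Icc.image _ (by fun_prop)
  refine hp.subset_left_of_subset_union h₁ h₂ hd ?_
    (⟨y, ⟨0, left_mem_Icc.2 hs, by simp⟩, hy⟩ :
      (((fun t : ℝ => y - t • e) '' Icc 0 s) ∩ O₁).Nonempty)
    (mem_image_of_mem (fun t : ℝ => y - t • e) (right_mem_Icc.2 hs))
  rw [← hc]
  rintro _ ⟨t, ht, rfl⟩
  have := S.ray_mem hyΩ hys ht.1 ht.2
  exact ⟨this, hr t ht.1 this⟩

/-- Beyond any point there is a point on the ray with `RayPos` nearby. -/
lemma exists_rayPos (S : MCSetting Ω V f u γ T) (he : e ≠ 0) {x : 𝔼} (hx : x ∈ Ω) :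
    ∃ t : ℝ, 0 ≤ t ∧ x - t • e ∈ Ω ∧ ∀ᶠ y in 𝓝 (x - t • e), RayPos Ω u e y := by
  obtain ⟨s, hs, hz, hlt, hv⟩ := S.exists_exit he hx
  have h1 := (S.eventually_rayPos he hz hv).eventually_nhds
  have hcont : ContinuousAt (fun s : ℝ => x - s • e) s := by fun_prop
  have h2 := (hcont.eventually h1).filter_mono (nhdsWithin_le_nhds (s := Iio s))
  obtain ⟨t, ht, h3⟩ := (h2.and (Ioo_mem_nhdsLT hs)).exists
  have hm := hlt t h3.1.le h3.2
  refine ⟨t, h3.1.le, hm, ?_⟩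
  filter_upwards [ht, S.isOpen.mem_nhds hm] with y h4 h5 using h4 h5

lemma isOpen_tail (S : MCSetting Ω V f u γ T) (he : e ≠ 0) {O₁ O₂ : Set 𝔼} (h₁ : IsOpen O₁)
    (h₂ : IsOpen O₂) (hd : Disjoint O₁ O₂) (hc : posSet Ω u e = O₁ ∪ O₂) :
    IsOpen {x | x ∈ Ω ∧ ∃ t : ℝ, 0 ≤ t ∧ x - t • e ∈ O₁ ∧ RayPos Ω u e (x - t • e)} := by
  refine isOpen_iff_mem_nhds.2 fun x ⟨hx, t, ht, hm, hr⟩ => ?_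
  have hmΩ : x - t • e ∈ Ω := by
    have : x - t • e ∈ posSet Ω u e := hc ▸ Or.inl hm
    exact this.1
  obtain ⟨t', ht', hm', hr'⟩ := S.exists_rayPos he hmΩ
  have hO := S.ray_mem_of_rayPos h₁ h₂ hd hc hm hr ht' hm'
  have e1 : x - t • e - t' • e = x - (t + t') • e := by module
  rw [e1] at hO hr'
  have hcont : ContinuousAt (fun y : 𝔼 => y - (t + t') • e) x := by fun_prop
  filter_upwards [S.isOpen.mem_nhds hx, hcont.eventually hr', hcont.eventually (h₁.mem_nhds hO)]
    with y g1 g2 g3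
  exact ⟨g1, t + t', by positivity, g3, g2⟩

lemma tail_nonempty (S : MCSetting Ω V f u γ T) (he : e ≠ 0) {O₁ O₂ : Set 𝔼} (h₁ : IsOpen O₁)
    (h₂ : IsOpen O₂) (hd : Disjoint O₁ O₂) (hc : posSet Ω u e = O₁ ∪ O₂) (hne : O₁.Nonempty) :
    {x | x ∈ Ω ∧ ∃ t : ℝ, 0 ≤ t ∧ x - t • e ∈ O₁ ∧ RayPos Ω u e (x - t • e)}.Nonempty := by
  have hsub : O₁ ⊆ posSet Ω u e := hc ▸ subset_union_left
  have hOΩ : O₁ ⊆ Ω := fun x hx => (hsub hx).1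
  obtain ⟨z, hz, hv⟩ := S.exists_frontier_pos h₁ hsub hne
  have hzn : z ∉ Ω := fun hzΩ => by
    have : z ∈ O₁ ∪ O₂ := hc ▸ (show z ∈ posSet Ω u e from ⟨hzΩ, hv⟩)
    rcases this with h | h
    · exact hz.2 (by rwa [h₁.interior_eq])
    · obtain ⟨y, hy2, hy1⟩ := mem_closure_iff.1 hz.1 O₂ h₂ h
      exact disjoint_left.1 hd hy1 hy2
  have hzf := S.mem_frontier (closure_mono hOΩ hz.1) hzn
  obtain ⟨y, hy, hyO⟩ := mem_closure_iff_nhds.1 hz.1 _ (S.eventually_rayPos he hzf hv)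
  exact ⟨y, hOΩ hyO, 0, le_rfl, by simpa using hyO, by simpa using hy (hOΩ hyO)⟩

/-- The region where `u` increases in a given direction is connected. -/
lemma isPreconnected_posSet (S : MCSetting Ω V f u γ T) (he : e ≠ 0) :
    IsPreconnected (posSet Ω u e) := by
  intro U₁ U₂ hU₁ hU₂ hsub hn₁ hn₂
  by_contra hcon
  have h₁ := (S.isOpen_posSet e).inter hU₁
  have h₂ := (S.isOpen_posSet e).inter hU₂
  have hd : Disjoint (posSet Ω u e ∩ U₁) (posSet Ω u e ∩ U₂) :=
    disjoint_left.2 fun x a b => hcon ⟨x, a.1, a.2, b.2⟩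
  have hc : posSet Ω u e = posSet Ω u e ∩ U₁ ∪ posSet Ω u e ∩ U₂ := by
    rw [← inter_union_distrib_left, inter_eq_left.2 hsub]
  have hc' := hc.trans (union_comm _ _)
  obtain ⟨x, -, ⟨-, t₁, ht₁, a₁, b₁⟩, -, t₂, ht₂, a₂, b₂⟩ := S.convex.isPreconnected _ _
    (S.isOpen_tail he h₁ h₂ hd hc) (S.isOpen_tail he h₂ h₁ hd.symm hc') (fun x hx => by
      obtain ⟨t, ht, hm, hr⟩ := S.exists_rayPos he hx
      have hr' := hr.self_of_nhds
      have hp := hr' 0 le_rfl (by simpa using hm)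
      rw [zero_smul, sub_zero] at hp
      have : x - t • e ∈ posSet Ω u e := ⟨hm, hp⟩
      rcases hsub this with h | h
      · exact Or.inl ⟨hx, t, ht, ⟨this, h⟩, hr'⟩
      · exact Or.inr ⟨hx, t, ht, ⟨this, h⟩, hr'⟩)
    (by
      obtain ⟨x, hx⟩ := S.tail_nonempty he h₁ h₂ hd hc hn₁
      exact ⟨x, hx.1, hx⟩)
    (by
      obtain ⟨x, hx⟩ := S.tail_nonempty he h₂ h₁ hd.symm hc' hn₂
      exact ⟨x, hx.1, hx⟩)
  rcases le_total t₁ t₂ with h | h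
  · have e1 : x - t₁ • e - (t₂ - t₁) • e = x - t₂ • e := by module
    have := S.ray_mem_of_rayPos h₁ h₂ hd hc a₁ b₁ (sub_nonneg.2 h) (e1 ▸ a₂.1.1)
    exact disjoint_left.1 hd (e1 ▸ this) a₂
  · have e1 : x - t₂ • e - (t₁ - t₂) • e = x - t₁ • e := by module
    have := S.ray_mem_of_rayPos h₂ h₁ hd.symm hc' a₂ b₂ (sub_nonneg.2 h) (e1 ▸ a₁.1.1)
    exact disjoint_left.1 hd a₁ (e1 ▸ this)

end MCSetting

/-- All derivatives of `g` at `p` of order less than `k` vanish. -/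
def Vanish (p : 𝔼) : ℕ → (𝔼 → ℝ) → Prop
  | 0, _ => True
  | k + 1, g => g p = 0 ∧ ∀ d, Vanish p k (dirDeriv d g)

section vanish

variable {N : Set 𝔼} {p : 𝔼} {g h c : 𝔼 → ℝ} {k : ℕ}

lemma dirDeriv_add_fun (hN : IsOpen N) (hg : ContDiffOn ℝ ∞ g N) (hh : ContDiffOn ℝ ∞ h N)
    (d : 𝔼) : ∀ x ∈ N, dirDeriv d (fun y => g y + h y) x = dirDeriv d g x + dirDeriv d h x := by
  intro x hx
  simp only [dirDeriv]
  rw [fderiv_fun_add (smooth_diffAt hN hg hx) (smooth_diffAt hN hh hx)]; rfl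

lemma dirDeriv_mul_fun (hN : IsOpen N) (hg : ContDiffOn ℝ ∞ g N) (hh : ContDiffOn ℝ ∞ h N)
    (d : 𝔼) : ∀ x ∈ N, dirDeriv d (fun y => g y * h y) x =
      dirDeriv d g x * h x + g x * dirDeriv d h x := by
  intro x hx
  simp only [dirDeriv]
  rw [fderiv_fun_mul (smooth_diffAt hN hg hx) (smooth_diffAt hN hh hx)]
  simp; ring

lemma dirDeriv_const_mul_fun (hN : IsOpen N) (hg : ContDiffOn ℝ ∞ g N) (a : ℝ)
    (d : 𝔼) : ∀ x ∈ N, dirDeriv d (fun y => a * g y) x = a * dirDeriv d g x := by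
  intro x hx
  simp only [dirDeriv]
  rw [fderiv_const_mul (smooth_diffAt hN hg hx)]; rfl

lemma dirDeriv_congr (hN : IsOpen N) (hgh : ∀ x ∈ N, g x = h x) (d : 𝔼) :
    ∀ x ∈ N, dirDeriv d g x = dirDeriv d h x := by
  intro x hx
  simp only [dirDeriv]
  rw [Filter.EventuallyEq.fderiv_eq (𝕜 := ℝ) (Filter.mem_of_superset (hN.mem_nhds hx) hgh)]

lemma dirDeriv_comb (g : 𝔼 → ℝ) (a b : ℝ) (d e : 𝔼) :
    dirDeriv (a • d + b • e) g = fun x => a * dirDeriv d g x + b * dirDeriv e g x := by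
  funext x; simp [dirDeriv]

namespace Vanish

lemma congr (hN : IsOpen N) (hp : p ∈ N) (hg : Vanish p k g) (hgh : ∀ x ∈ N, g x = h x) :
    Vanish p k h := by
  induction k generalizing g h with
  | zero => trivial
  | succ k ih =>
    exact ⟨(hgh p hp) ▸ hg.1, fun d => ih (hg.2 d) (dirDeriv_congr hN hgh d)⟩

lemma of_succ (hg : Vanish p (k + 1) g) : Vanish p k g := by
  induction k generalizing g with
  | zero => trivial
  | succ k ih => exact ⟨hg.1, fun d => ih (hg.2 d)⟩

lemma zero (p : 𝔼) (k : ℕ) : Vanish p k fun _ => 0 := by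
  induction k with
  | zero => trivial
  | succ k ih =>
    refine ⟨rfl, fun d => ?_⟩
    have : dirDeriv d (fun _ : 𝔼 => (0 : ℝ)) = fun _ => 0 := by funext x; simp [dirDeriv]
    rwa [this]

lemma add (hN : IsOpen N) (hp : p ∈ N) (hgs : ContDiffOn ℝ ∞ g N) (hhs : ContDiffOn ℝ ∞ h N)
    (hg : Vanish p k g) (hh : Vanish p k h) : Vanish p k fun x => g x + h x := by
  induction k generalizing g h with
  | zero => trivial
  | succ k ih =>
    refine ⟨by simp [hg.1, hh.1], fun d => ?_⟩
    exact (ih (smooth_dirDeriv hN hgs d) (smooth_dirDeriv hN hhs d) (hg.2 d) (hh.2 d)).congr hN hp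
      fun x hx => (dirDeriv_add_fun hN hgs hhs d x hx).symm

lemma mul (hN : IsOpen N) (hp : p ∈ N) (hcs : ContDiffOn ℝ ∞ c N) (hgs : ContDiffOn ℝ ∞ g N)
    (hg : Vanish p k g) : Vanish p k fun x => c x * g x := by
  induction k generalizing g c with
  | zero => trivial
  | succ k ih =>
    refine ⟨by simp [hg.1], fun d => ?_⟩
    have hc' := smooth_dirDeriv hN hcs d
    have hg' := smooth_dirDeriv hN hgs d
    exact ((ih hc' hgs hg.of_succ).add hN hp (hc'.mul hgs) (hcs.mul hg')
      (ih hcs hg' (hg.2 d))).congr hN hp fun x hx => (dirDeriv_mul_fun hN hcs hgs d x hx).symm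

lemma mul_succ (hN : IsOpen N) (hp : p ∈ N) (hcs : ContDiffOn ℝ ∞ c N)
    (hgs : ContDiffOn ℝ ∞ g N) (hc : c p = 0) (hg : Vanish p k g) :
    Vanish p (k + 1) fun x => c x * g x := by
  induction k generalizing g with
  | zero => exact ⟨by simp [hc], fun d => trivial⟩
  | succ k ih =>
    refine ⟨by simp [hc], fun d => ?_⟩
    have hc' := smooth_dirDeriv hN hcs d
    have hg' := smooth_dirDeriv hN hgs d
    exact ((hg.mul hN hp hc' hgs).add hN hp (hc'.mul hgs) (hcs.mul hg')
      (ih hg' (hg.2 d))).congr hN hp fun x hx => (dirDeriv_mul_fun hN hcs hgs d x hx).symm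

lemma const_mul (hN : IsOpen N) (hp : p ∈ N) (hgs : ContDiffOn ℝ ∞ g N) (a : ℝ)
    (hg : Vanish p k g) : Vanish p k fun x => a * g x :=
  hg.mul hN hp contDiffOn_const hgs

lemma iterate (hg : Vanish p (k + 1) g) (d : 𝔼) : (dirDeriv d)^[k] g p = 0 := by
  induction k generalizing g with
  | zero => exact hg.1
  | succ k ih => exact ih (hg.2 d)

end Vanish

lemma smooth_iterate (hN : IsOpen N) (hg : ContDiffOn ℝ ∞ g N) (d : 𝔼) (k : ℕ) :
    ContDiffOn ℝ ∞ ((dirDeriv d)^[k] g) N := by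
  induction k generalizing g with
  | zero => exact hg
  | succ k ih => exact ih (smooth_dirDeriv hN hg d)

lemma iterate_congr (hN : IsOpen N) (hgh : ∀ x ∈ N, g x = h x) (d : 𝔼) (k : ℕ) :
    ∀ x ∈ N, (dirDeriv d)^[k] g x = (dirDeriv d)^[k] h x := by
  induction k generalizing g h with
  | zero => exact hgh
  | succ k ih => exact ih (dirDeriv_congr hN hgh d)

lemma iterate_add (hN : IsOpen N) (hg : ContDiffOn ℝ ∞ g N) (hh : ContDiffOn ℝ ∞ h N) (d : 𝔼)
    (k : ℕ) : ∀ x ∈ N, (dirDeriv d)^[k] (fun y => g y + h y) x =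
      (dirDeriv d)^[k] g x + (dirDeriv d)^[k] h x := by
  induction k generalizing g h with
  | zero => exact fun _ _ => rfl
  | succ k ih =>
    intro x hx
    rw [Function.iterate_succ_apply, iterate_congr hN (dirDeriv_add_fun hN hg hh d) d k x hx,
      ih (smooth_dirDeriv hN hg d) (smooth_dirDeriv hN hh d) x hx]
    rfl

lemma dirDeriv_comm (hN : IsOpen N) (hg : ContDiffOn ℝ ∞ g N) (d e : 𝔼) :
    ∀ x ∈ N, dirDeriv d (dirDeriv e g) x = dirDeriv e (dirDeriv d g) x := by
  intro x hx
  have h1 := smooth_pd hN hg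
  rw [dirDeriv_eq e g, dirDeriv_eq d g, dirDeriv_eq d, dirDeriv_eq e]
  simp only [pd_lin hN (h1 0) (h1 1) hx, smooth_pd_comm hN hg hx 1 0]
  ring

lemma dirDeriv_dirDeriv (hN : IsOpen N) (hg : ContDiffOn ℝ ∞ g N) (d : 𝔼) :
    ∀ x ∈ N, dirDeriv d (dirDeriv d g) x = hessForm g d x := by
  intro x hx
  have h1 := smooth_pd hN hg
  rw [dirDeriv_eq d g, dirDeriv_eq d, hessForm]
  simp only [pd_lin hN (h1 0) (h1 1) hx, smooth_pd_comm hN hg hx 1 0]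
  ring

/-- Leading-order behaviour of an approximate solution `g + i h` of the Cauchy–Riemann
equations. -/
lemma iterate_of_cauchyRiemann (hN : IsOpen N) (hp : p ∈ N) (d₁ d₂ : 𝔼) (θ : ℝ)
    (hg : ContDiffOn ℝ ∞ g N) (hh : ContDiffOn ℝ ∞ h N)
    (h₁ : Vanish p k fun x => dirDeriv d₁ g x + -1 * dirDeriv d₂ h x)
    (h₂ : Vanish p k fun x => dirDeriv d₁ h x + dirDeriv d₂ g x) (φ : ℝ) :
    (dirDeriv (Real.cos θ • d₁ + Real.sin θ • d₂))^[k]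
        (fun x => Real.cos φ * g x + -Real.sin φ * h x) p =
      Real.cos (φ + k * θ) * (dirDeriv d₁)^[k] g p -
        Real.sin (φ + k * θ) * (dirDeriv d₁)^[k] h p := by
  induction k generalizing g h φ with
  | zero => simp; ring
  | succ k ih =>
    have hD := fun d => smooth_dirDeriv hN hg d
    have hE := fun d => smooth_dirDeriv hN hh d
    have hc : ∀ {q : 𝔼 → ℝ}, ContDiffOn ℝ ∞ q N → ∀ a : ℝ, ContDiffOn ℝ ∞ (fun x => a * q x) N :=
      fun hq a => contDiffOn_const.mul hq
    have s₁ := (hD d₁).add (hc (hE d₂) (-1))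
    have s₂ := (hE d₁).add (hD d₂)
    have key : ∀ x ∈ N, dirDeriv (Real.cos θ • d₁ + Real.sin θ • d₂)
        (fun x => Real.cos φ * g x + -Real.sin φ * h x) x =
        (Real.cos (φ + θ) * dirDeriv d₁ g x + -Real.sin (φ + θ) * dirDeriv d₁ h x) +
        (Real.cos φ * Real.sin θ * (dirDeriv d₁ h x + dirDeriv d₂ g x) +
          Real.sin φ * Real.sin θ * (dirDeriv d₁ g x + -1 * dirDeriv d₂ h x)) := by
      intro x hx
      rw [dirDeriv_add_fun hN (hc hg _) (hc hh _) _ x hx, dirDeriv_const_mul_fun hN hg _ _ x hx,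
        dirDeriv_const_mul_fun hN hh _ _ x hx, dirDeriv_comb, dirDeriv_comb, Real.cos_add,
        Real.sin_add]
      ring
    have herr := ((h₂.const_mul hN hp s₂ (Real.cos φ * Real.sin θ)).add hN hp (hc s₂ _) (hc s₁ _)
      (h₁.const_mul hN hp s₁ (Real.sin φ * Real.sin θ))).iterate
      (Real.cos θ • d₁ + Real.sin θ • d₂)
    rw [Function.iterate_succ_apply, iterate_congr hN key _ k p hp,
      iterate_add hN ((hc (hD d₁) _).add (hc (hE d₁) _)) ((hc s₂ _).add (hc s₁ _)) _ k p hp, herr,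
      add_zero, ih (hD d₁) (hE d₁) ?_ ?_ (φ + θ)]
    · rw [show φ + θ + k * θ = φ + ((k + 1 : ℕ) : ℝ) * θ by push_cast; ring]; rfl
    · refine (h₁.2 d₁).congr hN hp fun x hx => ?_
      rw [dirDeriv_add_fun hN (hD d₁) (hc (hE d₂) (-1)) _ x hx,
        dirDeriv_const_mul_fun hN (hE d₂) _ _ x hx, dirDeriv_comm hN hh d₁ d₂ x hx]
    · refine (h₂.2 d₁).congr hN hp fun x hx => ?_
      rw [dirDeriv_add_fun hN (hE d₁) (hD d₂) _ x hx, dirDeriv_comm hN hg d₁ d₂ x hx]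

lemma vanish_of_cauchyRiemann (hN : IsOpen N) (hp : p ∈ N) {d₁ d₂ : 𝔼}
    (hd : ∀ d : 𝔼, ∃ a b : ℝ, d = a • d₁ + b • d₂)
    (hg : ContDiffOn ℝ ∞ g N) (hh : ContDiffOn ℝ ∞ h N)
    (h₁ : Vanish p k fun x => dirDeriv d₁ g x + -1 * dirDeriv d₂ h x)
    (h₂ : Vanish p k fun x => dirDeriv d₁ h x + dirDeriv d₂ g x)
    (hg' : Vanish p k g) (hh' : Vanish p k h) (hgk : (dirDeriv d₁)^[k] g p = 0)
    (hhk : (dirDeriv d₁)^[k] h p = 0) : Vanish p (k + 1) g ∧ Vanish p (k + 1) h := by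
  induction k generalizing g h with
  | zero => exact ⟨⟨hgk, fun _ => trivial⟩, ⟨hhk, fun _ => trivial⟩⟩
  | succ k ih =>
    have hD := fun d => smooth_dirDeriv hN hg d
    have hE := fun d => smooth_dirDeriv hN hh d
    have hc : ∀ {q : 𝔼 → ℝ}, ContDiffOn ℝ ∞ q N → ∀ a : ℝ, ContDiffOn ℝ ∞ (fun x => a * q x) N :=
      fun hq a => contDiffOn_const.mul hq
    have s₁ := (hD d₁).add (hc (hE d₂) (-1))
    have s₂ := (hE d₁).add (hD d₂)
    obtain ⟨i₁, i₂⟩ := ih (hD d₁) (hE d₁)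
      ((h₁.2 d₁).congr hN hp fun x hx => by
        rw [dirDeriv_add_fun hN (hD d₁) (hc (hE d₂) (-1)) _ x hx,
          dirDeriv_const_mul_fun hN (hE d₂) _ _ x hx, dirDeriv_comm hN hh d₁ d₂ x hx])
      ((h₂.2 d₁).congr hN hp fun x hx => by
        rw [dirDeriv_add_fun hN (hE d₁) (hD d₂) _ x hx, dirDeriv_comm hN hg d₁ d₂ x hx])
      (hg'.2 d₁) (hh'.2 d₁) hgk hhk
    have j₁ : Vanish p (k + 1) (dirDeriv d₂ g) :=
      ((i₂.const_mul hN hp (hE d₁) (-1)).add hN hp (hc (hE d₁) _) s₂ h₂).congr hN hp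
        fun x hx => by ring
    have j₂ : Vanish p (k + 1) (dirDeriv d₂ h) :=
      ((h₁.const_mul hN hp s₁ (-1)).add hN hp (hc s₁ _) (hD d₁) i₁).congr hN hp
        fun x hx => by ring
    refine ⟨⟨hg'.1, fun d => ?_⟩, ⟨hh'.1, fun d => ?_⟩⟩ <;> obtain ⟨a, b, rfl⟩ := hd d <;>
      rw [dirDeriv_comb]
    · exact (i₁.const_mul hN hp (hD d₁) a).add hN hp (hc (hD d₁) _) (hc (hD d₂) _)
        (j₁.const_mul hN hp (hD d₂) b)
    · exact (i₂.const_mul hN hp (hE d₁) a).add hN hp (hc (hE d₁) _) (hc (hE d₂) _)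
        (j₂.const_mul hN hp (hE d₂) b)

/-- The first nonvanishing derivative determines the sign along a ray. -/
lemma pos_on_ray (hN : IsOpen N) (hp : p ∈ N) (hg : ContDiffOn ℝ ∞ g N) (d : 𝔼)
    (hv : Vanish p k g) (hpos : 0 < (dirDeriv d)^[k] g p) :
    ∃ r > 0, ∀ t : ℝ, 0 < t → t ≤ r → p + t • d ∈ N ∧ 0 < g (p + t • d) := by
  induction k generalizing g with
  | zero =>
    have hcont : ContinuousAt (fun t : ℝ => p + t • d) 0 := by fun_prop
    have h0 : p + (0 : ℝ) • d = p := by simp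
    have h1 : ∀ᶠ x in 𝓝 (p + (0 : ℝ) • d), x ∈ N ∧ 0 < g x := by
      rw [h0]
      exact (show ∀ᶠ x in 𝓝 p, x ∈ N from hN.mem_nhds hp).and
        ((hg.continuousOn.continuousAt (hN.mem_nhds hp)).eventually (lt_mem_nhds hpos))
    obtain ⟨r, hr, h⟩ := Metric.eventually_nhds_iff_ball.1 (hcont.eventually h1)
    exact ⟨r / 2, half_pos hr, fun t h0 h2 => h t (by
      rw [mem_ball_zero_iff, Real.norm_of_nonneg h0.le]; linarith)⟩
  | succ k ih =>
    obtain ⟨r, hr, h⟩ := ih (smooth_dirDeriv hN hg d) (hv.2 d) hpos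
    refine ⟨r, hr, fun t h0 h1 => ⟨(h t h0 h1).1, ?_⟩⟩
    have hm : ∀ s ∈ Icc (0 : ℝ) r, p + s • d ∈ N := fun s hs => by
      rcases hs.1.eq_or_lt with rfl | h'
      · simpa using hp
      · exact (h s h' hs.2).1
    have hd : ∀ s ∈ Icc (0 : ℝ) r,
        HasDerivAt (fun s : ℝ => g (p + s • d)) (dirDeriv d g (p + s • d)) s := fun s hs => by
      have h6 : HasDerivAt (fun s : ℝ => p + s • d) ((1 : ℝ) • d) s :=
        ((hasDerivAt_id s).smul_const d).const_add p
      refine ((smooth_diffAt hN hg (hm s hs)).hasFDerivAt.comp_hasDerivAt s h6).congr_deriv ?_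
      rw [one_smul]; rfl
    have := strictMonoOn_of_deriv_pos (convex_Icc (0 : ℝ) r)
      (fun s hs => (hd s hs).continuousAt.continuousWithinAt) (fun s hs => by
        rw [interior_Icc] at hs
        rw [(hd s ⟨hs.1.le, hs.2.le⟩).deriv]
        exact (h s hs.1 hs.2.le).2) (left_mem_Icc.2 hr.le) ⟨h0.le, h1⟩ h0
    simpa [hv.1] using this

end vanish

section sectors

variable {N : Set 𝔼} {p : 𝔼} {g : 𝔼 → ℝ} {k : ℕ}

lemma iteratedDeriv_line (hN : IsOpen N) (hg : ContDiffOn ℝ ∞ g N) (d : 𝔼) (k : ℕ) :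
    ∀ t : ℝ, p + t • d ∈ N →
      iteratedDeriv k (fun t : ℝ => g (p + t • d)) t = (dirDeriv d)^[k] g (p + t • d) := by
  induction k with
  | zero => intro t _; simp
  | succ k ih =>
    intro t ht
    have hcont : ContinuousAt (fun t : ℝ => p + t • d) t := by fun_prop
    have he : iteratedDeriv k (fun t : ℝ => g (p + t • d)) =ᶠ[𝓝 t]
        fun t => (dirDeriv d)^[k] g (p + t • d) := by
      filter_upwards [hcont.eventually (hN.mem_nhds ht)] with s hs using ih s hs
    rw [iteratedDeriv_succ, he.deriv_eq, Function.iterate_succ_apply']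
    have h6 : HasDerivAt (fun s : ℝ => p + s • d) ((1 : ℝ) • d) t :=
      ((hasDerivAt_id t).smul_const d).const_add p
    have := (smooth_diffAt hN (smooth_iterate hN hg d k) ht).hasFDerivAt.comp_hasDerivAt t h6
    rw [one_smul] at this
    exact this.deriv

lemma eq_zero_of_vanish (hN : IsOpen N) (hc : Convex ℝ N) (hg : AnalyticOnNhd ℝ g N) (hp : p ∈ N)
    (hv : ∀ k, Vanish p k g) {y : 𝔼} (hy : y ∈ N) : g y = 0 := by
  set d := y - p
  have hgs : ContDiffOn ℝ ∞ g N := hg.contDiffOn hN.uniqueDiffOn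
  have han : AnalyticOnNhd ℝ (fun t : ℝ => g (p + t • d)) (Icc 0 1) := fun t ht => by
    have h1 : p + t • d ∈ N := hc.add_smul_sub_mem hp hy ht
    exact (hg _ h1).fun_comp (f := fun t : ℝ => p + t • d) (by fun_prop)
  have h0 : (0 : ℝ) ∈ Icc (0 : ℝ) 1 := by simp
  have htop : analyticOrderAt (fun t : ℝ => g (p + t • d)) 0 = ⊤ := by
    refine ENat.eq_top_iff_forall_ge.2 fun n => ?_
    rw [natCast_le_analyticOrderAt_iff_iteratedDeriv_eq_zero (han 0 h0)]
    intro i _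
    rw [iteratedDeriv_line hN hgs d i 0 (by simpa using hp)]
    simpa using (hv (i + 1)).iterate d
  have := han.eqOn_zero_of_preconnected_of_eventuallyEq_zero isPreconnected_Icc h0
    (analyticOrderAt_eq_top.1 htop) (show (1 : ℝ) ∈ Icc (0 : ℝ) 1 by simp)
  simpa [d] using this

/-- The leading homogeneous part of an approximate solution of an elliptic equation is a
harmonic polynomial in suitable coordinates. -/
lemma leading_part (hN : IsOpen N) (hp : p ∈ N) {d₁ d₂ : 𝔼}
    (hd : ∀ d : 𝔼, ∃ a b : ℝ, d = a • d₁ + b • d₂) (hg : ContDiffOn ℝ ∞ g N)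
    (hv : Vanish p (k + 1) g) (hn : ¬ Vanish p (k + 2) g)
    (hL : Vanish p k fun x => dirDeriv d₁ (dirDeriv d₁ g) x + dirDeriv d₂ (dirDeriv d₂ g) x) :
    ∃ A B : ℝ, (A ≠ 0 ∨ B ≠ 0) ∧ ∀ θ : ℝ,
      (dirDeriv (Real.cos θ • d₁ + Real.sin θ • d₂))^[k + 1] g p =
        A * Real.cos ((k + 1) * θ) - B * Real.sin ((k + 1) * θ) := by
  have hD := fun d => smooth_dirDeriv hN hg d
  have hE : ContDiffOn ℝ ∞ (fun x => -1 * dirDeriv d₂ g x) N := contDiffOn_const.mul (hD d₂)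
  have hc := dirDeriv_const_mul_fun hN (hD d₂) (-1)
  have h₁ : Vanish p k fun x => dirDeriv d₁ (dirDeriv d₁ g) x +
      -1 * dirDeriv d₂ (fun x => -1 * dirDeriv d₂ g x) x :=
    hL.congr hN hp fun x hx => by rw [hc _ x hx]; ring
  have h₂ : Vanish p k fun x => dirDeriv d₁ (fun x => -1 * dirDeriv d₂ g x) x +
      dirDeriv d₂ (dirDeriv d₁ g) x :=
    (Vanish.zero p k).congr hN hp fun x hx => by
      rw [hc _ x hx, dirDeriv_comm hN hg d₂ d₁ x hx]; ring
  refine ⟨(dirDeriv d₁)^[k] (dirDeriv d₁ g) p, (dirDeriv d₁)^[k] (fun x => -1 * dirDeriv d₂ g x) p,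
    ?_, fun θ => ?_⟩
  · by_contra! h0
    obtain ⟨i₁, i₂⟩ := vanish_of_cauchyRiemann hN hp hd (hD d₁) hE h₁ h₂ (hv.2 d₁)
      ((hv.2 d₂).const_mul hN hp (hD d₂) (-1)) h0.1 h0.2
    refine hn ⟨hv.1, fun d => ?_⟩
    obtain ⟨a, b, rfl⟩ := hd d
    rw [dirDeriv_comb]
    exact ((i₁.const_mul hN hp (hD d₁) a).add hN hp (contDiffOn_const.mul (hD d₁))
      (contDiffOn_const.mul hE) (i₂.const_mul hN hp hE (-b))).congr hN hp fun x hx => by ring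
  · have := iterate_of_cauchyRiemann hN hp d₁ d₂ θ (hD d₁) hE h₁ h₂ θ
    rw [Function.iterate_succ_apply, dirDeriv_comb]
    rw [show θ + k * θ = (k + 1) * θ by ring] at this
    rw [iterate_congr hN (h := fun x => Real.cos θ * dirDeriv d₁ g x +
      -Real.sin θ * (-1 * dirDeriv d₂ g x)) (fun x _ => by ring) _ k p hp, this]
    ring

lemma exists_phase {A B m : ℝ} (h : A ≠ 0 ∨ B ≠ 0) (hm : 0 < m) :
    ∃ θ : ℝ, 0 < A * Real.cos (m * θ) - B * Real.sin (m * θ) := by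
  refine ⟨-Complex.arg ⟨A, B⟩ / m, ?_⟩
  set z : ℂ := ⟨A, B⟩
  have hz : z ≠ 0 := fun h0 => by
    have h1 := congrArg Complex.re h0
    have h2 := congrArg Complex.im h0
    simp only [z, Complex.zero_re, Complex.zero_im] at h1 h2
    tauto
  rw [mul_div_cancel₀ _ hm.ne', Real.cos_neg, Real.sin_neg, Complex.cos_arg hz, Complex.sin_arg]
  have hn : 0 < ‖z‖ := norm_pos_iff.2 hz
  have : A * (A / ‖z‖) - B * -(B / ‖z‖) = (A * A + B * B) / ‖z‖ := by ring
  show 0 < A * (A / ‖z‖) - B * -(B / ‖z‖)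
  rw [this]
  have : 0 < A * A + B * B := by
    rcases h with h | h
    · nlinarith [mul_self_pos.2 h, mul_self_nonneg B]
    · nlinarith [mul_self_pos.2 h, mul_self_nonneg A]
  positivity

/-- Vectors with `d₁ d₁ᵀ + d₂ d₂ᵀ = 1 + w wᵀ`. -/
lemma exists_frame (w : 𝔼) : ∃ d₁ d₂ : 𝔼, d₁ 0 ^ 2 + d₂ 0 ^ 2 = 1 + w 0 ^ 2 ∧
    d₁ 0 * d₁ 1 + d₂ 0 * d₂ 1 = w 0 * w 1 ∧ d₁ 1 ^ 2 + d₂ 1 ^ 2 = 1 + w 1 ^ 2 ∧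
    0 < d₁ 0 * d₂ 1 - d₁ 1 * d₂ 0 := by
  have h1 : 0 < 1 + w 0 ^ 2 := by positivity
  have h2 : 0 < (1 + w 0 ^ 2 + w 1 ^ 2) / (1 + w 0 ^ 2) := by positivity
  have s1 := Real.sq_sqrt h1.le
  have s2 := Real.sq_sqrt h2.le
  have p1 := Real.sqrt_pos.2 h1
  have p2 := Real.sqrt_pos.2 h2
  refine ⟨!₂[√(1 + w 0 ^ 2), w 0 * w 1 / √(1 + w 0 ^ 2)],
    !₂[0, √((1 + w 0 ^ 2 + w 1 ^ 2) / (1 + w 0 ^ 2))], ?_, ?_, ?_, ?_⟩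
  · simp [s1]
  · simp; field_simp
  · simp only [Matrix.cons_val_one, Matrix.cons_val_fin_one, div_pow, s1, s2]
    field_simp; ring
  · simp; positivity

lemma frame_span {d₁ d₂ : 𝔼} (h : 0 < d₁ 0 * d₂ 1 - d₁ 1 * d₂ 0) (d : 𝔼) :
    d = ((d 0 * d₂ 1 - d 1 * d₂ 0) / (d₁ 0 * d₂ 1 - d₁ 1 * d₂ 0)) • d₁ +
      ((d₁ 0 * d 1 - d₁ 1 * d 0) / (d₁ 0 * d₂ 1 - d₁ 1 * d₂ 0)) • d₂ := by
  have := h.ne'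
  ext i
  fin_cases i <;> simp only [PiLp.add_apply, PiLp.smul_apply, smul_eq_mul, Fin.zero_eta, Fin.mk_one]
    <;> rw [div_mul_eq_mul_div, div_mul_eq_mul_div, ← add_div, eq_div_iff this] <;> ring

/-- Linear coordinates centred at `p` in which `d₁, d₂` rotated by `θ` is the standard frame. -/
def sectorMap (p d₁ d₂ : 𝔼) (θ : ℝ) (z : ℂ) : 𝔼 :=
  p + (z * Complex.exp (θ * Complex.I)).re • d₁ + (z * Complex.exp (θ * Complex.I)).im • d₂

/-- The inverse of `sectorMap`. -/
def sectorInv (p d₁ d₂ : 𝔼) (θ : ℝ) (y : 𝔼) : ℂ :=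
  ((((y - p) 0 * d₂ 1 - (y - p) 1 * d₂ 0) / (d₁ 0 * d₂ 1 - d₁ 1 * d₂ 0) : ℝ) +
    ((d₁ 0 * (y - p) 1 - d₁ 1 * (y - p) 0) / (d₁ 0 * d₂ 1 - d₁ 1 * d₂ 0) : ℝ) * Complex.I) *
    Complex.exp (-(θ * Complex.I))

lemma sectorMap_inv {d₁ d₂ : 𝔼} (h : 0 < d₁ 0 * d₂ 1 - d₁ 1 * d₂ 0) (θ : ℝ) :
    Function.LeftInverse (sectorMap p d₁ d₂ θ) (sectorInv p d₁ d₂ θ) := fun y => by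
  have := frame_span h (y - p)
  rw [sectorMap, sectorInv, mul_assoc, ← Complex.exp_add, neg_add_cancel, Complex.exp_zero, mul_one]
  simp only [Complex.add_re, Complex.add_im, Complex.ofReal_re, Complex.ofReal_im,
    Complex.re_ofReal_mul, Complex.im_ofReal_mul, Complex.I_re, Complex.I_im, mul_zero, mul_one,
    add_zero, zero_add]
  rw [add_assoc, ← this]; abel

lemma sectorInv_map {d₁ d₂ : 𝔼} (h : 0 < d₁ 0 * d₂ 1 - d₁ 1 * d₂ 0) (θ : ℝ) :
    Function.RightInverse (sectorMap p d₁ d₂ θ) (sectorInv p d₁ d₂ θ) := fun z => by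
  rw [sectorMap, sectorInv]
  set w := z * Complex.exp (θ * Complex.I) with hw
  have e1 : p + w.re • d₁ + w.im • d₂ - p = w.re • d₁ + w.im • d₂ := by abel
  rw [e1]
  simp only [PiLp.add_apply, PiLp.smul_apply, smul_eq_mul]
  rw [show (w.re * d₁ 0 + w.im * d₂ 0) * d₂ 1 - (w.re * d₁ 1 + w.im * d₂ 1) * d₂ 0 =
    w.re * (d₁ 0 * d₂ 1 - d₁ 1 * d₂ 0) by ring, show d₁ 0 * (w.re * d₁ 1 + w.im * d₂ 1) -
    d₁ 1 * (w.re * d₁ 0 + w.im * d₂ 0) = w.im * (d₁ 0 * d₂ 1 - d₁ 1 * d₂ 0) by ring,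
    mul_div_cancel_right₀ _ h.ne', mul_div_cancel_right₀ _ h.ne', Complex.re_add_im, hw, mul_assoc,
    ← Complex.exp_add, add_neg_cancel, Complex.exp_zero, mul_one]

lemma continuous_sectorMap (p d₁ d₂ : 𝔼) (θ : ℝ) : Continuous (sectorMap p d₁ d₂ θ) := by
  unfold sectorMap; fun_prop

lemma continuous_sectorInv (p d₁ d₂ : 𝔼) (θ : ℝ) : Continuous (sectorInv p d₁ d₂ θ) := by
  unfold sectorInv; fun_prop

lemma sectorMap_polar (p d₁ d₂ : 𝔼) (θ α t : ℝ) :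
    sectorMap p d₁ d₂ θ (t * Complex.exp (α * Complex.I)) =
      p + t • (Real.cos (θ + α) • d₁ + Real.sin (θ + α) • d₂) := by
  rw [sectorMap, mul_assoc, ← Complex.exp_add, ← add_mul, ← Complex.ofReal_add,
    Complex.re_ofReal_mul, Complex.im_ofReal_mul, Complex.exp_ofReal_mul_I_re,
    Complex.exp_ofReal_mul_I_im, add_comm α θ]
  module

/-- Four alternating sectors cannot be joined through two disjoint connected sets. -/
lemma no_alternating_sectors {P M : Set 𝔼} (hPo : IsOpen P) (hP : IsPreconnected P)
    (hM : IsPreconnected M) (hPM : Disjoint P M) (hpP : p ∉ P) (hpM : p ∉ M) {d₁ d₂ : 𝔼}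
    (h : 0 < d₁ 0 * d₂ 1 - d₁ 1 * d₂ 0) {θ φ r : ℝ} (hφ : 0 < φ) (hφ2 : φ ≤ Real.pi / 2)
    (hr : 0 < r)
    (h1 : ∀ t : ℝ, 0 < t → t ≤ r → p + t • (Real.cos θ • d₁ + Real.sin θ • d₂) ∈ P)
    (h2 : ∀ t : ℝ, 0 < t → t ≤ r →
      p + t • (Real.cos (θ + φ) • d₁ + Real.sin (θ + φ) • d₂) ∈ M)
    (h3 : ∀ t : ℝ, 0 < t → t ≤ r →
      p + t • (Real.cos (θ + 2 * φ) • d₁ + Real.sin (θ + 2 * φ) • d₂) ∈ P)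
    (h4 : ∀ t : ℝ, 0 < t → t ≤ r →
      p + t • (Real.cos (θ + -φ) • d₁ + Real.sin (θ + -φ) • d₂) ∈ M) : False := by
  have himg : ∀ Q : Set 𝔼, sectorInv p d₁ d₂ θ '' Q = sectorMap p d₁ d₂ θ ⁻¹' Q := fun Q =>
    congrFun (image_eq_preimage_of_inverse (sectorMap_inv h θ) (sectorInv_map h θ)) Q
  have hpre : ∀ {Q : Set 𝔼}, IsPreconnected Q → IsPreconnected (sectorMap p d₁ d₂ θ ⁻¹' Q) :=
    fun hQ => himg _ ▸ hQ.image _ (continuous_sectorInv p d₁ d₂ θ).continuousOn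
  have h0 : sectorMap p d₁ d₂ θ 0 = p := by simp [sectorMap]
  refine crossing (hPo.preimage (continuous_sectorMap p d₁ d₂ θ)) (hpre hP) (hpre hM)
    (hPM.preimage _) (by rwa [mem_preimage, h0]) (by rwa [mem_preimage, h0]) hφ hφ2 hr
    (fun t ht htr => ?_) (fun t ht htr => ?_) (fun t ht htr => ?_) (fun t ht htr => ?_)
  · have := sectorMap_polar p d₁ d₂ θ 0 t
    rw [Complex.ofReal_zero, zero_mul, Complex.exp_zero, mul_one, add_zero] at this
    rw [mem_preimage, this]; exact h1 t ht htr
  · rw [mem_preimage, sectorMap_polar]; exact h2 t ht htr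
  · rw [mem_preimage, show (2 * φ * Complex.I : ℂ) = ((2 * φ : ℝ) : ℂ) * Complex.I by push_cast; rfl,
      sectorMap_polar]
    exact h3 t ht htr
  · rw [mem_preimage, show (-φ * Complex.I : ℂ) = ((-φ : ℝ) : ℂ) * Complex.I by push_cast; rfl,
      sectorMap_polar]
    exact h4 t ht htr

end sectors

lemma dirDeriv_neg_dir (e : 𝔼) (g : 𝔼 → ℝ) : dirDeriv (-e) g = fun x => -1 * dirDeriv e g x := by
  funext x; simp [dirDeriv]

lemma iterate_neg_one {N : Set 𝔼} {g : 𝔼 → ℝ} (hN : IsOpen N) (hg : ContDiffOn ℝ ∞ g N) (d : 𝔼)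
    (k : ℕ) : ∀ x ∈ N, (dirDeriv d)^[k] (fun y => -1 * g y) x = -(dirDeriv d)^[k] g x := by
  induction k generalizing g with
  | zero => intro x _; simp
  | succ k ih =>
    intro x hx
    rw [Function.iterate_succ_apply, iterate_congr hN (dirDeriv_const_mul_fun hN hg _ d) d k x hx,
      ih (smooth_dirDeriv hN hg d) x hx]
    rfl

namespace MCSetting

variable {Ω V : Set 𝔼} {f : ℝ → ℝ} {u : 𝔼 → ℝ} {γ : ℝ → 𝔼} {T : ℝ} {e : 𝔼}

lemma analytic_dirDeriv (S : MCSetting Ω V f u γ T) (e : 𝔼) : AnalyticOnNhd ℝ (dirDeriv e u) Ω :=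
  fun x hx => ((ContinuousLinearMap.apply ℝ ℝ e).analyticAt _).comp (S.uan x hx).fderiv

lemma not_vanish (S : MCSetting Ω V f u γ T) (he : e ≠ 0) {p : 𝔼} (hp : p ∈ Ω) :
    ∃ k, ¬ Vanish p k (dirDeriv e u) := by
  by_contra! hcon
  have h0 : ∀ y ∈ Ω, dirDeriv e u y = 0 := fun y hy =>
    eq_zero_of_vanish S.isOpen S.convex (S.analytic_dirDeriv e) hp hcon hy
  obtain ⟨s, -, hz, -, hv⟩ := S.exists_exit he hp
  have hzc := S.frontier_sub hz
  obtain ⟨y, hy, hyΩ⟩ := mem_closure_iff_nhds.1 hzc _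
    ((S.continuousAt_dirDeriv e hzc).eventually (lt_mem_nhds hv))
  exact (h0 y hyΩ).not_gt hy

lemma vanish_frozen (S : MCSetting Ω V f u γ T) {p : 𝔼} (hp : p ∈ Ω) {k : ℕ}
    (hv : Vanish p (k + 2) (dirDeriv e u)) {d₁ d₂ : 𝔼}
    (h00 : d₁ 0 ^ 2 + d₂ 0 ^ 2 = 1 + perpGrad u p 0 ^ 2)
    (h01 : d₁ 0 * d₁ 1 + d₂ 0 * d₂ 1 = perpGrad u p 0 * perpGrad u p 1)
    (h11 : d₁ 1 ^ 2 + d₂ 1 ^ 2 = 1 + perpGrad u p 1 ^ 2) :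
    Vanish p (k + 1) fun x => dirDeriv d₁ (dirDeriv d₁ (dirDeriv e u)) x +
      dirDeriv d₂ (dirDeriv d₂ (dirDeriv e u)) x := by
  have hO := S.isOpen
  have hs := smooth_dirDeriv hO S.smooth e
  have h1 := smooth_pd hO S.smooth
  have hs1 := smooth_pd hO hs
  have hs2 := fun i j => smooth_pd hO (hs1 j) i
  have v2 : ∀ i j, Vanish p k (pd i (pd j (dirDeriv e u))) := fun i j => (hv.2 _).2 _
  have hcs : ∀ i j, ContDiffOn ℝ ∞ (fun x => pd i u p * pd j u p + -1 * (pd i u x * pd j u x)) Ω :=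
    fun i j => contDiffOn_const.add (contDiffOn_const.mul ((h1 i).mul (h1 j)))
  have gain : ∀ i j a b, Vanish p (k + 1) fun x =>
      (pd i u p * pd j u p + -1 * (pd i u x * pd j u x)) * pd a (pd b (dirDeriv e u)) x :=
    fun i j a b => (v2 a b).mul_succ hO hp (hcs i j) (hs2 a b) (by ring)
  have sg := fun i j a b => (hcs i j).mul (hs2 a b)
  have t1 := (hv.of_succ.mul hO hp S.smooth_potential hs)
  have t2 := ((hv.2 (EuclideanSpace.single 0 1)).mul hO hp S.smooth_driftZero (hs1 0))
  have t3 := ((hv.2 (EuclideanSpace.single 1 1)).mul hO hp S.smooth_driftOne (hs1 1))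
  have s1 := S.smooth_potential.mul hs
  have s2 := S.smooth_driftZero.mul (hs1 0)
  have s3 := S.smooth_driftOne.mul (hs1 1)
  have t4 := (gain 0 1 0 1).const_mul hO hp (sg 0 1 0 1) (-2)
  have s4 : ContDiffOn ℝ ∞ _ Ω := (contDiffOn_const (c := (-2 : ℝ))).mul (sg 0 1 0 1)
  have all := ((((t1.add hO hp s1 s2 t2).add hO hp (s1.add s2) s3 t3).add hO hp
    ((s1.add s2).add s3) (sg 1 1 0 0) (gain 1 1 0 0)).add hO hp
    (((s1.add s2).add s3).add (sg 1 1 0 0)) s4 t4).add hO hp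
    ((((s1.add s2).add s3).add (sg 1 1 0 0)).add s4) (sg 0 0 1 1) (gain 0 0 1 1)
  refine all.congr hO hp fun x hx => ?_
  rw [dirDeriv_dirDeriv hO hs _ x hx, dirDeriv_dirDeriv hO hs _ x hx]
  have hl := S.linearized hx e
  simp only [ellForm, hessForm, perpGrad_zero, perpGrad_one] at hl h00 h01 h11 ⊢
  simp only [pd] at hl h00 h01 h11 ⊢
  linear_combination -hl - h00 * dirDeriv (EuclideanSpace.single 0 1)
      (dirDeriv (EuclideanSpace.single 0 1) (dirDeriv e u)) x -
    2 * h01 * dirDeriv (EuclideanSpace.single 0 1)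
      (dirDeriv (EuclideanSpace.single 1 1) (dirDeriv e u)) x -
    h11 * dirDeriv (EuclideanSpace.single 1 1)
      (dirDeriv (EuclideanSpace.single 1 1) (dirDeriv e u)) x

lemma vanish_two {p : 𝔼} {v : 𝔼 → ℝ} (h0 : v p = 0) (h1 : fderiv ℝ v p = 0) : Vanish p 2 v :=
  ⟨h0, fun d => ⟨by simp [dirDeriv, h1], fun _ => trivial⟩⟩

/-- At interior points a directional derivative of `u` has no degenerate zeros. -/
lemma fderiv_dirDeriv_ne_zero (S : MCSetting Ω V f u γ T) (he : e ≠ 0) {p : 𝔼} (hp : p ∈ Ω)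
    (h0 : dirDeriv e u p = 0) : fderiv ℝ (dirDeriv e u) p ≠ 0 := fun h1 => by
  classical
  have hO := S.isOpen
  have hs := smooth_dirDeriv hO S.smooth e
  have hex := S.not_vanish he hp
  obtain ⟨k, hv, hn⟩ : ∃ k, Vanish p (k + 2) (dirDeriv e u) ∧ ¬ Vanish p (k + 3) (dirDeriv e u) := by
    have hv2 : Vanish p 2 (dirDeriv e u) := vanish_two h0 h1
    by_contra! hcon
    have hall : ∀ k, Vanish p (k + 2) (dirDeriv e u) := fun k => by
      induction k with
      | zero => exact hv2
      | succ k ih => exact hcon k ih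
    obtain ⟨k, hk⟩ := hex
    exact hk (hall k).of_succ.of_succ
  obtain ⟨d₁, d₂, h00, h01, h11, hdet⟩ := exists_frame (perpGrad u p)
  obtain ⟨A, B, hAB, hform⟩ := leading_part hO hp (fun d => ⟨_, _, frame_span hdet d⟩) hs hv hn
    (S.vanish_frozen hp hv h00 h01 h11)
  set m : ℝ := (k + 1 : ℕ) + 1 with hm
  have hm2 : 2 ≤ m := by rw [hm]; push_cast; linarith [Nat.cast_nonneg (α := ℝ) k]
  have hm0 : 0 < m := by linarith
  obtain ⟨θ, hθ⟩ := exists_phase hAB hm0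
  set φ := Real.pi / m with hφ
  have hmφ : m * φ = Real.pi := by rw [hφ]; field_simp
  have ray_pos : ∀ α, 0 < A * Real.cos (m * α) - B * Real.sin (m * α) → ∃ r > 0,
      ∀ t : ℝ, 0 < t → t ≤ r →
        p + t • (Real.cos α • d₁ + Real.sin α • d₂) ∈ posSet Ω u e := fun α hα =>
    pos_on_ray hO hp hs _ hv (by rw [hform]; exact hα)
  have ray_neg : ∀ α, A * Real.cos (m * α) - B * Real.sin (m * α) < 0 → ∃ r > 0,
      ∀ t : ℝ, 0 < t → t ≤ r →
        p + t • (Real.cos α • d₁ + Real.sin α • d₂) ∈ posSet Ω u (-e) := fun α hα => by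
    have hv' : Vanish p (k + 2) (dirDeriv (-e) u) := by
      rw [dirDeriv_neg_dir]; exact hv.const_mul hO hp hs (-1)
    refine pos_on_ray hO hp (smooth_dirDeriv hO S.smooth (-e)) _ hv' ?_
    rw [dirDeriv_neg_dir, iterate_neg_one hO hs _ _ p hp]
    have := hform α
    rw [this]; linarith
  obtain ⟨r₁, hr₁, k₁⟩ := ray_pos θ hθ
  obtain ⟨r₂, hr₂, k₂⟩ := ray_neg (θ + φ) (by
    rw [mul_add, hmφ, Real.cos_add_pi, Real.sin_add_pi]; linarith)
  obtain ⟨r₃, hr₃, k₃⟩ := ray_pos (θ + 2 * φ) (by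
    rw [show m * (θ + 2 * φ) = m * θ + 2 * Real.pi by rw [← hmφ]; ring, Real.cos_add_two_pi,
      Real.sin_add_two_pi]; exact hθ)
  obtain ⟨r₄, hr₄, k₄⟩ := ray_neg (θ + -φ) (by
    rw [mul_add, mul_neg, hmφ, ← sub_eq_add_neg, Real.cos_sub_pi, Real.sin_sub_pi]; linarith)
  have hr : 0 < min (min r₁ r₂) (min r₃ r₄) := by positivity
  have hneg : ∀ x, dirDeriv (-e) u x = -dirDeriv e u x := fun x => by rw [dirDeriv_neg_dir]; ring
  refine no_alternating_sectors (S.isOpen_posSet e) (S.isPreconnected_posSet he)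
    (S.isPreconnected_posSet (neg_ne_zero.2 he)) (disjoint_left.2 fun x hx hy => ?_)
    (fun hx => hx.2.ne' h0) (fun hx => hx.2.ne' (by rw [hneg, h0, neg_zero])) hdet
    (φ := φ) (by positivity) (div_le_div_of_nonneg_left Real.pi_pos.le two_pos hm2) hr
    (fun t a b => k₁ t a (b.trans (by simp))) (fun t a b => k₂ t a (b.trans (by simp)))
    (fun t a b => k₃ t a (b.trans (by simp))) (fun t a b => k₄ t a (b.trans (by simp)))
  have := hy.2
  rw [hneg] at this
  linarith [hx.2]

end MCSetting

section inversion

variable {F : Type*} [NormedAddCommGroup F] [InnerProductSpace ℝ F]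

lemma norm_div_sq_smul_le {a : F} {s c : ℝ} (hc : 0 < c) (hs : 0 ≤ s) (ha : c * s ≤ ‖a‖) :
    ‖(s / ‖a‖) ^ 2 • a‖ ≤ s / c := by
  rw [norm_smul, Real.norm_of_nonneg (by positivity)]
  rcases eq_or_ne a 0 with rfl | h
  · simp only [norm_zero, mul_zero]; positivity
  have hn : 0 < ‖a‖ := norm_pos_iff.2 h
  rw [show (s / ‖a‖) ^ 2 * ‖a‖ = s ^ 2 / ‖a‖ by field_simp, div_le_div_iff₀ hn hc]
  nlinarith

lemma norm_div_sq_smul_sub_le_of_le {a b : F} {s t c : ℝ} (hc : 0 < c) (ht : 0 ≤ t) (hts : t ≤ s)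
    (ha : c * s ≤ ‖a‖) (hb : c * t ≤ ‖b‖) :
    ‖(s / ‖a‖) ^ 2 • a - (t / ‖b‖) ^ 2 • b‖ ≤ 2 / c * (s - t) + 1 / c ^ 2 * ‖a - b‖ := by
  rcases ht.eq_or_lt with rfl | ht
  · have h := norm_div_sq_smul_le hc hts ha
    have : 0 ≤ s / c := by positivity
    have h2 : 0 ≤ 1 / c ^ 2 * ‖a - b‖ := by positivity
    rw [show 2 / c * (s - 0) = 2 * (s / c) by ring]
    simp only [zero_div, ne_eq, OfNat.ofNat_ne_zero, not_false_eq_true, zero_pow, zero_smul,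
      sub_zero]
    linarith
  have hs : 0 < s := ht.trans_le hts
  have hna : 0 < ‖a‖ := lt_of_lt_of_le (by positivity) ha
  have hnb : 0 < ‖b‖ := lt_of_lt_of_le (by positivity) hb
  have key : (s / ‖a‖) ^ 2 • a - (t / ‖b‖) ^ 2 • b =
      ((s ^ 2 - t ^ 2) / ‖a‖ ^ 2) • a + ((t / ‖a‖) ^ 2 • a - (t / ‖b‖) ^ 2 • b) := by
    rw [add_sub, ← add_smul]; congr 2; ring
  rw [key]
  refine (norm_add_le _ _).trans (add_le_add ?_ ?_)
  · have h0 : 0 ≤ s ^ 2 - t ^ 2 := by nlinarith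
    rw [norm_smul, Real.norm_of_nonneg (by positivity),
      show (s ^ 2 - t ^ 2) / ‖a‖ ^ 2 * ‖a‖ = (s - t) * ((s + t) / ‖a‖) by field_simp; ring,
      mul_comm (2 / c)]
    refine mul_le_mul_of_nonneg_left ?_ (sub_nonneg.2 hts)
    rw [div_le_div_iff₀ hna hc]
    nlinarith
  · rw [← dist_eq_norm, dist_div_norm_sq_smul (norm_pos_iff.1 hna) (norm_pos_iff.1 hnb),
      dist_eq_norm]
    refine mul_le_mul_of_nonneg_right ?_ (norm_nonneg _)
    rw [div_le_div_iff₀ (by positivity) (by positivity), one_mul]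
    calc t ^ 2 * c ^ 2 = (c * t) * (c * t) := by ring
      _ ≤ ‖a‖ * ‖b‖ := mul_le_mul (by nlinarith) hb (by positivity) hna.le

/-- Inversion scaled by the square of a dominated quantity is Lipschitz. -/
lemma norm_div_sq_smul_sub_le {a b : F} {s t c : ℝ} (hc : 0 < c) (hs : 0 ≤ s) (ht : 0 ≤ t)
    (ha : c * s ≤ ‖a‖) (hb : c * t ≤ ‖b‖) :
    ‖(s / ‖a‖) ^ 2 • a - (t / ‖b‖) ^ 2 • b‖ ≤ 2 / c * |s - t| + 1 / c ^ 2 * ‖a - b‖ := by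
  rcases le_total t s with h | h
  · rw [abs_of_nonneg (sub_nonneg.2 h)]
    exact norm_div_sq_smul_sub_le_of_le hc ht h ha hb
  · rw [norm_sub_rev, norm_sub_rev a, abs_sub_comm, abs_of_nonneg (sub_nonneg.2 h)]
    exact norm_div_sq_smul_sub_le_of_le hc hs h hb ha

end inversion

/-- The Hessian of `u` applied to a vector. -/
def hessVec (u : 𝔼 → ℝ) (x e : 𝔼) : 𝔼 :=
  !₂[pd 0 (pd 0 u) x * e 0 + pd 0 (pd 1 u) x * e 1,
    pd 1 (pd 0 u) x * e 0 + pd 1 (pd 1 u) x * e 1]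

@[simp] lemma hessVec_zero (u : 𝔼 → ℝ) (x e : 𝔼) :
    hessVec u x e 0 = pd 0 (pd 0 u) x * e 0 + pd 0 (pd 1 u) x * e 1 := by simp [hessVec]

@[simp] lemma hessVec_one (u : 𝔼 → ℝ) (x e : 𝔼) :
    hessVec u x e 1 = pd 1 (pd 0 u) x * e 0 + pd 1 (pd 1 u) x * e 1 := by simp [hessVec]

lemma hessVec_smul (u : 𝔼 → ℝ) (x e : 𝔼) (c : ℝ) : hessVec u x (c • e) = c • hessVec u x e := by
  ext i
  fin_cases i <;> simp <;> ring

lemma Xfield_eq {u : 𝔼 → ℝ} {x : 𝔼} (hu : ContDiffAt ℝ 2 u x) :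
    Xfield u x = (‖gradient u x‖ ^ 2)⁻¹ • hessVec u x (perpGrad u x) := by
  unfold Xfield
  congr 1
  ext i
  fin_cases i <;>
    (simp [hessMatrix, Matrix.vecHead, Matrix.vecTail, gradient_apply, hessEntry_eq hu]; ring)

lemma norm_perpGrad (u : 𝔼 → ℝ) (x : 𝔼) : ‖perpGrad u x‖ = ‖gradient u x‖ := by
  rw [← sq_eq_sq₀ (norm_nonneg _) (norm_nonneg _), MCSetting.norm_perpGrad_sq, norm_gradient_sq]

lemma inv_sq_smul_Xfield {u : 𝔼 → ℝ} {x : 𝔼} (hu : ContDiffAt ℝ 2 u x) (hg : gradient u x ≠ 0) :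
    (‖Xfield u x‖ ^ 2)⁻¹ • Xfield u x =
      (‖gradient u x‖ / ‖hessVec u x (perpGrad u x)‖) ^ 2 • hessVec u x (perpGrad u x) := by
  have hq : 0 < ‖gradient u x‖ := norm_pos_iff.2 hg
  rw [Xfield_eq hu, smul_smul, norm_smul, Real.norm_of_nonneg (by positivity)]
  congr 1
  rcases eq_or_ne (hessVec u x (perpGrad u x)) 0 with h | h
  · simp [h]
  have := norm_pos_iff.2 h
  field_simp

namespace MCSetting

variable {Ω V : Set 𝔼} {f : ℝ → ℝ} {u : 𝔼 → ℝ} {γ : ℝ → 𝔼} {T : ℝ}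

lemma hessVec_ne_zero (S : MCSetting Ω V f u γ T) {x e : 𝔼} (hx : x ∈ closure Ω) (he : e ≠ 0)
    (h0 : dirDeriv e u x = 0) : hessVec u x e ≠ 0 := by
  intro h
  have a0 : pd 0 (pd 0 u) x * e 0 + pd 0 (pd 1 u) x * e 1 = 0 := by
    rw [← hessVec_zero, h]; rfl
  have a1 : pd 1 (pd 0 u) x * e 0 + pd 1 (pd 1 u) x * e 1 = 0 := by
    rw [← hessVec_one, h]; rfl
  by_cases hxΩ : x ∈ Ω
  · refine S.fderiv_dirDeriv_ne_zero he hxΩ h0 ?_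
    have hp : ∀ i, pd i (dirDeriv e u) x = e 0 * pd i (pd 0 u) x + e 1 * pd i (pd 1 u) x :=
      fun i => by
        rw [dirDeriv_eq, pd_lin S.isOpen (smooth_pd S.isOpen S.smooth 0)
          (smooth_pd S.isOpen S.smooth 1) hxΩ]
    ext d
    rw [fderiv_apply_eq, hp, hp, zero_apply]
    linear_combination d 0 * a0 + d 1 * a1
  · have hf := S.mem_frontier hx hxΩ
    have hq := S.grad_pos hf
    have ht := S.tangHess_neg hf
    simp only [dirDeriv_eq] at h0
    rw [pd_comm (S.contDiffAt hx) 1 0] at a1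
    set p := pd 0 u x
    set r := pd 1 u x
    have e0 : (p ^ 2 + r ^ 2) * e 0 = (e 0 * r - e 1 * p) * r := by linear_combination p * h0
    have e1 : (p ^ 2 + r ^ 2) * e 1 = -((e 0 * r - e 1 * p) * p) := by linear_combination r * h0
    have hl : (e 0 * r - e 1 * p) ^ 2 * tangHess u x = 0 := by
      have hQ : e 0 ^ 2 * pd 0 (pd 0 u) x + 2 * (e 0 * e 1) * pd 0 (pd 1 u) x
          + e 1 ^ 2 * pd 1 (pd 1 u) x = 0 := by linear_combination e 0 * a0 + e 1 * a1
      unfold tangHess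
      linear_combination (p ^ 2 + r ^ 2) ^ 2 * hQ
        - pd 0 (pd 0 u) x * ((p ^ 2 + r ^ 2) * e 0 + (e 0 * r - e 1 * p) * r) * e0
        - 2 * pd 0 (pd 1 u) x * ((p ^ 2 + r ^ 2) * e 1 * e0 + (e 0 * r - e 1 * p) * r * e1)
        - pd 1 (pd 1 u) x * ((p ^ 2 + r ^ 2) * e 1 - (e 0 * r - e 1 * p) * p) * e1
    have hl0 : e 0 * r - e 1 * p = 0 := by
      have := (mul_eq_zero.1 hl).resolve_right ht.ne
      simpa using this
    rw [hl0] at e0 e1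
    simp only [zero_mul, neg_zero, mul_eq_zero, hq.ne', false_or] at e0 e1
    exact he (by ext i; fin_cases i <;> simp [e0, e1])

lemma exists_hessVec_lower (S : MCSetting Ω V f u γ T) : ∃ c > 0, ∀ x ∈ closure Ω,
    c * ‖gradient u x‖ ≤ ‖hessVec u x (perpGrad u x)‖ := by
  have h1 : ∀ i, ContinuousOn (fun z : 𝔼 × 𝔼 => pd i u z.1) (closure Ω ×ˢ sphere 0 1) := fun i =>
    (S.continuousOn_pd i).comp continuousOn_fst fun z hz => hz.1
  have h2 : ∀ i j, ContinuousOn (fun z : 𝔼 × 𝔼 => pd i (pd j u) z.1)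
      (closure Ω ×ˢ sphere 0 1) := fun i j =>
    (S.continuousOn_pd_pd i j).comp continuousOn_fst fun z hz => hz.1
  have he : ∀ i, ContinuousOn (fun z : 𝔼 × 𝔼 => z.2 i) (closure Ω ×ˢ sphere 0 1) := fun i => by
    fun_prop
  have hd : ContinuousOn (fun z : 𝔼 × 𝔼 => dirDeriv z.2 u z.1) (closure Ω ×ˢ sphere 0 1) := by
    simp only [dirDeriv_eq]
    exact ((he 0).mul (h1 0)).add ((he 1).mul (h1 1))
  have hh : ContinuousOn (fun z : 𝔼 × 𝔼 => ‖hessVec u z.1 z.2‖ ^ 2) (closure Ω ×ˢ sphere 0 1) := by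
    simp only [norm_sq_eq, hessVec_zero, hessVec_one]
    exact ((((h2 0 0).mul (he 0)).add ((h2 0 1).mul (he 1))).pow 2).add
      ((((h2 1 0).mul (he 0)).add ((h2 1 1).mul (he 1))).pow 2)
  have hc0 : IsCompact (closure Ω ×ˢ sphere (0 : 𝔼) 1) :=
    S.closure_isCompact.prod (isCompact_sphere _ _)
  set W : Set (𝔼 × 𝔼) := closure Ω ×ˢ sphere (0 : 𝔼) 1 ∩
    (fun z : 𝔼 × 𝔼 => dirDeriv z.2 u z.1) ⁻¹' {0} with hW
  have hmem : ∀ x ∈ closure Ω, ∀ e : 𝔼, ‖e‖ = 1 → dirDeriv e u x = 0 → (x, e) ∈ W :=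
    fun x hx e hen h0 => ⟨⟨hx, by simpa using hen⟩, h0⟩
  have hc : IsCompact W :=
    hc0.of_isClosed_subset (hd.preimage_isClosed_of_isClosed hc0.isClosed isClosed_singleton)
      inter_subset_left
  obtain ⟨c, hcpos, hlow⟩ : ∃ c > 0, ∀ x ∈ closure Ω, ∀ e : 𝔼, ‖e‖ = 1 → dirDeriv e u x = 0 →
      c ≤ ‖hessVec u x e‖ := by
    rcases W.eq_empty_or_nonempty with hem | hne
    · refine ⟨1, one_pos, fun x hx e hen h0 => ?_⟩
      have := hmem x hx e hen h0
      simp [hem] at this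
    · obtain ⟨z, hz, hmin⟩ := hc.exists_isMinOn hne (hh.mono inter_subset_left)
      have hz2 : ‖z.2‖ = 1 := by simpa using hz.1.2
      have hz0 : z.2 ≠ 0 := fun h => by simp [h] at hz2
      refine ⟨‖hessVec u z.1 z.2‖, norm_pos_iff.2 (S.hessVec_ne_zero hz.1.1 hz0 hz.2),
        fun x hx e hen h0 => ?_⟩
      have hle := isMinOn_iff.1 hmin (x, e) (hmem x hx e hen h0)
      simp only at hle
      exact (sq_le_sq₀ (norm_nonneg _) (norm_nonneg _)).1 hle
  refine ⟨c, hcpos, fun x hx => ?_⟩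
  rw [← norm_perpGrad]
  rcases eq_or_ne (perpGrad u x) 0 with h | h
  · simp [h]
  have hn := norm_pos_iff.2 h
  have hl := hlow x hx (‖perpGrad u x‖⁻¹ • perpGrad u x) (norm_smul_inv_norm h) (by
    simp only [dirDeriv_eq, PiLp.smul_apply, smul_eq_mul, perpGrad_zero, perpGrad_one]; ring)
  rw [hessVec_smul, norm_smul, norm_inv, norm_norm, inv_mul_eq_div, le_div_iff₀ hn] at hl
  exact hl

lemma pd_lipschitz (S : MCSetting Ω V f u γ T) : ∃ C ≥ 0, ∀ i, ∀ x ∈ closure Ω,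
    ∀ y ∈ closure Ω, |pd i u x - pd i u y| ≤ C * ‖x - y‖ := by
  choose B hB0 hB using fun i : Fin 2 => fun j : Fin 2 =>
    S.bddFun_of_continuousOn (S.continuousOn_pd_pd i j)
  set D := B 0 0 + B 0 1 + B 1 0 + B 1 1 with hD
  have hle : ∀ i j, B i j ≤ D := fun i j => by
    have h00 := hB0 0 0
    have h01 := hB0 0 1
    have h10 := hB0 1 0
    have h11 := hB0 1 1
    fin_cases i <;> fin_cases j <;> simp only [Fin.zero_eta, Fin.mk_one] <;> linarith
  have hD0 : 0 ≤ D := (hB0 0 0).trans (hle 0 0)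
  refine ⟨D + D, by positivity, fun j => lipschitz_closure (S.continuousOn_pd j) ?_⟩
  exact lipschitz_of_pd S.convex
    (fun x hx => smooth_diffAt S.isOpen (smooth_pd S.isOpen S.smooth j) hx)
    fun i x hx => (hB i j x (subset_closure hx)).trans (hle i j)

lemma gradient_norm_lipschitz (S : MCSetting Ω V f u γ T) : ∃ C ≥ 0, ∀ x ∈ closure Ω,
    ∀ y ∈ closure Ω, |‖gradient u x‖ - ‖gradient u y‖| ≤ C * ‖x - y‖ := by
  obtain ⟨C, hC, h⟩ := S.pd_lipschitz
  refine ⟨C + C, by positivity, fun x hx y hy => (abs_norm_sub_norm_le _ _).trans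
    ((norm_le_abs_add _).trans ?_)⟩
  simp only [PiLp.sub_apply, gradient_apply]
  linarith [h 0 x hx y hy, h 1 x hx y hy]

lemma hessVec_perpGrad_lipschitz (S : MCSetting Ω V f u γ T) : ∃ C ≥ 0, ∀ x ∈ closure Ω,
    ∀ y ∈ closure Ω,
      ‖hessVec u x (perpGrad u x) - hessVec u y (perpGrad u y)‖ ≤ C * ‖x - y‖ := by
  obtain ⟨C, hC, h1⟩ := S.pd_lipschitz
  obtain ⟨D, hD, h2⟩ := S.pd_pd_lipschitz
  choose P hP0 hP using fun i : Fin 2 => S.bddFun_of_continuousOn (S.continuousOn_pd i)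
  choose B hB0 hB using fun i : Fin 2 => fun j : Fin 2 =>
    S.bddFun_of_continuousOn (S.continuousOn_pd_pd i j)
  have hprod : ∀ i j k, ∀ x ∈ closure Ω, ∀ y ∈ closure Ω,
      |pd i (pd j u) x * pd k u x - pd i (pd j u) y * pd k u y| ≤
        (B i j * C + D * P k) * ‖x - y‖ := by
    intro i j k x hx y hy
    rw [show pd i (pd j u) x * pd k u x - pd i (pd j u) y * pd k u y =
      pd i (pd j u) x * (pd k u x - pd k u y) + (pd i (pd j u) x - pd i (pd j u) y) * pd k u y
      by ring]
    refine (abs_add_le _ _).trans ?_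
    rw [abs_mul, abs_mul, add_mul, mul_assoc, mul_right_comm]
    exact add_le_add (mul_le_mul (hB i j x hx) (h1 k x hx y hy) (abs_nonneg _) (hB0 i j))
      (mul_le_mul (h2 i j x hx y hy) (hP k y hy) (abs_nonneg _) (by positivity))
  have hcomp : ∀ i, ∀ x ∈ closure Ω, ∀ y ∈ closure Ω,
      |(pd i (pd 0 u) x * -pd 1 u x + pd i (pd 1 u) x * pd 0 u x)
        - (pd i (pd 0 u) y * -pd 1 u y + pd i (pd 1 u) y * pd 0 u y)| ≤
        (B i 0 * C + D * P 1 + (B i 1 * C + D * P 0)) * ‖x - y‖ := by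
    intro i x hx y hy
    rw [show (pd i (pd 0 u) x * -pd 1 u x + pd i (pd 1 u) x * pd 0 u x)
        - (pd i (pd 0 u) y * -pd 1 u y + pd i (pd 1 u) y * pd 0 u y) =
        (pd i (pd 1 u) x * pd 0 u x - pd i (pd 1 u) y * pd 0 u y)
          - (pd i (pd 0 u) x * pd 1 u x - pd i (pd 0 u) y * pd 1 u y) by ring]
    refine (abs_sub _ _).trans ?_
    have := hprod i 0 1 x hx y hy
    have := hprod i 1 0 x hx y hy
    linarith
  have hnn : ∀ i, 0 ≤ B i 0 * C + D * P 1 + (B i 1 * C + D * P 0) := fun i => by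
    have := hB0 i 0
    have := hB0 i 1
    have := hP0 0
    have := hP0 1
    positivity
  refine ⟨_, add_nonneg (hnn 0) (hnn 1), fun x hx y hy => (norm_le_abs_add _).trans ?_⟩
  rw [add_mul]
  simpa using add_le_add (hcomp 0 x hx y hy) (hcomp 1 x hx y hy)

end MCSetting

lemma eqn_closure {Ω V : Set 𝔼} {f : ℝ → ℝ} {u : 𝔼 → ℝ} (hf : Continuous f)
    (hV : IsOpen V) (hΩ : closure Ω ⊆ V) (hu : ContDiffOn ℝ 2 u V)
    (h : ∀ x ∈ Ω, meanCurv u x = f (u x)) : ∀ x ∈ closure Ω,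
      pd 0 (pd 0 u) x + pd 1 (pd 1 u) x + tangHess u x = mcRhs f u x := by
  have h1 : ∀ i, ContDiffOn ℝ 1 (pd i u) V := fun i => contDiffOn_pd hV hu (by norm_num) i
  have c1 : ∀ i, ContinuousOn (pd i u) (closure Ω) := fun i => (h1 i).continuousOn.mono hΩ
  have c2 : ∀ i j, ContinuousOn (pd i (pd j u)) (closure Ω) := fun i j =>
    (contDiffOn_pd hV (h1 j) (m := 0) (by norm_num) i).continuousOn.mono hΩ
  have c10 := c1 0
  have c11 := c1 1
  have c00 := c2 0 0
  have c01 := c2 0 1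
  have c2' := c2 1 1
  have c0 : ContinuousOn (fun x => f (u x)) (closure Ω) :=
    hf.comp_continuousOn (hu.continuousOn.mono hΩ)
  refine Set.EqOn.of_subset_closure (s := Ω) (fun x hx => ?_) ?_ ?_ subset_closure subset_rfl
  · rw [mcRhs, ← h x hx,
      ← meanCurv_eq (hu.contDiffAt (hV.mem_nhds (hΩ (subset_closure hx))))]
  · unfold tangHess
    fun_prop
  · unfold mcRhs
    have cs : ContinuousOn (fun x => 1 + pd 0 u x ^ 2 + pd 1 u x ^ 2) (closure Ω) := by fun_prop
    exact (cs.mul cs.sqrt).mul c0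

/-- The vector field `Z = X/|X|²` on `closure Ω \ K`, extended by `0` on
`K`, satisfies `|Z| ≤ C|∇u|` and is Lipschitz on `closure Ω`. Here "C² up to the closure"
is expressed by `u` being `C²` on an open neighborhood of `closure Ω`. -/
theorem Zfield_lipschitz
    (Ω : Set (EuclideanSpace ℝ (Fin 2)))
    (hΩne : Ω.Nonempty) (hΩopen : IsOpen Ω) (hΩbd : Bornology.IsBounded Ω)
    (hΩconv : StrictConvex ℝ (closure Ω)) (hΩsmooth : SmoothPosCurvBoundary Ω)
    (f : ℝ → ℝ) (hf : AnalyticOnNhd ℝ f Set.univ) (hfmono : Monotone f)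
    (u : EuclideanSpace ℝ (Fin 2) → ℝ)
    (hsol : IsMCSolution Ω f u) (hupos : ∀ x ∈ Ω, 0 < u x)
    (huan : AnalyticOnNhd ℝ u Ω)
    (V : Set (EuclideanSpace ℝ (Fin 2))) (hVopen : IsOpen V) (hΩV : closure Ω ⊆ V)
    (huC2 : ContDiffOn ℝ 2 u V)
    (K : Set (EuclideanSpace ℝ (Fin 2))) (hK : K = {x | x ∈ Ω ∧ gradient u x = 0})
    (Z : EuclideanSpace ℝ (Fin 2) → EuclideanSpace ℝ (Fin 2))
    (hZ : ∀ x ∈ closure Ω \ K, Z x = (‖Xfield u x‖ ^ 2)⁻¹ • Xfield u x)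
    (hZK : ∀ x ∈ K, Z x = 0) :
    ∃ C > (0:ℝ), (∀ x ∈ closure Ω, ‖Z x‖ ≤ C * ‖gradient u x‖) ∧
      ∀ x₁ ∈ closure Ω, ∀ x₂ ∈ closure Ω, ‖Z x₂ - Z x₁‖ ≤ C * ‖x₂ - x₁‖ := by
  obtain ⟨T, hT, γ, hγ, hγper, hγrange, hγcurv⟩ := hΩsmooth
  have hfs : ContDiff ℝ ∞ f := contDiffOn_univ.1 (hf.contDiffOn uniqueDiffOn_univ)
  have S : MCSetting Ω V f u γ T := {
    nonempty := hΩne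
    isOpen := hΩopen
    bdd := hΩbd
    sconv := hΩconv
    fsmooth := hfs
    fmono := hfmono
    upos := hupos
    uzero := hsol.2.2.2
    uan := huan
    isOpenV := hVopen
    subV := hΩV
    contDiffV := huC2
    eqn := eqn_closure hfs.continuous hVopen hΩV huC2 hsol.2.2.1
    Tpos := hT
    γsmooth := hγ
    γper := hγper
    γrange := hγrange
    γderiv := fun t => (hγcurv t).1
    γcurv := fun t => (hγcurv t).2 }
  have hZeq : ∀ x ∈ closure Ω, Z x =
      (‖gradient u x‖ / ‖hessVec u x (perpGrad u x)‖) ^ 2 • hessVec u x (perpGrad u x) := by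
    intro x hx
    by_cases hg : gradient u x = 0
    · have hxΩ : x ∈ Ω := by
        by_contra hn
        have := S.grad_pos (S.mem_frontier hx hn)
        simp [← norm_gradient_sq, hg] at this
      rw [hZK x (hK ▸ ⟨hxΩ, hg⟩), hg]
      simp
    · rw [hZ x ⟨hx, fun hxK => hg (hK ▸ hxK : x ∈ {x | x ∈ Ω ∧ gradient u x = 0}).2⟩,
        inv_sq_smul_Xfield (S.contDiffAt hx) hg]
  obtain ⟨c, hc, hlow⟩ := S.exists_hessVec_lower
  obtain ⟨C, hC, hgrad⟩ := S.gradient_norm_lipschitz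
  obtain ⟨D, hD, hhess⟩ := S.hessVec_perpGrad_lipschitz
  have hc' : 0 < 1 / c := by positivity
  have hCD : 0 ≤ 2 / c * C + 1 / c ^ 2 * D := by positivity
  refine ⟨1 / c + (2 / c * C + 1 / c ^ 2 * D), by positivity, fun x hx => ?_,
    fun y hy x hx => ?_⟩
  · rw [hZeq x hx]
    refine (norm_div_sq_smul_le hc (norm_nonneg _) (hlow x hx)).trans ?_
    rw [add_mul, one_div_mul_eq_div]
    exact le_add_of_nonneg_right (mul_nonneg hCD (norm_nonneg _))
  · rw [hZeq x hx, hZeq y hy]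
    calc _ ≤ _ := norm_div_sq_smul_sub_le hc (norm_nonneg _) (norm_nonneg _) (hlow x hx) (hlow y hy)
      _ ≤ 2 / c * (C * ‖x - y‖) + 1 / c ^ 2 * (D * ‖x - y‖) := by
        gcongr
        · exact hgrad x hx y hy
        · exact hhess x hx y hy
      _ = (2 / c * C + 1 / c ^ 2 * D) * ‖x - y‖ := by ring
      _ ≤ _ := mul_le_mul_of_nonneg_right (le_add_of_nonneg_left hc'.le) (norm_nonneg _)
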